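/- arXiv:2004.08266 — 2 statements merged into one kernel-verified Lean document; each statement's English description precedes it below -/
import Mathlib

section
/- Let δ ∈ {1, 2} and suppose n = δ·p₁⋯p_t·q₁⋯q_s, where p₁,…,p_t are distinct primes ≡ 1 (mod 4), q₁,…,q_s are distinct primes ≡ 3 (mod 4), all coprime to l, t ≥ 1, and s ≥ 1 is odd. Let h be the number of prime ideals of k lying above p₁⋯p_t (so h = t + #{i : (p_i/l) = 1}), and write s₁ = #{j : (q_j/l) = −1} and s₂ = #{j : (q_j/l) = 1}, so s = s₁ + s₂. Then r₂(H) = h + s₁ + 2s₂. -/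
/-- `ε` is the fundamental unit of the real quadratic field `ℚ(√l)` (viewed inside `ℝ`):
it lies in `ℚ(√l)`, it is a unit of the ring of integers (both `ε` and `ε⁻¹` are
algebraic integers), `ε > 1`, and it is the smallest such unit. -/
def IsFundamentalUnit (l : ℕ) (ε : ℝ) : Prop :=
  1 < ε ∧ ε ∈ IntermediateField.adjoin ℚ ({Real.sqrt (l : ℝ)} : Set ℝ) ∧
    IsIntegral ℤ ε ∧ IsIntegral ℤ ε⁻¹ ∧
    ∀ x : ℝ, 1 < x → x ∈ IntermediateField.adjoin ℚ ({Real.sqrt (l : ℝ)} : Set ℝ) →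
      IsIntegral ℤ x → IsIntegral ℤ x⁻¹ → ε ≤ x

/-- The Legendre symbol `(a/p)`, via Euler's criterion (so that no `Fact p.Prime`
instance is needed): for an odd prime `p` it is `1` if `a` is a nonzero square mod `p`,
`0` if `p ∣ a`, and `-1` otherwise. -/
def legSym (p : ℕ) (a : ℤ) : ℤ :=
  if (a : ZMod p) ^ ((p - 1) / 2) = 1 then 1 else if (a : ZMod p) = 0 then 0 else -1

/-- The rational fourth power residue symbol `(a/p)₄ ∈ {±1}`, meaningful when
`(a/p) = 1`; it is determined by `(a/p)₄ ≡ a ^ ((p-1)/4) (mod p)`. -/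
def quartSym (p : ℕ) (a : ℤ) : ℤ :=
  if (a : ZMod p) ^ ((p - 1) / 4) = 1 then 1 else -1

/-- The cardinality of the 2-torsion subgroup of the class group of `K`.
For a number field `K` this equals `2 ^ r₂(H)`, where `r₂(H)` is the rank of the
2-class group `H` of `K` (i.e. `dim_{𝔽₂} Cl(K)/Cl(K)²`); in particular
`r₂(H) = r` iff this cardinality is `2 ^ r`. -/
noncomputable def twoTorsCard (K : IntermediateField ℚ ℝ) : ℕ :=
  Nat.card {x : ClassGroup (NumberField.RingOfIntegers K) // x ^ 2 = 1}

section

open scoped Pointwise nonZeroDivisors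

section Involution

variable {A B G : Type*} [CommRing A] [IsDedekindDomain A] [CommRing B] [IsDedekindDomain B]
  [Algebra A B] [Module.Finite A B] [Module.IsTorsionFree A B] [Group G] [MulSemiringAction G B]
  [IsGaloisGroup G A B]

theorem eq_one_or_eq_of_card_two (hG : Nat.card G = 2) {σ : G} (hσ : σ ≠ 1) (g : G) :
    g = 1 ∨ g = σ := by
  by_contra! h
  have : Finite G := Nat.finite_of_card_ne_zero (by omega)
  have : Fintype G := Fintype.ofFinite G
  classical
  have h3 : ({1, σ, g} : Finset G).card = 3 := by
    rw [Finset.card_eq_three]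
    exact ⟨1, σ, g, hσ.symm, h.1.symm, h.2.symm, rfl⟩
  have := Finset.card_le_univ ({1, σ, g} : Finset G)
  rw [h3, ← Nat.card_eq_fintype_card, hG] at this
  omega

theorem mul_self_eq_one_of_card_two (hG : Nat.card G = 2) (σ : G) : σ * σ = 1 := by
  rw [← sq, ← hG]
  exact pow_card_eq_one'

theorem prime_splitting_trichotomy (hG : Nat.card G = 2) {σ : G} (hσ : σ ≠ 1) (P : Ideal B)
    [hPp : P.IsPrime] (hP : P ≠ ⊥) :
    (σ • P = P ∧ (P.under A).map (algebraMap A B) = P) ∨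
    (σ • P = P ∧ (P.under A).map (algebraMap A B) = P ^ 2 ∧
      ∀ x : B, ∃ a : A, x - algebraMap A B a ∈ P) ∨
    (σ • P ≠ P ∧ (P.under A).map (algebraMap A B) = P * σ • P) := by
  classical
  have : Finite G := Nat.finite_of_card_ne_zero (by omega)
  set p := P.under A with hp
  have hpp : p.IsPrime := inferInstance
  have hp0 : p ≠ ⊥ := by
    rw [hp]; exact Ideal.IsIntegral.comap_ne_bot A hP
  have hpm : p.IsMaximal := hpp.isMaximal hp0
  have hfund := Ideal.ncard_primesOver_mul_ramificationIdxIn_mul_inertiaDegIn p B G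
  rw [hG, Ideal.ramificationIdxIn_eq_ramificationIdx p P G, Ideal.inertiaDegIn_eq_inertiaDeg p P G]
    at hfund
  have hprod := Ideal.map_algebraMap_eq_finsetProd_pow (R := B) hp0
  have hPs : (σ • P).IsPrime := inferInstance
  have hlo : (σ • P).LiesOver p := inferInstance
  have hset : p.primesOver B = {P, σ • P} := by
    ext Q
    constructor
    · rintro ⟨hQ, hQ'⟩
      obtain ⟨g, hg⟩ := Ideal.exists_smul_eq_of_isGaloisGroup p P Q G
      rcases eq_one_or_eq_of_card_two hG hσ g with rfl | rfl
      · left; simpa using hg.symm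
      · right; exact hg.symm
    · rintro (rfl | rfl)
      · exact ⟨hPp, inferInstance⟩
      · exact ⟨hPs, hlo⟩
  have hram : ∀ Q : Ideal B, Q ∈ p.primesOver B → Q.ramificationIdx A = P.ramificationIdx A := by
    rintro Q ⟨hQ, hQ'⟩
    exact Ideal.ramificationIdx_eq_of_isGaloisGroup p Q P G
  have hprod' : p.map (algebraMap A B) = ∏ Q ∈ (p.primesOver B).toFinset, Q ^ P.ramificationIdx A := by
    rw [hprod]
    refine Finset.prod_congr rfl fun Q hQ => ?_
    rw [hram Q (by simpa using hQ)]
  by_cases hs : σ • P = P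
  · have hset' : (p.primesOver B).toFinset = {P} := by
      ext Q; simp [hset, hs]
    have hn : (p.primesOver B).ncard = 1 := by rw [hset, hs]; simp
    rw [hset', Finset.prod_singleton] at hprod'
    rw [hn, one_mul] at hfund
    have : P.ramificationIdx A ∣ 2 := ⟨_, hfund.symm⟩
    rcases (Nat.dvd_prime Nat.prime_two).1 this with h1 | h2
    · left; rw [h1, pow_one] at hprod'; exact ⟨hs, hprod'⟩
    · right; left
      rw [h2] at hprod' hfund
      refine ⟨hs, hprod', fun x => ?_⟩
      have hPm : P.IsMaximal := hPp.isMaximal hP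
      have hf : P.inertiaDeg A = 1 := by omega
      rw [Ideal.inertiaDeg_eq_of_isMaximal p P] at hf
      let : Field (A ⧸ p) := Ideal.Quotient.field p
      obtain ⟨c, hc⟩ := (finrank_eq_one_iff_of_nonzero' (K := A ⧸ p) (1 : B ⧸ P) one_ne_zero).1 hf
        (Ideal.Quotient.mk P x)
      obtain ⟨a, rfl⟩ := Ideal.Quotient.mk_surjective c
      refine ⟨a, ?_⟩
      rw [← Ideal.Quotient.eq, ← hc, Algebra.smul_def, mul_one]
      rfl
  · right; right
    refine ⟨hs, ?_⟩
    have hset' : (p.primesOver B).toFinset = {P, σ • P} := by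
      ext Q; simp [hset]
    have hn : (p.primesOver B).ncard = 2 := by
      rw [hset, Set.ncard_pair (Ne.symm hs)]
    rw [hn] at hfund
    have : P.ramificationIdx A = 1 := Nat.eq_one_of_mul_eq_one_right
      (show P.ramificationIdx A * P.inertiaDeg A = 1 by omega)
    rw [hprod', hset', Finset.prod_pair (Ne.symm hs), this, pow_one, pow_one]


theorem ideal_map_injective :
    Function.Injective (Ideal.map (algebraMap A B)) := by
  intro I J h
  rw [← Ideal.comap_map_eq_self_of_faithfullyFlat (B := B) I, h,
    Ideal.comap_map_eq_self_of_faithfullyFlat]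

variable (A B) in
/-- The nonzero primes of `B` whose square is extended from `A`; these are the ramified primes
when `B` is quadratic over `A`. -/
def sqRamified : Set (Ideal B) :=
  {P | P.IsPrime ∧ P ≠ ⊥ ∧ (P.under A).map (algebraMap A B) = P ^ 2}

theorem ne_sq_of_prime {P : Ideal B} (hPp : P.IsPrime) (hP : P ≠ ⊥) : P ≠ P ^ 2 := by
  intro h
  have h1 : P * 1 = P * P := by rw [mul_one, ← sq]; exact h
  exact hPp.ne_top ((mul_left_cancel₀ hP h1).symm.trans Ideal.one_eq_top)

theorem mem_sqRamified_of_quadratic (hG : Nat.card G = 2) {σ : G} (hσ : σ ≠ 1) (P : Ideal B)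
    (hPp : P.IsPrime) (hP : P ≠ ⊥) (x : B) (T N : A)
    (hx : x ^ 2 = algebraMap A B T * x - algebraMap A B N)
    (hT : T ∈ P.under A) (hN : N ∈ P.under A) (hN2 : N ∉ (P.under A) ^ 2) :
    P ∈ sqRamified A B := by
  refine ⟨hPp, hP, ?_⟩
  by_contra hne
  set p := P.under A with hp
  have hT' : algebraMap A B T ∈ p.map (algebraMap A B) := Ideal.mem_map_of_mem _ hT
  have hN' : algebraMap A B N ∈ p.map (algebraMap A B) := Ideal.mem_map_of_mem _ hN
  have hx2 : x ^ 2 ∈ p.map (algebraMap A B) := by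
    rw [hx]; exact sub_mem (Ideal.mul_mem_right _ _ hT') hN'
  have hxp : x ∈ p.map (algebraMap A B) := by
    rcases prime_splitting_trichotomy (A := A) hG hσ P hP with ⟨-, h⟩ | ⟨-, h, -⟩ | ⟨hs, h⟩
    · rw [h] at hx2 ⊢
      exact hPp.mem_of_pow_mem 2 hx2
    · exact absurd h hne
    · rw [h] at hx2 ⊢
      have hPs : (σ • P).IsPrime := inferInstance
      have hPm := hPp.isMaximal hP
      have hPs0 : σ • P ≠ ⊥ := by
        rw [← Ideal.zero_eq_bot] at hP ⊢
        exact (smul_ne_zero_iff_ne σ).2 hP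
      have hPsm := hPs.isMaximal hPs0
      rw [Ideal.mul_eq_inf_of_coprime (hPm.coprime_of_ne hPsm (Ne.symm hs))] at hx2 ⊢
      exact ⟨hPp.mem_of_pow_mem 2 hx2.1, hPs.mem_of_pow_mem 2 hx2.2⟩
  apply hN2
  have : algebraMap A B N ∈ (p ^ 2).map (algebraMap A B) := by
    have e : algebraMap A B N = algebraMap A B T * x - x * x := by rw [← sq, hx]; ring
    rw [e, Ideal.map_pow, sq]
    exact sub_mem (Ideal.mul_mem_mul hT' hxp) (Ideal.mul_mem_mul hxp hxp)
  rw [← Ideal.comap_map_eq_self_of_faithfullyFlat (B := B) (p ^ 2)]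
  exact this

theorem smul_sub_mem_of_mem_sqRamified (hG : Nat.card G = 2) {σ : G} (hσ : σ ≠ 1) {P : Ideal B}
    (h : P ∈ sqRamified A B) : σ • P = P ∧ ∀ x : B, σ • x - x ∈ P := by
  obtain ⟨hPp, hP, h2⟩ := h
  have hPs : (σ • P).IsPrime := inferInstance
  rcases prime_splitting_trichotomy (A := A) hG hσ P hP with ⟨-, h⟩ | ⟨hs, h, hx⟩ | ⟨hs, h⟩
  · exact absurd (h.symm.trans h2) (ne_sq_of_prime hPp hP)
  · refine ⟨hs, fun x => ?_⟩
    obtain ⟨a, ha⟩ := hx x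
    have h1 : σ • (x - algebraMap A B a) ∈ P := by
      rw [← hs]; exact Ideal.smul_mem_pointwise_smul _ _ _ ha
    have : SMulCommClass G A B := IsGaloisGroup.commutes
    rw [smul_sub, smul_algebraMap] at h1
    have := sub_mem h1 ha
    convert this using 1
    ring
  · exfalso
    rw [h, sq] at h2
    exact hs (mul_left_cancel₀ hP h2)

end Involution

section Involution

variable {A B G : Type*} [CommRing A] [IsDedekindDomain A] [CommRing B] [IsDedekindDomain B]
  [Algebra A B] [Module.Finite A B] [Module.IsTorsionFree A B] [Group G] [MulSemiringAction G B]
  [IsGaloisGroup G A B]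

theorem exists_eq_map_mul_prod_of_smul_eq (hG : Nat.card G = 2) {σ : G} (hσ : σ ≠ 1)
    [Fintype (sqRamified A B)] (I : Ideal B) (hI : I ≠ ⊥) (hσI : σ • I = I) :
    ∃ J : Ideal A, J ≠ ⊥ ∧ ∃ f : sqRamified A B → ℕ,
      I = J.map (algebraMap A B) * ∏ P, P.1 ^ f P := by
  classical
  induction I using WellFoundedGT.induction with
  | ind I ih =>
  by_cases htop : I = ⊤
  · exact ⟨⊤, top_ne_bot, 0, by
      simp only [htop, Ideal.map_top, Pi.zero_apply, pow_zero, Finset.prod_const_one, mul_one]⟩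
  obtain ⟨P, hPm, hIP⟩ := Ideal.exists_le_maximal I htop
  have hPp := hPm.isPrime
  have hP : P ≠ ⊥ := fun h => hI (le_bot_iff.1 (h ▸ hIP))
  have hp0 : P.under A ≠ ⊥ := Ideal.IsIntegral.comap_ne_bot A hP
  have step : ∀ Q I' : Ideal B, I = Q * I' → σ • Q = Q → Q ≠ ⊤ →
      ∃ J : Ideal A, J ≠ ⊥ ∧ ∃ f : sqRamified A B → ℕ,
      I' = J.map (algebraMap A B) * ∏ P, P.1 ^ f P := by
    rintro Q I' rfl hQ hQt
    have hQ0 : Q ≠ ⊥ := by rintro rfl; simp at hI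
    have hI'0 : I' ≠ ⊥ := by rintro rfl; simp at hI
    refine ih I' (lt_of_le_of_ne Ideal.mul_le_right ?_) hI'0 ?_
    · intro h
      have : Q * I' = 1 * I' := by rw [h, one_mul]
      exact hQt ((mul_right_cancel₀ hI'0 this).trans Ideal.one_eq_top)
    · rw [smul_mul', hQ] at hσI
      exact mul_left_cancel₀ hQ0 hσI
  rcases prime_splitting_trichotomy (A := A) hG hσ P hP with ⟨hs, h⟩ | ⟨hs, h, -⟩ | ⟨hs, h⟩
  · obtain ⟨I', rfl⟩ := Ideal.dvd_iff_le.2 hIP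
    obtain ⟨J, hJ, f, rfl⟩ := step P I' rfl hs hPp.ne_top
    refine ⟨P.under A * J, mul_ne_zero hp0 hJ, f, ?_⟩
    rw [Ideal.map_mul, h, mul_assoc]
  · obtain ⟨I', rfl⟩ := Ideal.dvd_iff_le.2 hIP
    obtain ⟨J, hJ, f, rfl⟩ := step P I' rfl hs hPp.ne_top
    let P' : sqRamified A B := ⟨P, hPp, hP, h⟩
    refine ⟨J, hJ, f + Pi.single P' 1, ?_⟩
    simp only [Pi.add_apply, pow_add, Finset.prod_mul_distrib]
    rw [Finset.prod_eq_single (f := fun Q : sqRamified A B => Q.1 ^ (Pi.single P' 1 : _ → ℕ) Q) P'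
      (by intro Q _ hQ; rw [Pi.single_eq_of_ne hQ, pow_zero]) (by simp), Pi.single_eq_same, pow_one]
    change P * _ = _ * (_ * P)
    ring
  · have hPs : (σ • P).IsPrime := inferInstance
    have hPs0 : σ • P ≠ ⊥ := by
      rw [← Ideal.zero_eq_bot] at hP ⊢
      exact (smul_ne_zero_iff_ne σ).2 hP
    have hPsm := hPs.isMaximal hPs0
    have hle : I ≤ P * σ • P := by
      rw [Ideal.mul_eq_inf_of_coprime (hPm.coprime_of_ne hPsm (Ne.symm hs))]
      refine le_inf hIP ?_
      rw [← hσI]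
      exact Ideal.map_mono hIP
    obtain ⟨I', hI'⟩ := Ideal.dvd_iff_le.2 hle
    obtain ⟨J, hJ, f, rfl⟩ := step _ I' hI'
      (by rw [smul_mul', ← mul_smul, mul_self_eq_one_of_card_two hG, one_smul, mul_comm])
      (fun h' => hPp.ne_top (top_le_iff.1 (h' ▸ Ideal.mul_le_left)))
    refine ⟨P.under A * J, mul_ne_zero hp0 hJ, f, ?_⟩
    rw [hI', Ideal.map_mul, h, ← mul_assoc]

theorem exists_mul_smul_eq_map (hG : Nat.card G = 2) {σ : G} (hσ : σ ≠ 1) (I : Ideal B)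
    (hI : I ≠ ⊥) : ∃ J : Ideal A, J ≠ ⊥ ∧ I * σ • I = J.map (algebraMap A B) := by
  induction I using WellFoundedGT.induction with
  | ind I ih =>
  by_cases htop : I = ⊤
  · refine ⟨⊤, top_ne_bot, ?_⟩
    rw [htop, Ideal.map_top, ← Ideal.one_eq_top, smul_one, one_mul]
  obtain ⟨P, hPm, hIP⟩ := Ideal.exists_le_maximal I htop
  have hPp := hPm.isPrime
  have hP : P ≠ ⊥ := fun h => hI (le_bot_iff.1 (h ▸ hIP))
  have hp0 : P.under A ≠ ⊥ := Ideal.IsIntegral.comap_ne_bot A hP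
  obtain ⟨I', rfl⟩ := Ideal.dvd_iff_le.2 hIP
  have hI'0 : I' ≠ ⊥ := by rintro rfl; simp at hI
  obtain ⟨J, hJ, hIJ⟩ := ih I' (lt_of_le_of_ne Ideal.mul_le_right (by
    intro h
    have : P * I' = 1 * I' := by rw [h, one_mul]
    exact hPp.ne_top ((mul_right_cancel₀ hI'0 this).trans Ideal.one_eq_top))) hI'0
  have hPP : ∃ q : Ideal A, q ≠ ⊥ ∧ P * σ • P = q.map (algebraMap A B) := by
    rcases prime_splitting_trichotomy (A := A) hG hσ P hP with ⟨hs, h⟩ | ⟨hs, h, -⟩ | ⟨hs, h⟩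
    · exact ⟨P.under A * P.under A, mul_ne_zero hp0 hp0, by rw [hs, Ideal.map_mul, h]⟩
    · exact ⟨P.under A, hp0, by rw [hs, h, sq]⟩
    · exact ⟨P.under A, hp0, h.symm⟩
  obtain ⟨q, hq, hPq⟩ := hPP
  refine ⟨q * J, mul_ne_zero hq hJ, ?_⟩
  rw [Ideal.map_mul, ← hPq, ← hIJ, smul_mul']
  ring

end Involution

section Involution

variable {A B G : Type*} [CommRing A] [IsDedekindDomain A] [CommRing B] [IsDedekindDomain B]
  [Algebra A B] [Module.Finite A B] [Module.IsTorsionFree A B] [Group G] [MulSemiringAction G B]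
  [IsGaloisGroup G A B]

theorem smul_span_singleton {B G : Type*} [CommRing B] [Group G] [MulSemiringAction G B]
    (σ : G) (a : B) : σ • Ideal.span {a} = Ideal.span {σ • a} := by
  rw [Ideal.pointwise_smul_def, Ideal.map_span, Set.image_singleton]
  rfl

theorem exists_algebraMap_eq_of_smul_eq (hG : Nat.card G = 2) {σ : G} (hσ : σ ≠ 1) {x : B}
    (hx : σ • x = x) : ∃ y : A, algebraMap A B y = x := by
  have := IsGaloisGroup.isInvariant (G := G) (A := A) (B := B)
  refine Algebra.IsInvariant.isInvariant (A := A) (G := G) x fun g => ?_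
  rcases eq_one_or_eq_of_card_two hG hσ g with rfl | rfl
  · exact one_smul _ _
  · exact hx

theorem smul_smul_of_card_two (hG : Nat.card G = 2) (σ : G) {X : Type*} [MulAction G X] (x : X) :
    σ • σ • x = x := by
  rw [← mul_smul, mul_self_eq_one_of_card_two hG, one_smul]

theorem exists_algebraMap_eq_mul_smul (hG : Nat.card G = 2) {σ : G} (hσ : σ ≠ 1) (x : B) :
    ∃ y : A, algebraMap A B y = x * σ • x :=
  exists_algebraMap_eq_of_smul_eq hG hσ
    (by rw [smul_mul', smul_smul_of_card_two hG, mul_comm])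

/-- A 2-torsion ideal class contains an invariant ideal, provided the class group of the base
has no 2-torsion and unit norms of elements are norms of units. -/
theorem exists_smul_eq_mk0_eq_of_sq_eq_one (hG : Nat.card G = 2) {σ : G} (hσ : σ ≠ 1)
    (hCl : ∀ J : Ideal A, J ≠ ⊥ → (J ^ 2).IsPrincipal → J.IsPrincipal)
    (hU : ∀ η : Aˣ, (∃ a b : B, b ≠ 0 ∧ a * σ • a = algebraMap A B η * (b * σ • b)) →
      ∃ e : Bˣ, (e : B) * σ • (e : B) = algebraMap A B η)
    (c : ClassGroup B) (hc : c ^ 2 = 1) :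
    ∃ I : (Ideal B)⁰, σ • (I : Ideal B) = I ∧ ClassGroup.mk0 I = c := by
  obtain ⟨I, rfl⟩ := ClassGroup.mk0_surjective c
  have hI0 : (I : Ideal B) ≠ ⊥ := nonZeroDivisors.coe_ne_zero I
  have : SMulCommClass G A B := IsGaloisGroup.commutes
  have hinj : Function.Injective (algebraMap A B) := FaithfulSMul.algebraMap_injective A B
  rw [← map_pow, ClassGroup.mk0_eq_one_iff] at hc
  obtain ⟨a, ha⟩ := hc
  rw [Ideal.submodule_span_eq, SubmonoidClass.coe_pow] at ha
  obtain ⟨J, hJ0, hJ⟩ := exists_mul_smul_eq_map (A := A) hG hσ I.1 hI0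
  obtain ⟨b, hb⟩ := exists_algebraMap_eq_mul_smul (A := A) hG hσ a
  have hJ2 : J ^ 2 = Ideal.span {b} := by
    apply ideal_map_injective (B := B)
    rw [Ideal.map_pow, ← hJ, mul_pow, ← smul_pow', ha, smul_span_singleton, Ideal.map_span,
      Set.image_singleton, hb, Ideal.span_singleton_mul_span_singleton]
  obtain ⟨g, hg⟩ := hCl J hJ0 ⟨b, hJ2⟩
  rw [Ideal.submodule_span_eq] at hg
  have hg0 : g ≠ 0 := by rintro rfl; simp at hg; exact hJ0 hg
  have hassoc : Associated (g ^ 2) b := by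
    rw [← Ideal.span_singleton_eq_span_singleton, ← hJ2, hg, Ideal.span_singleton_pow]
  obtain ⟨η, hη⟩ := hassoc
  obtain ⟨e, he⟩ := hU η ⟨a, algebraMap A B g, (map_ne_zero_iff _ hinj).2 hg0, by
    rw [← hb, ← hη, smul_algebraMap, map_mul, map_pow]; ring⟩
  obtain ⟨a', rfl⟩ : ∃ a', a = a' * e := ⟨a * (e⁻¹ : Bˣ), by simp⟩
  have hnorm : a' * σ • a' = (algebraMap A B g) ^ 2 := by
    have h1 : (a' * σ • a') * (algebraMap A B η) = (algebraMap A B g) ^ 2 * algebraMap A B η := by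
      rw [← map_pow, ← map_mul, hη, hb, ← he, smul_mul']; ring
    exact (η.isUnit.map (algebraMap A B)).mul_right_cancel h1
  have ha' : (I : Ideal B) * I = Ideal.span {a'} := by
    rw [← sq, ha, Ideal.span_singleton_mul_right_unit e.isUnit]
  have hJm : (I : Ideal B) * σ • (I : Ideal B) = Ideal.span {algebraMap A B g} := by
    rw [hJ, hg, Ideal.map_span, Set.image_singleton]
  have hspan0 : Ideal.span {a'} ≠ ⊥ := by rw [← ha']; exact mul_ne_zero hI0 hI0
  by_cases hγ : algebraMap A B g + a' = 0
  · refine ⟨I, ?_, rfl⟩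
    have : a' = -algebraMap A B g := by linear_combination hγ
    rw [this, Ideal.span_singleton_neg, ← hJm] at ha'
    exact (mul_left_cancel₀ hI0 ha').symm
  · set γ := algebraMap A B g + a'
    have hσγ : σ • γ ≠ 0 := (smul_ne_zero_iff_ne σ).2 hγ
    have hrel : a' * σ • γ = algebraMap A B g * γ := by
      simp only [γ, smul_add, smul_algebraMap]
      linear_combination hnorm
    have hs0 : Ideal.span {σ • γ} ≠ ⊥ := by simpa using hσγ
    refine ⟨⟨Ideal.span {σ • γ} * I, mem_nonZeroDivisors_of_ne_zero (mul_ne_zero hs0 hI0)⟩, ?_, ?_⟩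
    · change σ • (Ideal.span {σ • γ} * (I : Ideal B)) = Ideal.span {σ • γ} * I
      rw [smul_mul', smul_span_singleton, smul_smul_of_card_two hG]
      apply mul_left_cancel₀ hspan0
      rw [← mul_assoc, ← mul_assoc, Ideal.span_singleton_mul_span_singleton a' (σ • γ), hrel,
        ← Ideal.span_singleton_mul_span_singleton, ← hJm, ← ha']
      ring
    · rw [ClassGroup.mk0_eq_mk0_iff]
      exact ⟨1, σ • γ, one_ne_zero, hσγ, by simp⟩

end Involution

open UniqueFactorizationMonoid
section Involution

variable {A B G : Type*} [CommRing A] [IsDedekindDomain A] [CommRing B] [IsDedekindDomain B]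
  [Algebra A B] [Module.Finite A B] [Module.IsTorsionFree A B] [Group G] [MulSemiringAction G B]
  [IsGaloisGroup G A B]

open Classical in
/-- The exponent of `P` in the factorization of the ideal `I`. -/
noncomputable def idealVal {B : Type*} [CommRing B] [IsDedekindDomain B] (P I : Ideal B) : ℕ :=
  (normalizedFactors I).count P

section idealVal

variable {B : Type*} [CommRing B] [IsDedekindDomain B] {P Q I J : Ideal B}

theorem idealVal_one : idealVal P (1 : Ideal B) = 0 := by
  classical
  rw [idealVal, normalizedFactors_one, Multiset.count_zero]

theorem idealVal_mul (hI : I ≠ ⊥) (hJ : J ≠ ⊥) :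
    idealVal P (I * J) = idealVal P I + idealVal P J := by
  classical
  simp [idealVal, normalizedFactors_mul hI hJ]

theorem idealVal_pow (n : ℕ) : idealVal P (I ^ n) = n * idealVal P I := by
  classical
  simp [idealVal, normalizedFactors_pow]

theorem idealVal_self (hP : P.IsPrime) (hP0 : P ≠ ⊥) : idealVal P P = 1 := by
  classical
  rw [idealVal, normalizedFactors_irreducible (Ideal.prime_of_isPrime hP0 hP).irreducible]
  simp

theorem idealVal_eq_zero_of_not_le (h : ¬ I ≤ P) : idealVal P I = 0 := by
  classical
  refine Multiset.count_eq_zero.2 fun h' => h ?_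
  exact Ideal.dvd_iff_le.1 (dvd_of_mem_normalizedFactors h')

theorem idealVal_prod {ι : Type*} [Fintype ι] (F : ι → Ideal B) (hF : ∀ i, F i ≠ ⊥) :
    idealVal P (∏ i, F i) = ∑ i, idealVal P (F i) := by
  classical
  have key : ∀ s : Finset ι, idealVal P (∏ i ∈ s, F i) = ∑ i ∈ s, idealVal P (F i) := by
    intro s
    induction s using Finset.induction_on with
    | empty => rw [Finset.prod_empty, idealVal_one, Finset.sum_empty]
    | insert i s hi ih =>
      rw [Finset.prod_insert hi, Finset.sum_insert hi, idealVal_mul (hF i) _, ih]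
      exact Finset.prod_ne_zero_iff.2 fun j _ => hF j
  exact key _

end idealVal

theorem even_idealVal_map {P : Ideal B} (hP : P ∈ sqRamified A B) (J : Ideal A) (hJ : J ≠ ⊥) :
    Even (idealVal P (J.map (algebraMap A B))) := by
  obtain ⟨hPp, hP0, hP2⟩ := hP
  have hmap : ∀ I : Ideal A, I ≠ ⊥ → I.map (algebraMap A B) ≠ ⊥ := fun I hI h =>
    hI (ideal_map_injective (B := B) (by rw [h, Ideal.map_bot]))
  induction J using WellFoundedGT.induction with
  | ind J ih =>
  by_cases htop : J = ⊤
  · rw [htop, Ideal.map_top, ← Ideal.one_eq_top, idealVal_one]; exact Even.zero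
  obtain ⟨q, hqm, hJq⟩ := Ideal.exists_le_maximal J htop
  have hq0 : q ≠ ⊥ := fun h => hJ (le_bot_iff.1 (h ▸ hJq))
  obtain ⟨J', rfl⟩ := Ideal.dvd_iff_le.2 hJq
  have hJ'0 : J' ≠ ⊥ := by rintro rfl; simp at hJ
  have hlt : q * J' < J' := lt_of_le_of_ne Ideal.mul_le_right (by
    intro h
    have : q * J' = 1 * J' := by rw [h, one_mul]
    exact hqm.ne_top ((mul_right_cancel₀ hJ'0 this).trans Ideal.one_eq_top))
  rw [Ideal.map_mul, idealVal_mul (hmap q hq0) (hmap J' hJ'0)]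
  refine Even.add ?_ (ih J' hlt hJ'0)
  by_cases hle : q.map (algebraMap A B) ≤ P
  · have : q = P.under A := hqm.eq_of_le (Ideal.IsPrime.under A P).ne_top (Ideal.map_le_iff_le_comap.1 hle)
    rw [this, hP2, idealVal_pow, idealVal_self hPp hP0]
    exact even_two
  · rw [idealVal_eq_zero_of_not_le hle]; exact Even.zero

theorem idealVal_prod_pow [Fintype (sqRamified A B)] (f : sqRamified A B → ℕ)
    (P : sqRamified A B) : idealVal P.1 (∏ Q : sqRamified A B, Q.1 ^ f Q) = f P := by
  rw [idealVal_prod _ fun Q => pow_ne_zero _ Q.2.2.1, Finset.sum_eq_single P]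
  · rw [idealVal_pow, idealVal_self P.2.1 P.2.2.1, mul_one]
  · intro Q _ hQ
    rw [idealVal_pow, idealVal_eq_zero_of_not_le, mul_zero]
    intro hle
    exact hQ (Subtype.ext ((Q.2.1.isMaximal Q.2.2.1).eq_of_le P.2.1.ne_top hle))
  · simp

theorem idealVal_map_mul_prod_pow_mod [Fintype (sqRamified A B)] (J : Ideal A) (hJ : J ≠ ⊥)
    (f : sqRamified A B → ℕ) (P : sqRamified A B) :
    (idealVal P.1 (J.map (algebraMap A B) * ∏ Q : sqRamified A B, Q.1 ^ f Q) : ZMod 2) = f P := by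
  have hJ' : J.map (algebraMap A B) ≠ ⊥ := fun h =>
    hJ (ideal_map_injective (B := B) (by rw [h, Ideal.map_bot]))
  rw [idealVal_mul hJ' (Finset.prod_ne_zero_iff.2 fun Q _ => pow_ne_zero _ Q.2.2.1),
    idealVal_prod_pow, Nat.cast_add, (ZMod.natCast_eq_zero_iff_even).2 (even_idealVal_map P.2 J hJ),
    zero_add]

/-- The units of `B` of relative norm one. -/
def normOneUnits (B : Type*) {G : Type*} [CommRing B] [Group G] [MulSemiringAction G B] (σ : G) : Subgroup Bˣ where
  carrier := {u | (u : B) * σ • (u : B) = 1}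
  one_mem' := by simp
  mul_mem' := by
    intro u v hu hv
    simp only [Set.mem_ofPred_eq, Units.val_mul, smul_mul'] at *
    linear_combination (v * σ • (v : B)) * hu + hv
  inv_mem' := by
    intro u hu
    simp only [Set.mem_ofPred_eq] at *
    have h1 : (u : B) * σ • (u : B) * ((u⁻¹ : Bˣ) * σ • ((u⁻¹ : Bˣ) : B)) = 1 := by
      rw [mul_mul_mul_comm, ← smul_mul']; simp
    rwa [hu, one_mul] at h1

end Involution

section Involution

variable {A B G : Type*} [CommRing A] [IsDedekindDomain A] [CommRing B] [IsDedekindDomain B]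
  [Algebra A B] [Module.Finite A B] [Module.IsTorsionFree A B] [Group G] [MulSemiringAction G B]
  [IsGaloisGroup G A B]

/-- For `a = u σ(a)` with `u` of norm one, the ramified valuations of `a` are all even exactly
when `u` is a square of a unit of norm one. -/
theorem forall_even_idealVal_iff (hG : Nat.card G = 2) {σ : G} (hσ : σ ≠ 1)
    [Fintype (sqRamified A B)] {m : ℕ} (hm : Odd m)
    (hCl : ∀ J : Ideal A, J ≠ ⊥ → (J ^ m).IsPrincipal)
    (hN : ∀ w : Bˣ, ∃ e : Aˣ, (w : B) * σ • (w : B) = algebraMap A B (e ^ 2 : Aˣ))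
    {a : B} (ha : a ≠ 0) {u : normOneUnits B σ} (hu : a = (u : Bˣ) * σ • a) :
    (∀ P : sqRamified A B, Even (idealVal P.1 (Ideal.span {a}))) ↔ ∃ v, u = v ^ 2 := by
  have : SMulCommClass G A B := IsGaloisGroup.commutes
  have hinj : Function.Injective (algebraMap A B) := FaithfulSMul.algebraMap_injective A B
  have ha0 : Ideal.span {a} ≠ ⊥ := by simpa using ha
  constructor
  · intro h
    have hinv : σ • Ideal.span {a} = Ideal.span {a} := by
      rw [smul_span_singleton]
      conv_rhs => rw [hu, Ideal.span_singleton_mul_left_unit (u : Bˣ).isUnit]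
    obtain ⟨J, hJ, f, hf⟩ := exists_eq_map_mul_prod_of_smul_eq (A := A) hG hσ _ ha0 hinv
    have hfe : ∀ P, Even (f P) := fun P => by
      rw [← ZMod.natCast_eq_zero_iff_even, ← idealVal_map_mul_prod_pow_mod J hJ f P, ← hf,
        ZMod.natCast_eq_zero_iff_even]
      exact h P
    choose k hk using fun P => (hfe P)
    have hJ' : Ideal.span {a} =
        (J * ∏ P : sqRamified A B, (P.1.under A) ^ k P).map (algebraMap A B) := by
      rw [hf, Ideal.map_mul, ← Ideal.mapHom_apply (algebraMap A B) (∏ P : sqRamified A B, (P.1.under A) ^ k P),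
        map_prod]
      congr 1
      refine Finset.prod_congr rfl fun P _ => ?_
      rw [map_pow, Ideal.mapHom_apply, P.2.2.2, ← pow_mul, hk P, two_mul]
    set J' := J * ∏ P : sqRamified A B, (P.1.under A) ^ k P
    have hJ'0 : J' ≠ ⊥ := by
      rintro h0
      rw [h0, Ideal.map_bot] at hJ'
      exact ha0 hJ'
    obtain ⟨b, hb⟩ := hCl J' hJ'0
    rw [Ideal.submodule_span_eq] at hb
    have hassoc : Associated (algebraMap A B b) (a ^ m) := by
      rw [← Ideal.span_singleton_eq_span_singleton, ← Ideal.span_singleton_pow, hJ',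
        ← Ideal.map_pow, hb, Ideal.map_span, Set.image_singleton]
    obtain ⟨w, hw⟩ := hassoc
    obtain ⟨e, he⟩ := hN w
    have hb0 : algebraMap A B b ≠ 0 := by
      rintro h0
      rw [h0, zero_mul] at hw
      exact pow_ne_zero _ ha hw.symm
    have hwu : (w : B) = (u : Bˣ) ^ m * σ • (w : B) := by
      apply mul_left_cancel₀ hb0
      calc algebraMap A B b * w = a ^ m := hw
        _ = ((u : Bˣ) * σ • a) ^ m := by rw [← hu]
        _ = (u : Bˣ) ^ m * σ • (a ^ m) := by rw [mul_pow, smul_pow']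
        _ = (u : Bˣ) ^ m * (algebraMap A B b * σ • (w : B)) := by
          rw [← hw, smul_mul', smul_algebraMap]
        _ = _ := by ring
    let e' : Bˣ := Units.map (algebraMap A B) e
    have he' : σ • (e' : B) = e' := smul_algebraMap σ (e : A)
    have hee : (w : B) * σ • (w : B) = e' ^ 2 := by rw [he]; simp [e']
    have hinv' : (e' : B) * (e'⁻¹ : Bˣ) = 1 := e'.mul_inv
    have hinv'' : σ • ((e'⁻¹ : Bˣ) : B) = (e'⁻¹ : Bˣ) := by
      have h1 := congrArg (σ • ·) hinv'
      simp only [smul_mul', he', smul_one] at h1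
      exact e'.isUnit.mul_left_cancel (h1.trans hinv'.symm)
    let w₁ : normOneUnits B σ := ⟨w * e'⁻¹, by
      change ((w * e'⁻¹ : Bˣ) : B) * σ • ((w * e'⁻¹ : Bˣ) : B) = 1
      rw [Units.val_mul, smul_mul', hinv'']
      linear_combination ((e'⁻¹ : Bˣ) : B) ^ 2 * hee + ((e' : B) * (e'⁻¹ : Bˣ) + 1) * hinv'⟩
    have hw₁ : u ^ m = w₁ ^ 2 := by
      apply Subtype.ext
      apply Units.ext
      change ((u : Bˣ) : B) ^ m = ((w * e'⁻¹ : Bˣ) : B) ^ 2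
      rw [Units.val_mul]
      have hsw : IsUnit (σ • (w : B)) := w.isUnit.map (MulSemiringAction.toRingHom G B σ)
      apply hsw.mul_right_cancel
      rw [← hwu]
      linear_combination (-(w : B) * ((e'⁻¹ : Bˣ) : B) ^ 2) * hee -
        w * ((e' : B) * (e'⁻¹ : Bˣ) + 1) * hinv'
    obtain ⟨r, rfl⟩ := hm
    refine ⟨w₁ * (u ^ r)⁻¹, ?_⟩
    rw [mul_pow, ← hw₁, inv_pow, ← pow_mul, mul_comm r 2, pow_succ, mul_inv_cancel_comm]
  · rintro ⟨v, rfl⟩ P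
    have hv : ((v : Bˣ) : B) * σ • ((v : Bˣ) : B) = 1 := v.2
    have hvi : ((v : Bˣ) : B) * ((v : Bˣ)⁻¹ : Bˣ) = 1 := (v : Bˣ).mul_inv
    have hsvi : σ • (((v : Bˣ)⁻¹ : Bˣ) : B) = (v : Bˣ) := by
      have h1 := congrArg (σ • ·) hvi
      simp only [smul_mul', smul_one] at h1
      calc _ = ((v : Bˣ) : B) * σ • ((v : Bˣ) : B) * σ • (((v : Bˣ)⁻¹ : Bˣ) : B) := by
            rw [hv, one_mul]
        _ = _ := by rw [mul_assoc, h1, mul_one]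
    obtain ⟨b, hb⟩ := exists_algebraMap_eq_of_smul_eq (A := A) hG hσ
      (x := a * ((v : Bˣ)⁻¹ : Bˣ)) (by
        rw [smul_mul', hsvi]
        conv_rhs => rw [hu]
        simp only [SubmonoidClass.coe_pow, Units.val_pow_eq_pow_val]
        linear_combination (-(σ • a) * (v : Bˣ)) * hvi)
    have : Ideal.span {a} = (Ideal.span {b}).map (algebraMap A B) := by
      rw [Ideal.map_span, Set.image_singleton, hb,
        Ideal.span_singleton_mul_right_unit ((v : Bˣ)⁻¹ : Bˣ).isUnit]
    rw [this]
    refine even_idealVal_map P.2 _ fun h0 => ?_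
    rw [h0, Ideal.map_bot] at this
    exact ha0 this

end Involution

theorem Nat.card_eq_of_surjective_of_eq_iff {D X Y : Type*} {f : D → X} {g : D → Y}
    (hf : Function.Surjective f) (hg : Function.Surjective g)
    (h : ∀ a b, f a = f b ↔ g a = g b) : Nat.card X = Nat.card Y := by
  refine Nat.card_eq_of_bijective (fun x => g (Function.surjInv hf x)) ⟨fun x y hxy => ?_, fun y => ?_⟩
  · rw [← Function.surjInv_eq hf x, ← Function.surjInv_eq hf y]
    exact (h _ _).2 hxy
  · obtain ⟨d, rfl⟩ := hg y
    exact ⟨f d, (h _ _).1 (Function.surjInv_eq hf _)⟩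

section Involution

variable {A B G : Type*} [CommRing A] [IsDedekindDomain A] [CommRing B] [IsDedekindDomain B]
  [Algebra A B] [Module.Finite A B] [Module.IsTorsionFree A B] [Group G] [MulSemiringAction G B]
  [IsGaloisGroup G A B]

/-- The ideal class of a ramified prime. -/
noncomputable def ramClass (P : sqRamified A B) : ClassGroup B :=
  ClassGroup.mk0 ⟨P.1, mem_nonZeroDivisors_of_ne_zero P.2.2.1⟩

theorem ramClass_pow_sq {m : ℕ} (hCl : ∀ J : Ideal A, J ≠ ⊥ → (J ^ m).IsPrincipal)
    (P : sqRamified A B) : (ramClass P ^ m) ^ 2 = 1 := by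
  have := P.2.1
  obtain ⟨b, hb⟩ := hCl (P.1.under A) (Ideal.IsIntegral.comap_ne_bot A P.2.2.1)
  rw [ramClass, ← map_pow, ← map_pow, ClassGroup.mk0_eq_one_iff]
  refine ⟨algebraMap A B b, ?_⟩
  rw [SubmonoidClass.coe_pow, SubmonoidClass.coe_pow, ← pow_mul, mul_comm, pow_mul, ← P.2.2.2,
    ← Ideal.map_pow, hb, Ideal.submodule_span_eq, Ideal.submodule_span_eq, Ideal.map_span,
    Set.image_singleton]

/-- The homomorphism sending a parity vector `f` to the class of `∏ P ^ (m f(P))`. -/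
noncomputable def ramClassHom [Fintype (sqRamified A B)] {m : ℕ}
    (hCl : ∀ J : Ideal A, J ≠ ⊥ → (J ^ m).IsPrincipal) :
    Multiplicative (sqRamified A B → ZMod 2) →* ClassGroup B where
  toFun f := ∏ P, (ramClass P ^ m) ^ (f.toAdd P).val
  map_one' := by
    simp
  map_mul' f g := by
    rw [← Finset.prod_mul_distrib]
    refine Finset.prod_congr rfl fun P _ => ?_
    rw [toAdd_mul, Pi.add_apply, ZMod.val_add, ← pow_add]
    exact (pow_eq_pow_mod _ (ramClass_pow_sq hCl P)).symm

theorem ramClassHom_natCast [Fintype (sqRamified A B)] {m : ℕ}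
    (hCl : ∀ J : Ideal A, J ≠ ⊥ → (J ^ m).IsPrincipal) (f : sqRamified A B → ℕ) :
    ramClassHom hCl (Multiplicative.ofAdd fun P => (f P : ZMod 2)) =
      (∏ P, ramClass P ^ f P) ^ m := by
  rw [← Finset.prod_pow]
  refine Finset.prod_congr rfl fun P _ => ?_
  rw [toAdd_ofAdd, ZMod.val_natCast, ← pow_mul (ramClass P) (f P), mul_comm (f P), pow_mul]
  exact (pow_eq_pow_mod _ (ramClass_pow_sq hCl P)).symm

theorem mk0_pow_eq_of_eq_map_mul_prod [Fintype (sqRamified A B)] {m : ℕ}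
    (hCl : ∀ J : Ideal A, J ≠ ⊥ → (J ^ m).IsPrincipal) (I : (Ideal B)⁰) (J : Ideal A) (hJ : J ≠ ⊥)
    (f : sqRamified A B → ℕ)
    (h : (I : Ideal B) = J.map (algebraMap A B) * ∏ P : sqRamified A B, P.1 ^ f P) :
    ClassGroup.mk0 I ^ m = ramClassHom hCl (Multiplicative.ofAdd fun P => (f P : ZMod 2)) := by
  have hJ' : J.map (algebraMap A B) ≠ ⊥ := fun h =>
    hJ (ideal_map_injective (B := B) (by rw [h, Ideal.map_bot]))
  obtain ⟨b, hb⟩ := hCl J hJ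
  have hI : I = ⟨J.map (algebraMap A B), mem_nonZeroDivisors_of_ne_zero hJ'⟩ *
      ∏ P : sqRamified A B, (⟨P.1, mem_nonZeroDivisors_of_ne_zero P.2.2.1⟩ : (Ideal B)⁰) ^ f P := by
    apply Subtype.ext
    rw [h]
    simp
  have hJm : ClassGroup.mk0 (⟨J.map (algebraMap A B), mem_nonZeroDivisors_of_ne_zero hJ'⟩ :
      (Ideal B)⁰) ^ m = 1 := by
    rw [← map_pow, ClassGroup.mk0_eq_one_iff]
    refine ⟨algebraMap A B b, ?_⟩
    rw [SubmonoidClass.coe_pow, ← Ideal.map_pow, hb, Ideal.submodule_span_eq,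
      Ideal.submodule_span_eq, Ideal.map_span, Set.image_singleton]
  rw [ramClassHom_natCast, hI, map_mul, mul_pow, hJm, one_mul, map_prod]
  simp only [map_pow]
  rfl

theorem range_ramClassHom (hG : Nat.card G = 2) {σ : G} (hσ : σ ≠ 1)
    [Fintype (sqRamified A B)] {m : ℕ} (hm : Odd m)
    (hCl : ∀ J : Ideal A, J ≠ ⊥ → (J ^ m).IsPrincipal)
    (hU : ∀ η : Aˣ, (∃ a b : B, b ≠ 0 ∧ a * σ • a = algebraMap A B η * (b * σ • b)) →
      ∃ e : Bˣ, (e : B) * σ • (e : B) = algebraMap A B η) (c : ClassGroup B) :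
    c ∈ (ramClassHom (A := A) (B := B) hCl).range ↔ c ^ 2 = 1 := by
  constructor
  · rintro ⟨f, rfl⟩
    rw [← map_pow]
    convert map_one (ramClassHom hCl)
    ext P
    change (2 • f.toAdd) P = 0
    rw [two_nsmul, Pi.add_apply]
    exact CharTwo.add_self_eq_zero _
  · intro hc
    obtain ⟨I, hI, rfl⟩ := exists_smul_eq_mk0_eq_of_sq_eq_one (A := A) hG hσ (fun J hJ hJ2 => by
      let J0 : (Ideal A)⁰ := ⟨J, mem_nonZeroDivisors_of_ne_zero hJ⟩
      have h2 : ClassGroup.mk0 J0 ^ 2 = 1 := by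
        rw [← map_pow, ClassGroup.mk0_eq_one_iff]; exact hJ2
      have h3 : ClassGroup.mk0 J0 ^ m = 1 := by
        rw [← map_pow, ClassGroup.mk0_eq_one_iff]; exact hCl J hJ
      obtain ⟨r, rfl⟩ := hm
      rw [pow_succ, pow_mul, h2, one_pow, one_mul, ClassGroup.mk0_eq_one_iff] at h3
      exact h3) hU c hc
    obtain ⟨J, hJ, f, hf⟩ := exists_eq_map_mul_prod_of_smul_eq (A := A) hG hσ _
      (nonZeroDivisors.coe_ne_zero I) hI
    refine ⟨Multiplicative.ofAdd fun P => (f P : ZMod 2), ?_⟩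
    rw [← mk0_pow_eq_of_eq_map_mul_prod hCl I J hJ f hf]
    obtain ⟨r, rfl⟩ := hm
    rw [pow_succ, pow_mul, hc, one_pow, one_mul]

theorem card_ker_ramClassHom (hG : Nat.card G = 2) {σ : G} (hσ : σ ≠ 1)
    [Fintype (sqRamified A B)] {m : ℕ} (hm : Odd m)
    (hCl : ∀ J : Ideal A, J ≠ ⊥ → (J ^ m).IsPrincipal)
    (hN : ∀ w : Bˣ, ∃ e : Aˣ, (w : B) * σ • (w : B) = algebraMap A B (e ^ 2 : Aˣ)) :
    Nat.card (ramClassHom (A := A) (B := B) hCl).ker =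
      (powMonoidHom 2 : normOneUnits B σ →* normOneUnits B σ).range.index := by
  let D := {d : B × normOneUnits B σ // d.1 ≠ 0 ∧ d.1 = ((d.2 : Bˣ) : B) * σ • d.1}
  have hspan (d : D) : Ideal.span {d.1.1} ≠ ⊥ := by simpa using d.2.1
  have hinv (d : D) : σ • Ideal.span {d.1.1} = Ideal.span {d.1.1} := by
    rw [smul_span_singleton]
    conv_rhs => rw [d.2.2, Ideal.span_singleton_mul_left_unit (d.1.2 : Bˣ).isUnit]
  let v (d : D) : Multiplicative (sqRamified A B → ZMod 2) :=
    Multiplicative.ofAdd fun P => (idealVal P.1 (Ideal.span {d.1.1}) : ZMod 2)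
  have hv (d : D) : v d ∈ (ramClassHom (A := A) (B := B) hCl).ker := by
    obtain ⟨J, hJ, f, hf⟩ := exists_eq_map_mul_prod_of_smul_eq (A := A) hG hσ _ (hspan d) (hinv d)
    have h1 : v d = Multiplicative.ofAdd fun P => (f P : ZMod 2) := by
      simp only [v]
      congr 1
      funext P
      rw [hf, idealVal_map_mul_prod_pow_mod J hJ]
    rw [MonoidHom.mem_ker, h1, ← mk0_pow_eq_of_eq_map_mul_prod hCl
      ⟨Ideal.span {d.1.1}, mem_nonZeroDivisors_of_ne_zero (hspan d)⟩ J hJ f hf,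
      (ClassGroup.mk0_eq_one_iff _).2 ⟨d.1.1, rfl⟩, one_pow]
  refine Nat.card_eq_of_surjective_of_eq_iff (D := D) (f := fun d => ⟨v d, hv d⟩)
    (g := fun d => QuotientGroup.mk d.1.2) ?_ ?_ ?_
  · rintro ⟨f, hf⟩
    obtain ⟨I, hIdef⟩ : ∃ I : (Ideal B)⁰, I = ∏ P : sqRamified A B,
      (⟨P.1, mem_nonZeroDivisors_of_ne_zero P.2.2.1⟩ : (Ideal B)⁰) ^ (m * (f.toAdd P).val) :=
      ⟨_, rfl⟩
    have hI : (I : Ideal B) = ∏ P : sqRamified A B, P.1 ^ (m * (f.toAdd P).val) := by simp [hIdef]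
    have hI1 : ClassGroup.mk0 I = 1 := by
      rw [MonoidHom.mem_ker] at hf
      rw [← hf]
      simp only [hIdef, map_prod, map_pow]
      exact Finset.prod_congr rfl fun P _ => by rw [pow_mul]; rfl
    obtain ⟨a, ha⟩ := (ClassGroup.mk0_eq_one_iff _).1 hI1
    rw [Ideal.submodule_span_eq] at ha
    have ha0 : a ≠ 0 := by
      rintro rfl
      exact nonZeroDivisors.coe_ne_zero I (by rw [ha]; simp)
    have hIσ : σ • (I : Ideal B) = I := by
      rw [hI]
      change MulDistribMulAction.toMonoidHom (Ideal B) σ _ = _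
      rw [map_prod]
      refine Finset.prod_congr rfl fun P _ => ?_
      rw [map_pow]
      exact congrArg (· ^ _) (smul_sub_mem_of_mem_sqRamified hG hσ P.2).1
    have hassoc : Associated (σ • a) a := by
      rw [← Ideal.span_singleton_eq_span_singleton, ← smul_span_singleton, ← ha, hIσ]
    obtain ⟨u, hu⟩ := hassoc
    have hu1 : (u : B) * σ • (u : B) = 1 := by
      apply mul_left_cancel₀ ha0
      have h1 := congrArg (σ • ·) hu
      simp only [smul_mul', smul_smul_of_card_two hG] at h1
      linear_combination (u : B) * h1 + hu
    refine ⟨⟨(a, ⟨u, hu1⟩), ha0, by rw [mul_comm]; exact hu.symm⟩, Subtype.ext ?_⟩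
    ext P
    change (idealVal P.1 (Ideal.span {a}) : ZMod 2) = f.toAdd P
    rw [← ha, hI, idealVal_prod_pow, Nat.cast_mul, (ZMod.natCast_eq_one_iff_odd).2 hm, one_mul,
      ZMod.natCast_val, ZMod.cast_id]
  · intro u'
    obtain ⟨u, rfl⟩ := QuotientGroup.mk_surjective u'
    have hu : ((u : Bˣ) : B) * σ • ((u : Bˣ) : B) = 1 := u.2
    by_cases h : 1 + ((u : Bˣ) : B) = 0
    · have hfaith : FaithfulSMul G B := IsGaloisGroup.faithful A
      obtain ⟨x, hx⟩ : ∃ x : B, σ • x ≠ x := by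
        by_contra! h
        exact hσ (hfaith.eq_of_smul_eq_smul fun x => by rw [h x, one_smul])
      refine ⟨⟨(x - σ • x, u), sub_ne_zero.2 hx.symm, ?_⟩, rfl⟩
      simp only [smul_sub, smul_smul_of_card_two hG]
      linear_combination (x - σ • x) * h
    · refine ⟨⟨(1 + (u : Bˣ), u), h, ?_⟩, rfl⟩
      simp only [smul_add, smul_one]
      linear_combination -hu
  · intro d d'
    have hd := d.2.2
    have hd' := d'.2.2
    have key := forall_even_idealVal_iff (A := A) hG hσ hm hCl hN (a := d.1.1 * d'.1.1)
      (mul_ne_zero d.2.1 d'.2.1) (u := d.1.2 * d'.1.2) (by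
        conv_lhs => rw [hd, hd']
        simp only [Subgroup.coe_mul, Units.val_mul, smul_mul']
        ring)
    rw [QuotientGroup.eq, Subtype.mk.injEq]
    have e1 : v d = v d' ↔
        ∀ P : sqRamified A B, Even (idealVal P.1 (Ideal.span {d.1.1 * d'.1.1})) := by
      simp only [v, Multiplicative.ofAdd.injective.eq_iff, funext_iff]
      refine forall_congr' fun P => ?_
      rw [← Ideal.span_singleton_mul_span_singleton, idealVal_mul (hspan d) (hspan d'),
        ← ZMod.natCast_eq_zero_iff_even, Nat.cast_add, CharTwo.add_eq_zero]
    rw [e1, key]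
    constructor
    · rintro ⟨v, hv⟩
      refine ⟨d.1.2⁻¹ * v, ?_⟩
      rw [powMonoidHom_apply, mul_pow, ← hv, sq]
      group
    · rintro ⟨v, hv⟩
      refine ⟨d.1.2 * v, ?_⟩
      simp only [powMonoidHom_apply] at hv
      rw [mul_pow, hv, sq, mul_assoc, mul_inv_cancel_left]

/-- The ambiguous class number formula for the 2-torsion of the class group of a quadratic
extension whose base has odd class number. -/
theorem card_sq_eq_one_mul_index (hG : Nat.card G = 2) {σ : G} (hσ : σ ≠ 1)
    [Finite (sqRamified A B)] {m : ℕ} (hm : Odd m)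
    (hCl : ∀ J : Ideal A, J ≠ ⊥ → (J ^ m).IsPrincipal)
    (hU : ∀ η : Aˣ, (∃ a b : B, b ≠ 0 ∧ a * σ • a = algebraMap A B η * (b * σ • b)) →
      ∃ e : Bˣ, (e : B) * σ • (e : B) = algebraMap A B η)
    (hN : ∀ w : Bˣ, ∃ e : Aˣ, (w : B) * σ • (w : B) = algebraMap A B (e ^ 2 : Aˣ)) :
    Nat.card {x : ClassGroup B // x ^ 2 = 1} *
      (powMonoidHom 2 : normOneUnits B σ →* normOneUnits B σ).range.index =
      2 ^ Nat.card (sqRamified A B) := by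
  have := Fintype.ofFinite (sqRamified A B)
  rw [← card_ker_ramClassHom (A := A) hG hσ hm hCl hN, mul_comm]
  have h1 := (ramClassHom (A := A) (B := B) hCl).ker.card_mul_index
  rw [Subgroup.index_ker, Nat.card_congr (Equiv.subtypeEquivRight
    (range_ramClassHom (A := A) hG hσ hm hCl hU))] at h1
  rw [h1]
  simp [Nat.card_eq_fintype_card]

end Involution

section UnitIndex

open NumberField NumberField.Units

theorem NumberField.Units.mem_torsion_of_embedding_real {K : Type*} [Field K] [NumberField K]
    (f : K →+* ℝ) (x : (𝓞 K)ˣ) : x ∈ torsion K ↔ x = 1 ∨ x = -1 := by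
  constructor
  · intro hx
    obtain ⟨n, hn, hx⟩ := isOfFinOrder_iff_pow_eq_one.1 ((CommGroup.mem_torsion _).1 hx)
    have h1 : (f ((x : 𝓞 K) : K)) ^ n = 1 := by
      have := congrArg (fun y : (𝓞 K)ˣ => f ((y : 𝓞 K) : K)) hx
      simpa using this
    have hinj : ∀ y : (𝓞 K)ˣ, f ((x : 𝓞 K) : K) = f ((y : 𝓞 K) : K) → x = y := fun y hy =>
      Units.ext (RingOfIntegers.ext (f.injective hy))
    rcases (abs_eq (zero_le_one' ℝ)).1 ((pow_eq_one_iff_of_nonneg (abs_nonneg _) hn.ne').1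
      (by rw [← abs_pow, h1, abs_one])) with h | h
    · left; apply hinj; simpa using h
    · right; apply hinj; simpa using h
  · rintro (rfl | rfl)
    · exact one_mem _
    · rw [torsion, CommGroup.mem_torsion, isOfFinOrder_iff_pow_eq_one]
      exact ⟨2, two_pos, by simp⟩

theorem neg_one_ne_sq_of_embedding_real {R : Type*} [CommRing R] (f : R →+* ℝ) (x : Rˣ) :
    (-1 : Rˣ) ≠ x ^ 2 := by
  intro h
  have := congrArg (fun y : Rˣ => f (y : R)) h
  simp only [Units.val_neg, Units.val_one, map_neg, map_one, Units.val_pow_eq_pow_val, map_pow]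
    at this
  nlinarith [sq_nonneg (f x)]

/-- In a totally real number field of degree `n` the squares have index `2 ^ n` in the units. -/
theorem NumberField.Units.index_sq_of_isTotallyReal (K : Type*) [Field K] [NumberField K]
    [IsTotallyReal K] (f : K →+* ℝ) :
    (powMonoidHom 2 : (𝓞 K)ˣ →* (𝓞 K)ˣ).range.index = 2 ^ Module.finrank ℚ K := by
  classical
  let e (x : (𝓞 K)ˣ) : Fin (rank K) → ℤ := (exist_unique_eq_mul_prod K x).choose.2
  have he1 (x : (𝓞 K)ˣ) : ∃ ζ ∈ torsion K, x = ζ * ∏ i, (fundSystem K i) ^ e x i :=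
    ⟨_, (exist_unique_eq_mul_prod K x).choose.1.2, (exist_unique_eq_mul_prod K x).choose_spec.1⟩
  have he2 (x ζ : (𝓞 K)ˣ) (hζ : ζ ∈ torsion K) (g : Fin (rank K) → ℤ)
      (hx : x = ζ * ∏ i, (fundSystem K i) ^ g i) : e x = g :=
    (congrArg Prod.snd ((exist_unique_eq_mul_prod K x).choose_spec.2 (⟨ζ, hζ⟩, g) hx)).symm
  have he3 (x y : (𝓞 K)ˣ) : e (x * y) = e x + e y := by
    obtain ⟨ζ, hζ, hx⟩ := he1 x
    obtain ⟨ξ, hξ, hy⟩ := he1 y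
    refine he2 _ (ζ * ξ) (mul_mem hζ hξ) _ ?_
    simp only [Pi.add_apply, zpow_add, Finset.prod_mul_distrib]
    conv_lhs => rw [hx, hy]
    rw [mul_mul_mul_comm]
  have he4 (x : (𝓞 K)ˣ) (hx : x ∈ torsion K) : e x = 0 := he2 x x hx 0 (by simp)
  let θ : (𝓞 K)ˣ →* Multiplicative (Fin (rank K) → ZMod 2) :=
    { toFun := fun x => Multiplicative.ofAdd fun i => (e x i : ZMod 2)
      map_one' := by
        rw [he4 1 (one_mem _)]
        simp only [Pi.zero_apply, Int.cast_zero]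
        rfl
      map_mul' := fun x y => by
        simp only [he3, Pi.add_apply, Int.cast_add]
        rfl }
  have hθ : Function.Surjective θ := by
    intro g
    refine ⟨∏ i, (fundSystem K i) ^ ((g.toAdd i).val : ℤ), ?_⟩
    apply Multiplicative.toAdd.injective
    funext i
    change (e _ i : ZMod 2) = _
    rw [he2 _ 1 (one_mem _) _ (one_mul _).symm]
    simp
  have hker : θ.ker.index = 2 ^ rank K := by
    rw [Subgroup.index_ker, MonoidHom.range_eq_top.2 hθ, Subgroup.card_top]
    simp [Nat.card_eq_fintype_card]
  have hle : (powMonoidHom 2 : (𝓞 K)ˣ →* (𝓞 K)ˣ).range ≤ θ.ker := by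
    rintro _ ⟨x, rfl⟩
    rw [MonoidHom.mem_ker, powMonoidHom_apply, map_pow]
    apply Multiplicative.toAdd.injective
    funext i
    rw [toAdd_pow, two_nsmul]
    exact CharTwo.add_self_eq_zero _
  have hrel : (powMonoidHom 2 : (𝓞 K)ˣ →* (𝓞 K)ˣ).range.relIndex θ.ker = 2 := by
    rw [Subgroup.relIndex_eq_two_iff_exists_notMem_and]
    refine ⟨-1, ?_, ?_, ?_⟩
    · rw [MonoidHom.mem_ker]
      apply Multiplicative.toAdd.injective
      funext i
      change (e (-1) i : ZMod 2) = 0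
      rw [he4 _ ((mem_torsion_of_embedding_real f _).2 (Or.inr rfl))]
      simp
    · rintro ⟨x, hx⟩
      exact neg_one_ne_sq_of_embedding_real (f.comp (algebraMap (𝓞 K) K)) x hx.symm
    · intro x hx
      have hx' : ∀ i, ∃ c : ℤ, e x i = c + c := by
        intro i
        have := congrFun (congrArg Multiplicative.toAdd ((MonoidHom.mem_ker).1 hx)) i
        exact ZMod.intCast_eq_zero_iff_even.1 this
      choose c hc using hx'
      obtain ⟨ζ, hζ, hxζ⟩ := he1 x
      have hsq : x = ζ * (∏ i, (fundSystem K i) ^ c i) ^ 2 := by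
        rw [hxζ, ← Finset.prod_pow]
        congr 1
        refine Finset.prod_congr rfl fun i _ => ?_
        rw [hc i, zpow_add, sq]
      rcases (mem_torsion_of_embedding_real f _).1 hζ with rfl | rfl
      · right
        exact ⟨∏ i, (fundSystem K i) ^ c i, by rw [powMonoidHom_apply, hsq, one_mul]⟩
      · left
        exact ⟨∏ i, (fundSystem K i) ^ c i, by rw [powMonoidHom_apply, hsq]; simp⟩
  rw [← Subgroup.relIndex_mul_index hle, hrel, hker, IsTotallyReal.finrank, ← pow_succ', rank]
  have h1 := InfinitePlace.card_eq_nrRealPlaces_add_nrComplexPlaces K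
  rw [IsTotallyReal.nrComplexPlaces_eq_zero] at h1
  congr 1
  have := Fintype.card_pos (α := InfinitePlace K)
  omega

/-- The index of squares in the units of relative norm one. -/
theorem index_sq_mul_index_sq_normOneUnits {A B G : Type*} [CommRing A] [CommRing B] [IsDomain A]
    [Algebra A B] [FaithfulSMul A B] [Group G] [MulSemiringAction G B] [SMulCommClass G A B]
    (σ : G) (f : B →+* ℝ)
    (hN : ∀ w : Bˣ, ∃ e : Aˣ, (w : B) * σ • (w : B) = algebraMap A B (e ^ 2 : Aˣ)) :
    (powMonoidHom 2 : Aˣ →* Aˣ).range.index *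
      (powMonoidHom 2 : normOneUnits B σ →* normOneUnits B σ).range.index =
      2 * (powMonoidHom 2 : Bˣ →* Bˣ).range.index := by
  let SA := (powMonoidHom 2 : Aˣ →* Aˣ).range
  let SU := (powMonoidHom 2 : normOneUnits B σ →* normOneUnits B σ).range
  let SB := (powMonoidHom 2 : Bˣ →* Bˣ).range
  let ι : Aˣ →* Bˣ := Units.map (algebraMap A B)
  have hinj : Function.Injective (algebraMap A B) := FaithfulSMul.algebraMap_injective A B
  have hιinj : Function.Injective ι := Units.map_injective hinj
  have hι (e : Aˣ) : σ • ((ι e : Bˣ) : B) = ι e := smul_algebraMap σ (e : A)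
  have hιN (e : Aˣ) (h : ι e ∈ normOneUnits B σ) : e = 1 ∨ e = -1 := by
    have h1 : ((ι e : Bˣ) : B) * σ • ((ι e : Bˣ) : B) = 1 := h
    rw [hι, ← sq] at h1
    have h2 : (e : A) ^ 2 = 1 := hinj (by simpa [ι] using h1)
    rcases mul_self_eq_one_iff.1 ((sq (e : A)).symm.trans h2) with h | h
    · left; exact Units.ext h
    · right; exact Units.ext h
  have hdecomp (w : Bˣ) : ∃ (e : Aˣ) (u : normOneUnits B σ), w = ι e * u := by
    obtain ⟨e, he⟩ := hN w
    have hinv : σ • (((ι e)⁻¹ : Bˣ) : B) = ((ι e)⁻¹ : Bˣ) := by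
      have := hι e⁻¹
      rwa [map_inv] at this
    have he' : (w : B) * σ • (w : B) = (ι e : Bˣ) ^ 2 := by rw [he]; simp [ι]
    have hmul := (ι e).mul_inv
    refine ⟨e, ⟨(ι e)⁻¹ * w, ?_⟩, by simp⟩
    change (((ι e)⁻¹ * w : Bˣ) : B) * σ • (((ι e)⁻¹ * w : Bˣ) : B) = 1
    rw [Units.val_mul, smul_mul', hinv]
    linear_combination (((ι e)⁻¹ : Bˣ) : B) ^ 2 * he' +
      (((ι e : Bˣ) : B) * ((ι e)⁻¹ : Bˣ) + 1) * hmul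
  have hneg (u : normOneUnits B σ) : -(u : Bˣ) ∈ normOneUnits B σ := by
    have h1 : ((u : Bˣ) : B) * σ • ((u : Bˣ) : B) = 1 := u.2
    change ((-(u : Bˣ) : Bˣ) : B) * σ • ((-(u : Bˣ) : Bˣ) : B) = 1
    rw [Units.val_neg, smul_neg, neg_mul_neg, h1]
  let φ : Aˣ × normOneUnits B σ →* Bˣ ⧸ SB :=
    (QuotientGroup.mk' SB).comp (ι.coprod (normOneUnits B σ).subtype)
  have hφ : Function.Surjective φ := by
    intro x
    obtain ⟨w, rfl⟩ := QuotientGroup.mk_surjective x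
    obtain ⟨e, u, rfl⟩ := hdecomp w
    exact ⟨(e, u), rfl⟩
  have hφker (e : Aˣ) (u : normOneUnits B σ) : (e, u) ∈ φ.ker ↔ ∃ w : Bˣ, w ^ 2 = ι e * u := by
    rw [MonoidHom.mem_ker]
    exact QuotientGroup.eq_one_iff _
  have hker : φ.ker.index = SB.index := by
    rw [Subgroup.index_ker, MonoidHom.range_eq_top.2 hφ, Subgroup.card_top, Subgroup.index]
  have hle : SA.prod SU ≤ φ.ker := by
    rintro ⟨_, _⟩ ⟨⟨e, rfl⟩, ⟨u, rfl⟩⟩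
    rw [hφker]
    exact ⟨ι e * u, by simp [mul_pow]⟩
  have hrel : (SA.prod SU).relIndex φ.ker = 2 := by
    rw [Subgroup.relIndex_eq_two_iff_exists_notMem_and]
    refine ⟨(-1, ⟨-((1 : normOneUnits B σ) : Bˣ), hneg 1⟩), ?_, ?_, ?_⟩
    · rw [hφker]
      refine ⟨1, Units.ext ?_⟩
      simp [ι]
    · rintro ⟨⟨x, hx⟩, -⟩
      exact neg_one_ne_sq_of_embedding_real (f.comp (algebraMap A B)) x hx.symm
    · rintro ⟨e, u⟩ h
      obtain ⟨w, hw⟩ := (hφker _ _).1 h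
      obtain ⟨e', u', rfl⟩ := hdecomp w
      have h1 : ι (e * (e' ^ 2)⁻¹) = ((u' ^ 2 * u⁻¹ : normOneUnits B σ) : Bˣ) := by
        rw [map_mul, map_inv, map_pow, Subgroup.coe_mul, Subgroup.coe_inv, SubmonoidClass.coe_pow]
        rw [mul_pow] at hw
        rw [mul_inv_eq_iff_eq_mul, mul_comm, ← mul_assoc, hw, mul_inv_cancel_right]
      rcases hιN _ (h1 ▸ (u' ^ 2 * u⁻¹).2) with h2 | h2
      · right
        rw [h2, map_one] at h1
        refine ⟨⟨e', (mul_inv_eq_one.1 h2).symm⟩, ⟨u', ?_⟩⟩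
        exact mul_inv_eq_one.1 (Subtype.ext h1.symm)
      · left
        rw [h2] at h1
        refine ⟨⟨e', ?_⟩, ⟨u', ?_⟩⟩
        · rw [mul_inv_eq_iff_eq_mul] at h2
          simp [h2]
        · apply Subtype.ext
          have h3 : ι (-1) = -1 := Units.ext (by simp [ι])
          rw [h3, Subgroup.coe_mul, Subgroup.coe_inv, eq_mul_inv_iff_mul_eq] at h1
          change ((u' ^ 2 : normOneUnits B σ) : Bˣ) = u * -((1 : normOneUnits B σ) : Bˣ)
          rw [← h1]
          simp
  change SA.index * SU.index = 2 * SB.index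
  rw [← Subgroup.index_prod, ← Subgroup.relIndex_mul_index hle, hrel, hker]

end UnitIndex

section QuadraticExtension

open IntermediateField

variable {E L : Type*} [Field E] [Field L] [Algebra E L]

theorem minpoly_eq_X_sq_sub_C {w : L} {d : E} (hw : w ^ 2 = algebraMap E L d)
    (hd : ¬ IsSquare d) : minpoly E w = Polynomial.X ^ 2 - Polynomial.C d :=
  (minpoly.eq_of_irreducible_of_monic
    (X_pow_sub_C_irreducible_of_prime Nat.prime_two fun b hb => hd ⟨b, by rw [← hb, sq]⟩)
    (by simp [hw]) (Polynomial.monic_X_pow_sub_C d two_ne_zero)).symm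

theorem isIntegral_of_sq_eq_algebraMap {w : L} {d : E} (hw : w ^ 2 = algebraMap E L d) :
    IsIntegral E w :=
  ⟨_, Polynomial.monic_X_pow_sub_C d two_ne_zero, by simp [hw]⟩

theorem finrank_eq_two_of_adjoin_sqrt {w : L} {d : E} (hw : w ^ 2 = algebraMap E L d)
    (hd : ¬ IsSquare d) (hL : E⟮w⟯ = ⊤) : Module.finrank E L = 2 := by
  rw [← finrank_top', ← hL, adjoin.finrank (isIntegral_of_sq_eq_algebraMap hw),
    minpoly_eq_X_sq_sub_C hw hd, Polynomial.natDegree_X_pow_sub_C]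

variable [CharZero E] [Algebra.IsQuadraticExtension E L]

theorem card_gal_of_isQuadraticExtension : Nat.card Gal(L/E) = 2 := by
  rw [IsGalois.card_aut_eq_finrank, Algebra.IsQuadraticExtension.finrank_eq_two]

theorem exists_gal_eq_neg {w : L} {d : E} (hw : w ^ 2 = algebraMap E L d)
    (hd : ¬ IsSquare d) : ∃ σ : Gal(L/E), σ ≠ 1 ∧ σ w = -w := by
  have hG : Nat.card Gal(L/E) = 2 := card_gal_of_isQuadraticExtension
  have hnt : Nontrivial Gal(L/E) := by
    have : Finite Gal(L/E) := Nat.finite_of_card_ne_zero (by omega)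
    exact Finite.one_lt_card_iff_nontrivial.1 (by omega)
  obtain ⟨σ, hσ⟩ := exists_ne (1 : Gal(L/E))
  refine ⟨σ, hσ, ?_⟩
  have hsq : σ w ^ 2 = w ^ 2 := by rw [← map_pow, hw, AlgEquiv.commutes]
  refine (sq_eq_sq_iff_eq_or_eq_neg.1 hsq).resolve_left fun h => hd ?_
  have hfix : ∀ g : Gal(L/E), g w = w := by
    intro g
    rcases eq_one_or_eq_of_card_two hG hσ g with rfl | rfl
    · rfl
    · exact h
  obtain ⟨a, ha⟩ := (IsGalois.mem_range_algebraMap_iff_fixed (F := E) w).2 hfix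
  refine ⟨a, (algebraMap E L).injective ?_⟩
  rw [map_mul, ha, ← hw, sq]

theorem exists_eq_add_mul_sqrt {w : L} {d : E} (hw : w ^ 2 = algebraMap E L d)
    (hd : ¬ IsSquare d) (x : L) : ∃ a b : E, x = algebraMap E L a + algebraMap E L b * w := by
  have hG : Nat.card Gal(L/E) = 2 := card_gal_of_isQuadraticExtension
  have : CharZero L := charZero_of_injective_algebraMap (algebraMap E L).injective
  obtain ⟨σ, hσ, hσw⟩ := exists_gal_eq_neg hw hd
  have hw0 : w ≠ 0 := by
    rintro rfl
    refine hd ⟨0, (algebraMap E L).injective ?_⟩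
    rw [← hw]; simp
  have hinv (y : L) : σ (σ y) = y := by
    have := smul_smul_of_card_two hG σ y
    exact this
  have hfix {y : L} (hy : σ y = y) : ∃ a : E, algebraMap E L a = y := by
    refine (IsGalois.mem_range_algebraMap_iff_fixed (F := E) y).2 fun g => ?_
    rcases eq_one_or_eq_of_card_two hG hσ g with rfl | rfl
    · rfl
    · exact hy
  obtain ⟨a, ha⟩ := hfix (y := x + σ x) (by rw [map_add, hinv, add_comm])
  obtain ⟨b, hb⟩ := hfix (y := (x - σ x) / w) (by
    rw [map_div₀, map_sub, hinv, hσw, div_neg, ← neg_div, neg_sub])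
  refine ⟨a / 2, b / 2, ?_⟩
  rw [map_div₀, map_div₀, ha, hb, map_ofNat]
  field_simp
  ring

end QuadraticExtension

section QuadraticField

open NumberField

variable {F : Type*} [Field F] [NumberField F] [Algebra.IsQuadraticExtension ℚ F]
  {l : ℕ} {r : 𝓞 F} {τ : Gal(F/ℚ)}

theorem not_isSquare_natCast_of_prime (hl : l.Prime) : ¬ IsSquare (l : ℚ) := by
  rw [Rat.isSquare_natCast_iff]
  exact hl.prime.not_isSquare

theorem exists_gal_smul_eq_neg (hl : l.Prime) (hr : r ^ 2 = l) :
    ∃ τ : Gal(F/ℚ), τ ≠ 1 ∧ τ • r = -r := by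
  obtain ⟨τ, h1, h2⟩ := exists_gal_eq_neg (E := ℚ) (w := (r : F)) (d := l)
    (by rw [← map_pow, hr]; simp) (not_isSquare_natCast_of_prime hl)
  refine ⟨τ, h1, FaithfulSMul.algebraMap_injective (𝓞 F) F ?_⟩
  rw [map_neg, ← h2]
  exact algebraMap.coe_smul' τ r F

theorem exists_intCast_eq_of_smul_eq (hτ : τ ≠ 1) {x : 𝓞 F} (hx : τ • x = x) :
    ∃ a : ℤ, (a : 𝓞 F) = x := by
  obtain ⟨a, ha⟩ := exists_algebraMap_eq_of_smul_eq (A := ℤ)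
    card_gal_of_isQuadraticExtension hτ hx
  exact ⟨a, by simpa using ha⟩

theorem exists_two_mul_eq_add (hl : l.Prime) (hr : r ^ 2 = l) (hτ : τ ≠ 1) (hτr : τ • r = -r)
    (x : 𝓞 F) : ∃ a b : ℤ, 2 * x = a + b * r := by
  have hinv (y : 𝓞 F) : τ • τ • y = y := smul_smul_of_card_two card_gal_of_isQuadraticExtension τ y
  obtain ⟨a, ha⟩ := exists_intCast_eq_of_smul_eq hτ (x := x + τ • x) (by
    rw [smul_add, hinv, add_comm])
  obtain ⟨c, hc⟩ := exists_intCast_eq_of_smul_eq hτ (x := (x - τ • x) * r) (by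
    rw [smul_mul', smul_sub, hinv, hτr]; ring)
  obtain ⟨e, he⟩ := exists_intCast_eq_of_smul_eq hτ (x := (x - τ • x) ^ 2) (by
    rw [smul_pow', smul_sub, hinv]; ring)
  have h1 : c ^ 2 = l * e := by
    have : ((c ^ 2 : ℤ) : 𝓞 F) = (l * e : ℤ) := by
      push_cast
      rw [hc, he, mul_pow, hr]; ring
    exact_mod_cast this
  obtain ⟨b, hb⟩ : (l : ℤ) ∣ c :=
    (Nat.prime_iff_prime_int.1 hl).dvd_of_dvd_pow (Dvd.intro _ h1.symm)
  have hr0 : r ≠ 0 := by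
    rintro rfl
    have : (l : 𝓞 F) = 0 := by rw [← hr]; simp
    exact hl.ne_zero (by exact_mod_cast this)
  have h2 : x - τ • x = b * r := by
    refine mul_right_cancel₀ hr0 ?_
    rw [← hc, hb]
    push_cast
    rw [← hr]; ring
  exact ⟨a, b, by rw [ha, ← h2]; ring⟩

theorem exists_two_mul_eq_one_add (hl8 : l % 8 = 1) (hr : r ^ 2 = l) :
    ∃ (ω : 𝓞 F) (k : ℕ), 2 * ω = 1 + r ∧ ω * (ω - 1) = 2 * k := by
  obtain ⟨k, rfl⟩ : ∃ k, l = 8 * k + 1 := ⟨l / 8, by omega⟩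
  have hr' : (r : F) ^ 2 = (8 * k + 1 : ℕ) := by rw [← map_pow, hr, map_natCast]
  push_cast at hr'
  have hω : ((1 + r) / 2 : F) * ((1 + r) / 2 - 1) = 2 * k := by
    linear_combination (1 / 4 : F) * hr'
  have hint : IsIntegral ℤ ((1 + r) / 2 : F) := by
    refine ⟨Polynomial.X ^ 2 + (-Polynomial.X + Polynomial.C (-(2 * (k : ℤ)))), ?_, ?_⟩
    · refine Polynomial.monic_X_pow_add ?_
      compute_degree!
    · simp only [Polynomial.eval₂_add, Polynomial.eval₂_pow, Polynomial.eval₂_X,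
        Polynomial.eval₂_neg, Polynomial.eval₂_C]
      rw [eq_intCast]
      push_cast
      linear_combination hω
  obtain ⟨ω, h⟩ : ∃ ω : 𝓞 F, algebraMap (𝓞 F) F ω = (1 + r) / 2 := ⟨⟨_, hint⟩, rfl⟩
  rw [← h] at hω
  refine ⟨ω, k, FaithfulSMul.algebraMap_injective (𝓞 F) F ?_,
    FaithfulSMul.algebraMap_injective (𝓞 F) F ?_⟩
  · rw [map_mul, map_add, map_ofNat, map_one, h]
    field_simp
  · simpa only [map_mul, map_sub, map_ofNat, map_one, map_natCast] using hω

theorem smul_eq_one_sub {ω : 𝓞 F} (hω : 2 * ω = 1 + r) (hτr : τ • r = -r) :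
    τ • ω = 1 - ω := by
  have h : 2 * τ • ω = 2 * (1 - ω) := by
    have h2 : τ • (2 : 𝓞 F) = 2 := by
      have := map_ofNat (MulSemiringAction.toRingHom _ (𝓞 F) τ) 2
      exact this
    have h3 := congrArg (τ • ·) hω
    simp only [smul_mul', smul_add, h2, smul_one, hτr] at h3
    rw [h3]
    linear_combination hω
  exact mul_left_cancel₀ two_ne_zero h

end QuadraticField

section QuadraticFieldPrimes

open NumberField

theorem under_int_eq_span {R : Type*} [CommRing R] {p : ℕ} (hp : p.Prime) {P : Ideal R}
    (hP : P.IsPrime) (h : (p : R) ∈ P) : P.under ℤ = Ideal.span {(p : ℤ)} := by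
  have hmax : (Ideal.span {(p : ℤ)}).IsMaximal :=
    PrincipalIdealRing.isMaximal_of_irreducible (Nat.prime_iff_prime_int.1 hp).irreducible
  have : (P.under ℤ).IsPrime := inferInstance
  refine (hmax.eq_of_le this.ne_top ?_).symm
  rw [Ideal.span_singleton_le_iff_mem, Ideal.mem_comap]
  simpa using h

theorem eq_of_prime_natCast_mem {R : Type*} [CommRing R] {P : Ideal R} (hP : P.IsPrime) {p q : ℕ}
    (hp : p.Prime) (hq : q.Prime) (hpP : (p : R) ∈ P) (hqP : (q : R) ∈ P) : p = q := by
  have h := (under_int_eq_span hp hP hpP).symm.trans (under_int_eq_span hq hP hqP)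
  rw [Ideal.span_singleton_eq_span_singleton, Int.associated_iff_natAbs] at h
  simpa using h

variable (R : Type*) [CommRing R] in
/-- The prime ideals of `R` containing the natural number `n`. -/
def primesAbove (n : ℕ) : Set (Ideal R) := {P | P.IsPrime ∧ (n : R) ∈ P}

variable {F : Type*} [Field F] [NumberField F]

theorem ne_bot_of_natCast_mem {n : ℕ} (hn : n ≠ 0) {P : Ideal (𝓞 F)} (h : (n : 𝓞 F) ∈ P) :
    P ≠ ⊥ := by
  rintro rfl
  exact hn (by exact_mod_cast Ideal.mem_bot.1 h)

theorem primesAbove_nonempty {p : ℕ} (hp : p.Prime) : (primesAbove (𝓞 F) p).Nonempty := by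
  have hmax : (Ideal.span {(p : ℤ)}).IsPrime :=
    (Ideal.span_singleton_prime (by exact_mod_cast hp.ne_zero)).2 (Nat.prime_iff_prime_int.1 hp)
  obtain ⟨P, hP, h⟩ : (Ideal.span {(p : ℤ)}).primesOver (𝓞 F) |>.Nonempty :=
    Set.nonempty_coe_sort.1 inferInstance
  refine ⟨P, hP, ?_⟩
  have : (p : ℤ) ∈ P.under ℤ := by
    rw [← h.over]; exact Ideal.mem_span_singleton_self _
  simpa using this

variable [Algebra.IsQuadraticExtension ℚ F] {l : ℕ} {r : 𝓞 F} {τ : Gal(F/ℚ)}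

theorem primesAbove_eq_pair (hτ : τ ≠ 1) {p : ℕ} (hp : p.Prime) {P : Ideal (𝓞 F)}
    (hP : P ∈ primesAbove (𝓞 F) p) : primesAbove (𝓞 F) p = {P, τ • P} := by
  obtain ⟨hPp, hpP⟩ := hP
  have hP0 := ne_bot_of_natCast_mem hp.ne_zero hpP
  have hsp : (τ • P).IsPrime := inferInstance
  have hs0 : τ • P ≠ ⊥ := fun h => hP0 (by
    rw [← inv_smul_smul τ P, h]; rw [Ideal.pointwise_smul_def, Ideal.map_bot])
  have hpτ : (p : 𝓞 F) ∈ τ • P := by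
    have := Ideal.smul_mem_pointwise_smul τ _ P hpP
    rwa [show τ • (p : 𝓞 F) = p from map_natCast (MulSemiringAction.toRingHom _ (𝓞 F) τ) p] at this
  ext Q
  constructor
  · rintro ⟨hQ, hpQ⟩
    have hmap : (P.under ℤ).map (algebraMap ℤ (𝓞 F)) ≤ Q := by
      rw [under_int_eq_span hp hPp hpP, Ideal.map_span, Set.image_singleton,
        Ideal.span_singleton_le_iff_mem]
      simpa using hpQ
    rcases prime_splitting_trichotomy (A := ℤ) card_gal_of_isQuadraticExtension hτ P hP0 with
      ⟨-, h⟩ | ⟨-, h, -⟩ | ⟨-, h⟩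
    · left
      rw [h] at hmap
      exact ((hPp.isMaximal hP0).eq_of_le hQ.ne_top hmap).symm
    · left
      rw [h, hQ.pow_le_iff two_ne_zero] at hmap
      exact ((hPp.isMaximal hP0).eq_of_le hQ.ne_top hmap).symm
    · rw [h] at hmap
      rcases hQ.mul_le.1 hmap with hmap | hmap
      · left
        exact ((hPp.isMaximal hP0).eq_of_le hQ.ne_top hmap).symm
      · right
        exact ((hsp.isMaximal hs0).eq_of_le hQ.ne_top hmap).symm
  · rintro (rfl | rfl)
    · exact ⟨hPp, hpP⟩
    · exact ⟨hsp, hpτ⟩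

theorem mem_sqRamified_and_eq_span (hl : l.Prime) (hr : r ^ 2 = l) (hτ : τ ≠ 1)
    {P : Ideal (𝓞 F)} (hP : P.IsPrime) (h : r ∈ P) :
    P ∈ sqRamified ℤ (𝓞 F) ∧ P = Ideal.span {r} := by
  have hlP : (l : 𝓞 F) ∈ P := by rw [← hr]; exact Ideal.pow_mem_of_mem _ h 2 two_pos
  have hP0 := ne_bot_of_natCast_mem hl.ne_zero hlP
  have hu := under_int_eq_span hl hP hlP
  have hram : P ∈ sqRamified ℤ (𝓞 F) := by
    refine mem_sqRamified_of_quadratic card_gal_of_isQuadraticExtension hτ P hP hP0 r 0 (-l)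
      (by simp [hr]) (zero_mem _) ?_ ?_
    · rw [hu]; exact neg_mem (Ideal.mem_span_singleton_self _)
    · rw [hu, Ideal.span_singleton_pow, neg_mem_iff, Ideal.mem_span_singleton]
      intro hd
      have h1 : l ^ 2 ∣ l := by exact_mod_cast hd
      have h2 := Nat.le_of_dvd hl.pos h1
      have := hl.two_le
      nlinarith
  refine ⟨hram, ?_⟩
  obtain ⟨J, hJ⟩ := Ideal.dvd_iff_le.2 ((Ideal.span_singleton_le_iff_mem P).2 h)
  have h2 : P ^ 2 = P ^ 2 * J ^ 2 := by
    rw [← mul_pow, ← hJ, Ideal.span_singleton_pow, hr, ← hram.2.2, hu, Ideal.map_span,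
      Set.image_singleton]
    simp
  have hJ2 : J ^ 2 = 1 := by
    refine mul_left_cancel₀ (pow_ne_zero 2 (Ideal.zero_eq_bot (R := 𝓞 F) ▸ hP0)) ?_
    rw [← h2, mul_one]
  have hJ1 : J = ⊤ := Ideal.isUnit_iff.1 (IsUnit.of_pow_eq_one hJ2 two_ne_zero)
  rw [hJ, hJ1, Ideal.mul_top]

theorem ncard_primesAbove_self (hl : l.Prime) (hr : r ^ 2 = l) (hτ : τ ≠ 1) :
    (primesAbove (𝓞 F) l).ncard = 1 := by
  obtain ⟨P, hP⟩ := primesAbove_nonempty (F := F) hl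
  have hmem : ∀ Q ∈ primesAbove (𝓞 F) l, Q = Ideal.span {r} := fun Q hQ =>
    (mem_sqRamified_and_eq_span hl hr hτ hQ.1
      (hQ.1.mem_of_pow_mem 2 (by rw [hr]; exact hQ.2))).2
  rw [Set.ncard_eq_one]
  refine ⟨Ideal.span {r}, Set.eq_singleton_iff_nonempty_unique_mem.2 ⟨⟨P, hP⟩, hmem⟩⟩

theorem ncard_primesAbove_eq (hτ : τ ≠ 1) {p : ℕ} (hp : p.Prime) {P : Ideal (𝓞 F)}
    (hP : P ∈ primesAbove (𝓞 F) p) [Decidable (τ • P = P)] :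
    (primesAbove (𝓞 F) p).ncard = if τ • P = P then 1 else 2 := by
  rw [primesAbove_eq_pair hτ hp hP]
  split_ifs with h
  · rw [h, Set.pair_eq_singleton, Set.ncard_singleton]
  · rw [Set.ncard_pair (Ne.symm h)]

theorem ncard_primesAbove_two (hl8 : l % 8 = 1) (hr : r ^ 2 = l) (hτ : τ ≠ 1)
    (hτr : τ • r = -r) : (primesAbove (𝓞 F) 2).ncard = 2 := by
  classical
  obtain ⟨P, hP⟩ := primesAbove_nonempty (F := F) Nat.prime_two
  rw [ncard_primesAbove_eq hτ Nat.prime_two hP, if_neg]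
  intro hτP
  obtain ⟨ω, k, hω, hω2⟩ := exists_two_mul_eq_one_add hl8 hr
  have hτω := smul_eq_one_sub hω hτr
  have hst : ∀ x ∈ P, τ • x ∈ P := fun x hx => by
    rw [← hτP]; exact Ideal.smul_mem_pointwise_smul τ x P hx
  have hmem : ω * (ω - 1) ∈ P := by
    rw [hω2]; exact Ideal.mul_mem_right _ _ (by simpa using hP.2)
  refine hP.1.ne_top ((Ideal.eq_top_iff_one P).2 ?_)
  rcases hP.1.mem_or_mem hmem with h | h
  · have h1 := add_mem (hst _ h) h
    rwa [hτω, sub_add_cancel] at h1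
  · have h1 := add_mem (hst _ h) h
    rw [smul_sub, hτω, smul_one] at h1
    rw [← neg_mem_iff]
    convert h1 using 1
    ring

theorem ncard_primesAbove_of_odd (hl : l.Prime) (hl8 : l % 8 = 1) (hr : r ^ 2 = l) (hτ : τ ≠ 1)
    (hτr : τ • r = -r) {p : ℕ} (hp : p.Prime) (hp2 : p ≠ 2) (hpl : p ≠ l)
    [Decidable (IsSquare (p : ZMod l))] :
    (primesAbove (𝓞 F) p).ncard = if IsSquare (p : ZMod l) then 2 else 1 := by
  classical
  have : Fact p.Prime := ⟨hp⟩
  have : Fact l.Prime := ⟨hl⟩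
  have hrec : IsSquare (p : ZMod l) ↔ IsSquare (l : ZMod p) :=
    ZMod.exists_sq_eq_prime_iff_of_mod_four_eq_one (by omega) hp2
  obtain ⟨P, hP⟩ := primesAbove_nonempty (F := F) hp
  have hrP : r ∉ P := fun h => hpl (eq_of_prime_natCast_mem hP.1 hp hl hP.2
    (by rw [← hr]; exact Ideal.pow_mem_of_mem _ h 2 two_pos))
  have h2P : (2 : 𝓞 F) ∉ P := fun h =>
    hp2 (eq_of_prime_natCast_mem hP.1 hp Nat.prime_two hP.2 (by simpa using h))
  have hcast {m : ℤ} {Q : Ideal (𝓞 F)} (hQ : (p : 𝓞 F) ∈ Q) (h : (p : ℤ) ∣ m) :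
      (m : 𝓞 F) ∈ Q := by
    obtain ⟨k, rfl⟩ := h
    push_cast
    exact Ideal.mul_mem_right _ _ hQ
  have hcast' {m : ℤ} (h : (m : 𝓞 F) ∈ P) : (p : ℤ) ∣ m := by
    have h1 : m ∈ P.under ℤ := by simpa using h
    rwa [under_int_eq_span hp hP.1 hP.2, Ideal.mem_span_singleton] at h1
  have key : τ • P = P ↔ ¬ IsSquare (p : ZMod l) := by
    rw [hrec]
    constructor
    · rintro hτP ⟨x, hx⟩
      have hst : ∀ x ∈ P, τ • x ∈ P := fun x hx => by
        rw [← hτP]; exact Ideal.smul_mem_pointwise_smul τ x P hx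
      have hd : (p : ℤ) ∣ x.val * x.val - l := by
        rw [← ZMod.intCast_zmod_eq_zero_iff_dvd]
        push_cast
        rw [ZMod.natCast_val, ZMod.cast_id', id, hx, sub_self]
      have hτx : τ • ((x.val : ℕ) : 𝓞 F) = (x.val : ℕ) :=
        map_natCast (MulSemiringAction.toRingHom _ (𝓞 F) τ) _
      have hmem : ((x.val : ℕ) - r) * ((x.val : ℕ) + r) ∈ P := by
        have := hcast hP.2 hd
        push_cast at this
        convert this using 1
        rw [← hr]; ring
      have h2r : 2 * r ∈ P := by
        rcases hP.1.mem_or_mem hmem with h | h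
        · have := sub_mem (hst _ h) h
          rw [smul_sub, hτx, hτr] at this
          convert this using 1
          ring
        · have := sub_mem h (hst _ h)
          rw [smul_add, hτx, hτr] at this
          convert this using 1
          ring
      exact (hP.1.mem_or_mem h2r).elim h2P hrP
    · intro hns
      by_contra hne
      refine hns ?_
      have hτmem : τ • P ∈ primesAbove (𝓞 F) p := by
        rw [primesAbove_eq_pair hτ hp hP]; simp
      have hnle : ¬ P ≤ τ • P := fun hle => hne
        (((hP.1.isMaximal (ne_bot_of_natCast_mem hp.ne_zero hP.2)).eq_of_le hτmem.1.ne_top hle).symm)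
      obtain ⟨x, hxP, hx⟩ := SetLike.not_le_iff_exists.1 hnle
      obtain ⟨a, b, hab⟩ := exists_two_mul_eq_add hl hr hτ hτr x
      have h2x : (a + b * r : 𝓞 F) ∈ P := by rw [← hab]; exact Ideal.mul_mem_left _ _ hxP
      have hb : ¬ (p : ℤ) ∣ b := by
        intro hb
        have ha : (p : ℤ) ∣ a := by
          refine hcast' ?_
          have := sub_mem h2x (Ideal.mul_mem_right r _ (hcast hP.2 hb))
          rwa [add_sub_cancel_right] at this
        have : 2 * x ∈ τ • P := by
          rw [hab]
          exact add_mem (hcast hτmem.2 ha) (Ideal.mul_mem_right _ _ (hcast hτmem.2 hb))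
        rcases hτmem.1.mem_or_mem this with h | h
        · exact hp2 (eq_of_prime_natCast_mem hτmem.1 hp Nat.prime_two hτmem.2 (by simpa using h))
        · exact hx h
      have hd : (p : ℤ) ∣ a ^ 2 - l * b ^ 2 := by
        refine hcast' ?_
        push_cast
        rw [← hr]
        have := Ideal.mul_mem_left P (a - b * r) h2x
        convert this using 1
        ring
      rw [← ZMod.intCast_zmod_eq_zero_iff_dvd] at hd hb
      push_cast at hd
      refine ⟨a / b, ?_⟩
      field_simp
      linear_combination -hd
  rw [ncard_primesAbove_eq hτ hp hP]
  by_cases hs : IsSquare (p : ZMod l)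
  · rw [if_pos hs, if_neg (fun h => key.1 h hs)]
  · rw [if_neg hs, if_pos (key.2 hs)]

end QuadraticFieldPrimes

section QuadraticFieldClassGroup

open NumberField

variable {F : Type*} [Field F] [NumberField F]

theorem primesAbove_one {R : Type*} [CommRing R] : primesAbove R 1 = ∅ :=
  Set.eq_empty_of_forall_notMem fun P hP => hP.1.ne_top ((Ideal.eq_top_iff_one P).2
    (by simpa using hP.2))

theorem primesAbove_mul {R : Type*} [CommRing R] (m n : ℕ) :
    primesAbove R (m * n) = primesAbove R m ∪ primesAbove R n := by
  ext P
  constructor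
  · rintro ⟨hP, h⟩
    rw [Nat.cast_mul] at h
    exact (hP.mem_or_mem h).imp (fun h => ⟨hP, h⟩) (fun h => ⟨hP, h⟩)
  · rintro (⟨hP, h⟩ | ⟨hP, h⟩)
    · exact ⟨hP, by rw [Nat.cast_mul]; exact Ideal.mul_mem_right _ _ h⟩
    · exact ⟨hP, by rw [Nat.cast_mul]; exact Ideal.mul_mem_left _ _ h⟩

variable [Algebra.IsQuadraticExtension ℚ F] {l : ℕ} {r : 𝓞 F} {τ : Gal(F/ℚ)}

theorem primesAbove_finite (hτ : τ ≠ 1) {p : ℕ} (hp : p.Prime) :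
    (primesAbove (𝓞 F) p).Finite := by
  obtain ⟨P, hP⟩ := primesAbove_nonempty (F := F) hp
  rw [primesAbove_eq_pair hτ hp hP]
  exact Set.toFinite _

theorem finite_and_ncard_primesAbove_prod (hτ : τ ≠ 1) (S : Finset ℕ) (hS : ∀ p ∈ S, p.Prime) :
    (primesAbove (𝓞 F) (∏ p ∈ S, p)).Finite ∧
      (primesAbove (𝓞 F) (∏ p ∈ S, p)).ncard = ∑ p ∈ S, (primesAbove (𝓞 F) p).ncard := by
  classical
  induction S using Finset.induction_on with
  | empty => simp [primesAbove_one]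
  | insert p S hpS ih =>
    obtain ⟨hfin, hcard⟩ := ih fun q hq => hS q (Finset.mem_insert_of_mem hq)
    have hp := hS p (Finset.mem_insert_self _ _)
    have hpfin := primesAbove_finite (F := F) hτ hp
    rw [Finset.prod_insert hpS, Finset.sum_insert hpS, primesAbove_mul]
    refine ⟨hpfin.union hfin, ?_⟩
    rw [Set.ncard_union_eq _ hpfin hfin, hcard]
    refine Set.disjoint_left.2 fun P h1 h2 => ?_
    have h3 : ∏ q ∈ S, (q : 𝓞 F) ∈ P := by simpa using h2.2
    obtain ⟨q, hqS, hq⟩ := (h1.1.prod_mem_iff).1 h3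
    exact hpS (eq_of_prime_natCast_mem h1.1 hp (hS q (Finset.mem_insert_of_mem hqS)) h1.2 hq ▸ hqS)

theorem eq_span_of_mem_sqRamified (hl : l.Prime) (hl8 : l % 8 = 1) (hr : r ^ 2 = l)
    (hτ : τ ≠ 1) (hτr : τ • r = -r) {P : Ideal (𝓞 F)} (hP : P ∈ sqRamified ℤ (𝓞 F)) :
    P = Ideal.span {r} := by
  obtain ⟨ω, k, hω, -⟩ := exists_two_mul_eq_one_add hl8 hr
  refine (mem_sqRamified_and_eq_span hl hr hτ hP.1 ?_).2
  have h := (smul_sub_mem_of_mem_sqRamified card_gal_of_isQuadraticExtension hτ hP).2 ω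
  rw [smul_eq_one_sub hω hτr, ← neg_mem_iff] at h
  convert h using 1
  linear_combination -hω

theorem ideal_map_isPrincipal {R S : Type*} [CommRing R] [CommRing S] (f : R →+* S) {J : Ideal R}
    (hJ : J.IsPrincipal) : (J.map f).IsPrincipal := by
  obtain ⟨a, rfl⟩ := hJ
  exact ⟨f a, by rw [Ideal.submodule_span_eq, Ideal.map_span, Set.image_singleton,
    Ideal.submodule_span_eq]⟩

theorem odd_card_classGroup (hl : l.Prime) (hl8 : l % 8 = 1) (hr : r ^ 2 = l)
    (hτ : τ ≠ 1) (hτr : τ • r = -r) {ε : (𝓞 F)ˣ} (hε : (ε : 𝓞 F) * τ • (ε : 𝓞 F) = -1) :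
    Odd (Nat.card (ClassGroup (𝓞 F))) := by
  have hsub : sqRamified ℤ (𝓞 F) ⊆ {Ideal.span {r}} := fun P hP =>
    eq_span_of_mem_sqRamified hl hl8 hr hτ hτr hP
  have : Fintype (sqRamified ℤ (𝓞 F)) := ((Set.finite_singleton _).subset hsub).fintype
  have hU : ∀ η : ℤˣ, (∃ a b : 𝓞 F, b ≠ 0 ∧ a * τ • a = algebraMap ℤ (𝓞 F) η * (b * τ • b)) →
      ∃ e : (𝓞 F)ˣ, (e : 𝓞 F) * τ • (e : 𝓞 F) = algebraMap ℤ (𝓞 F) η := by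
    intro η _
    rcases Int.units_eq_one_or η with rfl | rfl
    · exact ⟨1, by simp⟩
    · exact ⟨ε, by simpa using hε⟩
  have htriv : ∀ c : ClassGroup (𝓞 F), c ^ 2 = 1 → c = 1 := by
    intro c hc
    obtain ⟨I, hI, rfl⟩ := exists_smul_eq_mk0_eq_of_sq_eq_one card_gal_of_isQuadraticExtension hτ
      (fun J _ _ => IsPrincipalIdealRing.principal J) hU c hc
    obtain ⟨J, -, f, hIJ⟩ := exists_eq_map_mul_prod_of_smul_eq (A := ℤ)
      card_gal_of_isQuadraticExtension hτ (I : Ideal (𝓞 F)) (nonZeroDivisors.coe_ne_zero I) hI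
    rw [ClassGroup.mk0_eq_one_iff]
    obtain ⟨a, ha⟩ := ideal_map_isPrincipal (algebraMap ℤ (𝓞 F)) (IsPrincipalIdealRing.principal J)
    refine ⟨a * ∏ P, r ^ f P, ?_⟩
    rw [hIJ, ha, Ideal.submodule_span_eq, Ideal.submodule_span_eq,
      ← Ideal.span_singleton_mul_span_singleton, ← Ideal.prod_span_singleton]
    congr 1
    refine Finset.prod_congr rfl fun P _ => ?_
    rw [← Ideal.span_singleton_pow, hsub P.2]
  rw [← Nat.not_even_iff_odd, even_iff_two_dvd]
  intro h2
  have : Fact (Nat.Prime 2) := ⟨Nat.prime_two⟩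
  obtain ⟨c, hc⟩ := exists_prime_orderOf_dvd_card' 2 h2
  have h1 := htriv c (by rw [← hc]; exact pow_orderOf_eq_one c)
  rw [h1, orderOf_one] at hc
  omega

theorem isPrincipal_pow_card_classGroup {R : Type*} [CommRing R] [IsDedekindDomain R]
    [Finite (ClassGroup R)] (J : Ideal R) (hJ : J ≠ ⊥) :
    (J ^ Nat.card (ClassGroup R)).IsPrincipal := by
  have h : ClassGroup.mk0 (⟨J, mem_nonZeroDivisors_of_ne_zero hJ⟩ ^ Nat.card (ClassGroup R)) = 1 := by
    rw [map_pow, pow_card_eq_one']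
  rw [ClassGroup.mk0_eq_one_iff] at h
  exact h

end QuadraticFieldClassGroup

section TwoAdic

theorem ne_one_of_sq_add_sq_eq_mul_sq_zmod_eight :
    ∀ D : ZMod (2 ^ 3), D = 3 ∨ D = 7 ∨ D = 6 → ∀ x z y : ZMod (2 ^ 3), x ^ 2 + z ^ 2 = D * y ^ 2 →
      x ≠ 1 ∧ z ≠ 1 ∧ y ≠ 1 := by
  decide

theorem padic_eq_zero_of_sq_add_sq_eq_mul_sq {d : ℤ_[2]}
    (hd : PadicInt.toZModPow 3 d = 3 ∨ PadicInt.toZModPow 3 d = 7 ∨ PadicInt.toZModPow 3 d = 6)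
    {x z y : ℚ_[2]} (h : x ^ 2 + z ^ 2 = d * y ^ 2) : x = 0 ∧ z = 0 ∧ y = 0 := by
  have hint (x z y : ℤ_[2]) (h : x ^ 2 + z ^ 2 = d * y ^ 2) : x ≠ 1 ∧ z ≠ 1 ∧ y ≠ 1 := by
    have h1 := congrArg (PadicInt.toZModPow 3) h
    simp only [map_add, map_mul, map_pow] at h1
    obtain ⟨h2, h3, h4⟩ := ne_one_of_sq_add_sq_eq_mul_sq_zmod_eight _ hd _ _ _ h1
    exact ⟨fun e => h2 (by rw [e, map_one]), fun e => h3 (by rw [e, map_one]),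
      fun e => h4 (by rw [e, map_one])⟩
  have hscale (m : ℚ_[2]) (hm : m ≠ 0) (hx : ‖x‖ ≤ ‖m‖) (hz : ‖z‖ ≤ ‖m‖) (hy : ‖y‖ ≤ ‖m‖) :
      x ≠ m ∧ z ≠ m ∧ y ≠ m := by
    have hle {t : ℚ_[2]} (ht : ‖t‖ ≤ ‖m‖) : ∃ T : ℤ_[2], (T : ℚ_[2]) = t / m :=
      ⟨⟨t / m, by rw [norm_div]; exact div_le_one_of_le₀ ht (norm_nonneg _)⟩, rfl⟩
    obtain ⟨X, hX⟩ := hle hx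
    obtain ⟨Z, hZ⟩ := hle hz
    obtain ⟨Y, hY⟩ := hle hy
    obtain ⟨h1, h2, h3⟩ := hint X Z Y (by
      apply PadicInt.ext
      push_cast
      rw [hX, hZ, hY, div_pow, div_pow, div_pow, ← add_div, h, mul_div_assoc])
    refine ⟨?_, ?_, ?_⟩ <;> rintro rfl
    · exact h1 (PadicInt.ext (hX.trans (div_self hm)))
    · exact h2 (PadicInt.ext (hZ.trans (div_self hm)))
    · exact h3 (PadicInt.ext (hY.trans (div_self hm)))
  classical
  obtain ⟨m, hm, hmax⟩ := Finset.exists_max_image {x, z, y} (fun t : ℚ_[2] => ‖t‖)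
    (Finset.insert_nonempty _ _)
  simp only [Finset.mem_insert, Finset.mem_singleton, forall_eq_or_imp, forall_eq] at hm hmax
  rcases eq_or_ne m 0 with rfl | hm0
  · simpa using hmax
  · obtain ⟨h1, h2, h3⟩ := hscale m hm0 hmax.1 hmax.2.1 hmax.2.2
    rcases hm with h | h | h
    · exact absurd h.symm h1
    · exact absurd h.symm h2
    · exact absurd h.symm h3

theorem exists_padic_sq_eq {l : ℕ} (hl8 : l % 8 = 1) : ∃ ρ : ℤ_[2], ρ ^ 2 = l := by
  have h8 : ‖(1 - l : ℤ_[2])‖ ≤ (2 : ℝ) ^ (-(3 : ℕ) : ℤ) := by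
    have := (PadicInt.norm_int_le_pow_iff_dvd (p := 2) (k := 1 - l) (n := 3)).2 (by norm_num; omega)
    exact_mod_cast this
  obtain ⟨z, hz, -⟩ := hensels_lemma (p := 2) (R := ℤ_[2])
    (F := Polynomial.X ^ 2 - Polynomial.C (l : ℤ_[2])) (a := 1) (by
      have : ‖(2 : ℤ_[2])‖ = 2⁻¹ := PadicInt.norm_p (p := 2)
      simp [one_add_one_eq_two, this]
      refine h8.trans_lt ?_
      norm_num)
  exact ⟨z, by simpa [sub_eq_zero] using hz⟩

open NumberField IntermediateField

variable {F : Type*} [Field F] [NumberField F] [Algebra.IsQuadraticExtension ℚ F]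
  {l : ℕ} {r : 𝓞 F}

theorem nonempty_algHom_padic (hl : l.Prime) (hl8 : l % 8 = 1) (hr : r ^ 2 = l) :
    Nonempty (F →ₐ[ℚ] ℚ_[2]) := by
  obtain ⟨ρ, hρ⟩ := exists_padic_sq_eq hl8
  have hr' : (r : F) ^ 2 = algebraMap ℚ F l := by rw [← map_pow, hr]; simp
  have hns := not_isSquare_natCast_of_prime hl
  have hmin := minpoly_eq_X_sq_sub_C hr' hns
  have htop : ℚ⟮(r : F)⟯ = ⊤ := by
    refine eq_top_iff.2 fun x _ => ?_
    obtain ⟨a, b, rfl⟩ := exists_eq_add_mul_sqrt hr' hns x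
    exact add_mem (IntermediateField.algebraMap_mem _ a)
      (mul_mem (IntermediateField.algebraMap_mem _ b) (mem_adjoin_simple_self ℚ _))
  have hroot : (ρ : ℚ_[2]) ∈ (minpoly ℚ (r : F)).aroots ℚ_[2] := by
    rw [hmin, Polynomial.mem_aroots]
    refine ⟨(Polynomial.monic_X_pow_sub_C _ two_ne_zero).ne_zero, ?_⟩
    have : (ρ : ℚ_[2]) ^ 2 = l := by exact_mod_cast congrArg (fun z : ℤ_[2] => (z : ℚ_[2])) hρ
    simp [this]
  exact ⟨((algHomAdjoinIntegralEquiv ℚ (isIntegral_of_sq_eq_algebraMap hr')).symm ⟨(ρ : ℚ_[2]), hroot⟩).comp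
    ((equivOfEq htop).symm.toAlgHom.comp topEquiv.symm.toAlgHom)⟩

end TwoAdic

section NormUnits

open NumberField

theorem mul_add_mul_zmod_eight :
    ∀ n : ZMod (2 ^ 3), n = 3 ∨ n = 7 ∨ n = 6 → ∀ u v : ZMod (2 ^ 3), u = 0 ∨ u = 4 →
      v = 1 ∨ v = 5 → ∀ ρ : ZMod (2 ^ 3), ρ ^ 2 = 1 →
      n * (u + v * ρ) * ρ = 3 ∨ n * (u + v * ρ) * ρ = 7 ∨ n * (u + v * ρ) * ρ = 6 := by
  decide

variable {F : Type*} [Field F] [NumberField F] [Algebra.IsQuadraticExtension ℚ F]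
  {l : ℕ} {r : 𝓞 F} {τ : Gal(F/ℚ)} {ε : 𝓞 F} {n : ℕ} {u v : ℤ}

theorem intCast_zmod_eight_eq_iff {a b : ℤ} : (a : ZMod (2 ^ 3)) = b ↔ a % 8 = b % 8 :=
  ZMod.intCast_eq_intCast_iff a b (2 ^ 3)

theorem eq_zero_of_sq_add_sq_eq (hl : l.Prime) (hl8 : l % 8 = 1) (hr : r ^ 2 = l)
    (hε : ε = u + v * r) (hu : 4 ∣ u) (hv : v % 4 = 1) (hn : n % 4 = 3 ∨ n % 8 = 6)
    {x z y : F} (h : x ^ 2 + z ^ 2 = algebraMap (𝓞 F) F (n * ε * r) * y ^ 2) : x = 0 ∧ z = 0 ∧ y = 0 := by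
  obtain ⟨φ⟩ := nonempty_algHom_padic hl hl8 hr
  have hr2 : φ r ^ 2 = l := by rw [← map_pow, ← map_pow, hr]; simp
  obtain ⟨ρ, hρ⟩ : ∃ ρ : ℤ_[2], (ρ : ℚ_[2]) = φ r := by
    refine ⟨⟨φ r, ?_⟩, rfl⟩
    rw [← pow_le_one_iff_of_nonneg (norm_nonneg _) two_ne_zero, ← norm_pow, hr2]
    exact_mod_cast Padic.norm_int_le_one (p := 2) l
  have hρ2 : PadicInt.toZModPow 3 ρ ^ 2 = 1 := by
    have h1 : ρ ^ 2 = l := by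
      apply PadicInt.ext
      push_cast
      rw [hρ, hr2]
    rw [← map_pow, h1, map_natCast]
    have := (intCast_zmod_eight_eq_iff (a := l) (b := 1)).2 (by omega)
    simpa using this
  have hn' : ((n : ℤ) : ZMod (2 ^ 3)) = (3 : ℤ) ∨ ((n : ℤ) : ZMod (2 ^ 3)) = (7 : ℤ) ∨
      ((n : ℤ) : ZMod (2 ^ 3)) = (6 : ℤ) := by
    simp only [intCast_zmod_eight_eq_iff]; omega
  have hu' : (u : ZMod (2 ^ 3)) = (0 : ℤ) ∨ (u : ZMod (2 ^ 3)) = (4 : ℤ) := by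
    simp only [intCast_zmod_eight_eq_iff]; omega
  have hv' : (v : ZMod (2 ^ 3)) = (1 : ℤ) ∨ (v : ZMod (2 ^ 3)) = (5 : ℤ) := by
    simp only [intCast_zmod_eight_eq_iff]; omega
  push_cast at hn' hu' hv'
  have hd := mul_add_mul_zmod_eight _ hn' _ _ hu' hv' _ hρ2
  have hφ := congrArg φ h
  have h1 := padic_eq_zero_of_sq_add_sq_eq_mul_sq (d := n * (u + v * ρ) * ρ)
    (x := φ x) (z := φ z) (y := φ y) (by simpa using hd) (by
      rw [← map_pow, ← map_pow, ← map_add, h, hε]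
      push_cast
      simp [hρ])
  simpa using h1

theorem not_isSquare_mul_mul (hl : l.Prime) (hl8 : l % 8 = 1) (hr : r ^ 2 = l)
    (hε : ε = u + v * r) (hu : 4 ∣ u) (hv : v % 4 = 1) (hn : n % 4 = 3 ∨ n % 8 = 6) :
    ¬ IsSquare (algebraMap (𝓞 F) F (n * ε * r)) := by
  rintro ⟨z, hz⟩
  have := eq_zero_of_sq_add_sq_eq hl hl8 hr hε hu hv hn (x := z) (z := 0) (y := 1)
    (by rw [hz]; ring)
  exact one_ne_zero this.2.2

theorem sq_sub_mul_sq_ne_neg_one (hl : l.Prime) (hl8 : l % 8 = 1) (hr : r ^ 2 = l)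
    (hε : ε = u + v * r) (hu : 4 ∣ u) (hv : v % 4 = 1) (hn : n % 4 = 3 ∨ n % 8 = 6) (x y : F) :
    x ^ 2 - algebraMap (𝓞 F) F (n * ε * r) * y ^ 2 ≠ -1 := by
  intro h
  have := eq_zero_of_sq_add_sq_eq hl hl8 hr hε hu hv hn (x := x) (z := 1) (y := y)
    (by linear_combination h)
  exact one_ne_zero this.2.1

theorem exists_sq_eq_of_sq_sub_mul_sq {ε : (𝓞 F)ˣ} (hl : l.Prime) (hl8 : l % 8 = 1)
    (hr : r ^ 2 = l) (hτr : τ • r = -r) (hετ : (ε : 𝓞 F) * τ • (ε : 𝓞 F) = -1)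
    (hunits : ∀ η : (𝓞 F)ˣ, ∃ m : ℤ, η = ε ^ m ∨ η = -ε ^ m)
    (hε : (ε : 𝓞 F) = u + v * r) (hu : 4 ∣ u) (hv : v % 4 = 1) (hn : n % 4 = 3 ∨ n % 8 = 6)
    (η : (𝓞 F)ˣ) (x y : F) (h : x ^ 2 - algebraMap (𝓞 F) F (n * ε * r) * y ^ 2 = algebraMap (𝓞 F) F η) :
    ∃ e : (𝓞 F)ˣ, e ^ 2 = η := by
  have hne := sq_sub_mul_sq_ne_neg_one hl hl8 hr hε hu hv hn
  obtain ⟨E, hE, hE0⟩ : ∃ E : F, algebraMap (𝓞 F) F ε = E ∧ E ≠ 0 :=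
    ⟨_, rfl, by simp⟩
  obtain ⟨R, hR⟩ : ∃ R : F, algebraMap (𝓞 F) F r = R := ⟨_, rfl⟩
  have hτR : τ R = -R := by
    rw [← hR, ← map_neg, ← hτr]
    exact (algebraMap.coe_smul' τ r F).symm
  have hτE : τ E = -E⁻¹ := by
    have h1 := congrArg (algebraMap (𝓞 F) F) hετ
    rw [map_mul, map_neg, map_one, hE, show algebraMap (𝓞 F) F (τ • (ε : 𝓞 F)) = τ E by
      rw [← hE]; exact algebraMap.coe_smul' τ (ε : 𝓞 F) F] at h1
    field_simp
    linear_combination h1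
  have hd : algebraMap (𝓞 F) F (n * ε * r) = n * E * R := by
    rw [← hE, ← hR, map_mul, map_mul, map_natCast]
  rw [hd] at h hne
  have hmulconj (s : F) (hs : s ^ 2 = 1) (hτs : τ s = s) (x y : F)
      (h : x ^ 2 - n * E * R * y ^ 2 = s * E) : False := by
    have h2 := congrArg τ h
    simp only [map_sub, map_mul, map_pow, map_natCast, hτE, hτR, hτs] at h2
    refine hne (x * τ x + n * R * y * τ y) (x * τ y * E⁻¹ + y * τ x) ?_
    have h3 : (x ^ 2 - n * E * R * y ^ 2) * (τ x ^ 2 - n * -E⁻¹ * -R * τ y ^ 2) = -1 := by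
      rw [h, h2]
      field_simp
      linear_combination -hs
    rw [← h3]
    field_simp
    ring
  have hdiv (k : ℤ) (c : F) (h : x ^ 2 - n * E * R * y ^ 2 = E ^ (2 * k) * c) :
      (x / E ^ k) ^ 2 - n * E * R * (y / E ^ k) ^ 2 = c := by
    have hk : E ^ k ≠ 0 := zpow_ne_zero _ hE0
    rw [zpow_mul', zpow_ofNat] at h
    field_simp
    linear_combination h
  have hzpow (m : ℤ) : algebraMap (𝓞 F) F ((ε ^ m : (𝓞 F)ˣ) : 𝓞 F) = E ^ m := by
    have := map_zpow (Units.map (algebraMap (𝓞 F) F).toMonoidHom) ε m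
    have h2 := congrArg Units.val this
    rw [Units.val_zpow_eq_zpow_val] at h2
    rw [← hE]
    exact h2
  obtain ⟨m, hm⟩ := hunits η
  obtain ⟨k, rfl | rfl⟩ := Int.even_or_odd' m
  · rcases hm with rfl | rfl
    · exact ⟨ε ^ k, by rw [← zpow_natCast, ← zpow_mul, mul_comm]; rfl⟩
    · refine absurd (hdiv k (-1) ?_) (hne _ _)
      rw [h, Units.val_neg, map_neg, hzpow, mul_neg_one]
  · have hsplit : E ^ (2 * k + 1) = E ^ (2 * k) * E := zpow_add_one₀ hE0 _
    rcases hm with rfl | rfl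
    · refine (hmulconj 1 (one_pow 2) (map_one τ) _ _ (hdiv k _ ?_)).elim
      rw [h, hzpow, hsplit, one_mul]
    · refine (hmulconj (-1) neg_one_sq (by simp) _ _ (hdiv k _ ?_)).elim
      rw [h, Units.val_neg, map_neg, hzpow, hsplit]
      ring

end NormUnits

section Relative

open NumberField

theorem algebraMap_coe_ringOfIntegers {F K : Type*} [Field F] [Field K] [Algebra F K]
    (x : 𝓞 F) :
    algebraMap (𝓞 K) K (algebraMap (𝓞 F) (𝓞 K) x) = algebraMap F K (algebraMap (𝓞 F) F x) :=
  rfl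

variable {F : Type*} [Field F] [NumberField F] [Algebra.IsQuadraticExtension ℚ F]
  {l : ℕ} {r : 𝓞 F} {τ : Gal(F/ℚ)} {n : ℕ} {u v : ℤ}
  {K : Type*} [Field K] [NumberField K] [Algebra F K] [Algebra.IsQuadraticExtension F K]
  {w : 𝓞 K} {σ : Gal(K/F)}

theorem natCast_notMem_sq (hl : l.Prime) (hl8 : l % 8 = 1) (hr : r ^ 2 = l) (hτ : τ ≠ 1)
    (hτr : τ • r = -r) {q : ℕ} (hq : q.Prime) (hql : q ≠ l) {P : Ideal (𝓞 F)} (hP : P.IsPrime)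
    (hqP : (q : 𝓞 F) ∈ P) : (q : 𝓞 F) ∉ P ^ 2 := by
  intro hq2
  have hP0 := ne_bot_of_natCast_mem hq.ne_zero hqP
  have hmap : (P.under ℤ).map (algebraMap ℤ (𝓞 F)) ≤ P ^ 2 := by
    rw [under_int_eq_span hq hP hqP, Ideal.map_span, Set.image_singleton,
      Ideal.span_singleton_le_iff_mem]
    simpa using hq2
  rcases prime_splitting_trichotomy (A := ℤ) card_gal_of_isQuadraticExtension hτ P hP0 with
    ⟨-, h⟩ | ⟨-, h, -⟩ | ⟨hne, h⟩
  · rw [h] at hmap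
    exact ne_sq_of_prime hP hP0 (le_antisymm hmap (Ideal.pow_le_self two_ne_zero))
  · have hrP : P = Ideal.span {r} := eq_span_of_mem_sqRamified hl hl8 hr hτ hτr ⟨hP, hP0, h⟩
    have : r ∈ P := by rw [hrP]; exact Ideal.mem_span_singleton_self r
    exact hql (eq_of_prime_natCast_mem hP hq hl hqP
      (by rw [← hr]; exact Ideal.pow_mem_of_mem _ this 2 two_pos))
  · rw [h, sq, ← Ideal.dvd_iff_le] at hmap
    have hle := Ideal.dvd_iff_le.1 ((mul_dvd_mul_iff_left hP0).1 hmap)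
    have hsp : (τ • P).IsPrime := inferInstance
    have hs0 : τ • P ≠ ⊥ := fun h => hP0 (by
      rw [← inv_smul_smul τ P, h, Ideal.pointwise_smul_def, Ideal.map_bot])
    exact hne ((hsp.isMaximal hs0).eq_of_le hP.ne_top hle)

theorem exists_sq_eq_of_norm {ε : (𝓞 F)ˣ} (hl : l.Prime) (hl8 : l % 8 = 1)
    (hr : r ^ 2 = l) (hτr : τ • r = -r) (hετ : (ε : 𝓞 F) * τ • (ε : 𝓞 F) = -1)
    (hunits : ∀ η : (𝓞 F)ˣ, ∃ m : ℤ, η = ε ^ m ∨ η = -ε ^ m)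
    (hε : (ε : 𝓞 F) = u + v * r) (hu : 4 ∣ u) (hv : v % 4 = 1) (hn : n % 4 = 3 ∨ n % 8 = 6)
    (hw : w ^ 2 = algebraMap (𝓞 F) (𝓞 K) (n * ε * r)) (hσw : σ • w = -w)
    (η : (𝓞 F)ˣ) (h : ∃ a b : 𝓞 K, b ≠ 0 ∧ a * σ • a = algebraMap (𝓞 F) (𝓞 K) η * (b * σ • b)) :
    ∃ e : (𝓞 F)ˣ, e ^ 2 = η := by
  obtain ⟨a, b, hb, hab⟩ := h
  have hw' : (algebraMap (𝓞 K) K w) ^ 2 =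
      algebraMap F K (algebraMap (𝓞 F) F (n * ε * r)) := by
    rw [← map_pow, hw, algebraMap_coe_ringOfIntegers]
  have hσw' : σ (algebraMap (𝓞 K) K w) = -algebraMap (𝓞 K) K w := by
    rw [← map_neg, ← hσw]
    exact (algebraMap.coe_smul' σ w K).symm
  have hns := not_isSquare_mul_mul hl hl8 hr hε hu hv hn
  obtain ⟨x, y, hxy⟩ := exists_eq_add_mul_sqrt hw' hns (algebraMap (𝓞 K) K a / algebraMap (𝓞 K) K b)
  refine exists_sq_eq_of_sq_sub_mul_sq hl hl8 hr hτr hετ hunits hε hu hv hn η x y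
    ((algebraMap F K).injective ?_)
  have hb0 : algebraMap (𝓞 K) K b ≠ 0 := by simpa using hb
  have hσb0 : σ (algebraMap (𝓞 K) K b) ≠ 0 := by simpa using hb
  have hnorm : (algebraMap (𝓞 K) K a / algebraMap (𝓞 K) K b) *
      σ (algebraMap (𝓞 K) K a / algebraMap (𝓞 K) K b) =
      algebraMap F K (algebraMap (𝓞 F) F η) := by
    have h1 := congrArg (algebraMap (𝓞 K) K) hab
    rw [map_mul, map_mul, map_mul, algebraMap_coe_ringOfIntegers,
      show algebraMap (𝓞 K) K (σ • a) = σ (algebraMap (𝓞 K) K a) from algebraMap.coe_smul' σ a K,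
      show algebraMap (𝓞 K) K (σ • b) = σ (algebraMap (𝓞 K) K b) from algebraMap.coe_smul' σ b K]
      at h1
    rw [map_div₀, div_mul_div_comm, h1, mul_div_cancel_right₀ _ (mul_ne_zero hb0 hσb0)]
  generalize algebraMap (𝓞 F) F (n * ε * r) = d at hw' hns ⊢
  rw [← hnorm, hxy, map_add, map_mul, AlgEquiv.commutes, AlgEquiv.commutes, hσw', map_sub, map_mul,
    map_pow, map_pow, ← hw']
  ring

theorem exists_gal_smul_eq_neg_of_not_isSquare {d : 𝓞 F} (hd : ¬ IsSquare (algebraMap (𝓞 F) F d))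
    (hw : w ^ 2 = algebraMap (𝓞 F) (𝓞 K) d) : ∃ σ : Gal(K/F), σ ≠ 1 ∧ σ • w = -w := by
  obtain ⟨σ, h1, h2⟩ := exists_gal_eq_neg (w := algebraMap (𝓞 K) K w)
    (by rw [← map_pow, hw, algebraMap_coe_ringOfIntegers]) hd
  refine ⟨σ, h1, FaithfulSMul.algebraMap_injective (𝓞 K) K ?_⟩
  rw [map_neg, ← h2]
  exact algebraMap.coe_smul' σ w K

theorem exists_unit_algebraMap_eq_mul_smul (hσ : σ ≠ 1) (x : (𝓞 K)ˣ) :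
    ∃ η : (𝓞 F)ˣ, algebraMap (𝓞 F) (𝓞 K) η = x * σ • (x : 𝓞 K) := by
  have hG : Nat.card Gal(K/F) = 2 := card_gal_of_isQuadraticExtension
  obtain ⟨y, hy⟩ := exists_algebraMap_eq_mul_smul (A := 𝓞 F) hG hσ (x : 𝓞 K)
  obtain ⟨z, hz⟩ := exists_algebraMap_eq_mul_smul (A := 𝓞 F) hG hσ ((x⁻¹ : (𝓞 K)ˣ) : 𝓞 K)
  refine ⟨Units.mkOfMulEqOne y z (FaithfulSMul.algebraMap_injective (𝓞 F) (𝓞 K) ?_), hy⟩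
  rw [map_mul, hy, hz, mul_mul_mul_comm, ← smul_mul', Units.mul_inv, smul_one, one_mul, map_one]

end Relative

section PrimesAbove

theorem exists_prime_dvd_natCast_mem {R : Type*} [CommRing R] {P : Ideal R} (hP : P.IsPrime)
    {m : ℕ} (hm : m ≠ 0) (h : (m : R) ∈ P) : ∃ q, q.Prime ∧ q ∣ m ∧ (q : R) ∈ P := by
  rw [← Nat.prod_primeFactorsList hm, Nat.cast_list_prod, ← Multiset.prod_coe,
    hP.multiset_prod_mem_iff_exists_mem] at h
  obtain ⟨x, hx, hxP⟩ := h
  obtain ⟨q, hq, rfl⟩ := List.mem_map.1 (Multiset.mem_coe.1 hx)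
  exact ⟨q, Nat.prime_of_mem_primeFactorsList hq, Nat.dvd_of_mem_primeFactorsList hq, hxP⟩

theorem natCast_mem_of_dvd {R : Type*} [CommRing R] {P : Ideal R} {a b : ℕ} (hab : a ∣ b)
    (h : (a : R) ∈ P) : (b : R) ∈ P :=
  P.mem_of_dvd (Nat.cast_dvd_cast hab) h

theorem primesAbove_prod_primeFactors {R : Type*} [CommRing R] {m : ℕ} (hm : m ≠ 0) :
    primesAbove R (∏ p ∈ m.primeFactors, p) = primesAbove R m := by
  ext P
  refine ⟨fun h => ⟨h.1, natCast_mem_of_dvd (Nat.prod_primeFactors_dvd m) h.2⟩, fun h => ?_⟩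
  obtain ⟨q, hq, hqm, hqP⟩ := exists_prime_dvd_natCast_mem h.1 hm h.2
  exact ⟨h.1, natCast_mem_of_dvd (Finset.dvd_prod_of_mem _ (hq.mem_primeFactors hqm hm)) hqP⟩

end PrimesAbove

section Relative

open NumberField

variable {F : Type*} [Field F] [NumberField F] [Algebra.IsQuadraticExtension ℚ F]
  {l : ℕ} {r : 𝓞 F} {τ : Gal(F/ℚ)} {n : ℕ}
  {K : Type*} [Field K] [NumberField K] [Algebra F K] [Algebra.IsQuadraticExtension F K]
  {w : 𝓞 K} {σ : Gal(K/F)} {ε : (𝓞 F)ˣ}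

theorem under_mem_primesAbove_of_mem_sqRamified (hr : r ^ 2 = l)
    (hw : w ^ 2 = algebraMap (𝓞 F) (𝓞 K) (n * ε * r)) (hσ : σ ≠ 1) (hσw : σ • w = -w)
    {P : Ideal (𝓞 K)} (hP : P ∈ sqRamified (𝓞 F) (𝓞 K)) :
    P.under (𝓞 F) ∈ primesAbove (𝓞 F) (2 * n * l) := by
  have hPp := hP.1
  refine ⟨inferInstance, ?_⟩
  have h := (smul_sub_mem_of_mem_sqRamified card_gal_of_isQuadraticExtension hσ hP).2 w
  rw [hσw] at h
  rw [Ideal.mem_comap]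
  have h2 : (2 * w) ^ 2 ∈ P := by
    refine Ideal.pow_mem_of_mem _ ?_ 2 two_pos
    rw [← neg_mem_iff]
    convert h using 1
    ring
  have h3 : algebraMap (𝓞 F) (𝓞 K) ((2 * n * l : ℕ) * (2 * n * l : ℕ)) ∈ P := by
    have h4 : ((2 * n * l : ℕ) * (2 * n * l : ℕ) : 𝓞 F) =
        2 ^ 2 * (n * ε * r) * (n * r * l * (ε⁻¹ : (𝓞 F)ˣ)) := by
      push_cast
      linear_combination (-4 * n ^ 2 * l * (ε * (ε⁻¹ : (𝓞 F)ˣ))) * hr -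
        4 * (n : 𝓞 F) ^ 2 * l ^ 2 * ε.mul_inv
    rw [h4, map_mul _ (_ * _), map_mul _ (2 ^ 2), ← hw]
    refine Ideal.mul_mem_right _ _ ?_
    convert h2 using 1
    rw [map_pow, map_ofNat]
    ring
  rw [map_mul] at h3
  exact (hPp.mem_or_mem h3).elim id id

theorem mem_sqRamified_of_under_mem_primesAbove (hl : l.Prime) (hl8 : l % 8 = 1)
    (hr : r ^ 2 = l) (hτ : τ ≠ 1) (hτr : τ • r = -r) (hn : n % 4 = 3 ∨ n % 8 = 6)
    (hsq : Squarefree n) (hln : ¬ l ∣ n) {u v : ℤ} (hε : (ε : 𝓞 F) = u + v * r)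
    (hu : 4 ∣ u) (hv : v % 4 = 1)
    (hw : w ^ 2 = algebraMap (𝓞 F) (𝓞 K) (n * ε * r)) (hσ : σ ≠ 1)
    {P : Ideal (𝓞 K)} (hP : P.IsPrime)
    (h : P.under (𝓞 F) ∈ primesAbove (𝓞 F) (2 * n * l)) : P ∈ sqRamified (𝓞 F) (𝓞 K) := by
  have hn0 : n ≠ 0 := hsq.ne_zero
  have hG : Nat.card Gal(K/F) = 2 := card_gal_of_isQuadraticExtension
  have hN0 : 2 * n * l ≠ 0 := by simp [hn0, hl.ne_zero]
  have hP0 : P ≠ ⊥ := by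
    refine ne_bot_of_natCast_mem hN0 (P := P) ?_
    rw [← map_natCast (algebraMap (𝓞 F) (𝓞 K))]
    exact Ideal.mem_comap.1 h.2
  have hp := h.1
  have hεp : (ε : 𝓞 F) ∉ P.under (𝓞 F) := fun hmem =>
    hp.ne_top (Ideal.eq_top_of_isUnit_mem _ hmem ε.isUnit)
  have hlp (q : ℕ) (hrp : r ∈ P.under (𝓞 F)) (hq : q.Prime) (hqp : (q : 𝓞 F) ∈ P.under (𝓞 F)) :
      q = l :=
    eq_of_prime_natCast_mem hp hq hl hqp (by rw [← hr]; exact Ideal.pow_mem_of_mem _ hrp 2 two_pos)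
  have of_w (hd : (n * ε * r : 𝓞 F) ∈ P.under (𝓞 F))
      (hd2 : (n * ε * r : 𝓞 F) ∉ P.under (𝓞 F) ^ 2) : P ∈ sqRamified (𝓞 F) (𝓞 K) :=
    mem_sqRamified_of_quadratic hG hσ P hP hP0 w 0 (-(n * ε * r))
      (by rw [hw, map_neg, map_zero]; ring) (zero_mem _) (neg_mem hd)
      (fun h => hd2 (neg_mem_iff.1 h))
  have hdvd_l (q : ℕ) (hq : q.Prime) (hqn : q ∣ n) : q ≠ l := by
    rintro rfl
    exact hln hqn
  obtain ⟨q, hq, hqN, hqp⟩ := exists_prime_dvd_natCast_mem hp hN0 h.2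
  by_cases hqn : q ∣ n
  · obtain ⟨m, rfl⟩ := hqn
    have hql := hdvd_l q hq (dvd_mul_right q m)
    have hmp : (m : 𝓞 F) ∉ P.under (𝓞 F) := by
      intro hm
      obtain ⟨q', hq', hq'm, hq'p⟩ := exists_prime_dvd_natCast_mem hp (by aesop) hm
      obtain rfl := eq_of_prime_natCast_mem hp hq hq' hqp hq'p
      exact hq.one_lt.ne' (Nat.isUnit_iff.1 (hsq q (mul_dvd_mul_left q hq'm)))
    refine of_w ?_ fun h2 => ?_
    · push_cast
      exact Ideal.mul_mem_right _ _ (Ideal.mul_mem_right _ _ (Ideal.mul_mem_right _ _ hqp))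
    · have h3 : (m * ε * r : 𝓞 F) * q ∈ P.under (𝓞 F) ^ 2 := by
        convert h2 using 1
        push_cast
        ring
      rcases Ideal.IsPrime.mul_mem_pow _ h3 with h3 | h3
      · rcases hp.mem_or_mem h3 with h3 | h3
        · exact (hp.mem_or_mem h3).elim hmp hεp
        · exact hql (hlp q h3 hq hqp)
      · exact natCast_notMem_sq hl hl8 hr hτ hτr hq hql hp hqp h3
  by_cases hql : q = l
  · subst hql
    have hrp : r ∈ P.under (𝓞 F) := hp.mem_of_pow_mem 2 (by rw [hr]; exact hqp)
    have hnp : (n : 𝓞 F) ∉ P.under (𝓞 F) := by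
      intro hm
      obtain ⟨q', hq', hq'm, hq'p⟩ := exists_prime_dvd_natCast_mem hp hn0 hm
      exact hdvd_l q' hq' hq'm (eq_of_prime_natCast_mem hp hq' hq hq'p hqp)
    refine of_w (Ideal.mul_mem_left _ _ hrp) fun h2 => ?_
    rcases Ideal.IsPrime.mul_mem_pow _ h2 with h3 | h3
    · exact (hp.mem_or_mem h3).elim hnp hεp
    · have hspan := (mem_sqRamified_and_eq_span hl hr hτ hp hrp).2
      refine ne_sq_of_prime hp (ne_bot_of_natCast_mem hN0 h.2)
        (le_antisymm ?_ (Ideal.pow_le_self two_ne_zero))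
      conv_lhs => rw [hspan]
      exact (Ideal.span_singleton_le_iff_mem _).2 h3
  have hq2 : q = 2 := by
    rcases (hq.dvd_mul).1 hqN with h1 | h1
    · rcases (hq.dvd_mul).1 h1 with h1 | h1
      · exact (Nat.prime_dvd_prime_iff_eq hq Nat.prime_two).1 h1
      · exact absurd h1 hqn
    · exact absurd ((Nat.prime_dvd_prime_iff_eq hq hl).1 h1) hql
  subst hq2
  obtain ⟨a, rfl⟩ := hu
  obtain ⟨c, hc⟩ : ∃ c : ℤ, (n * v * l : ℤ) = 3 + 4 * c := by
    have h3 : (n : ℤ) % 4 = 3 := by omega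
    have h4 : (l : ℤ) % 4 = 1 := by omega
    have h5 : (n * v * l : ℤ) % 4 = 3 := by simp [Int.mul_emod, h3, h4, hv]
    exact ⟨n * v * l / 4, by omega⟩
  have hd : (n * ε * r : 𝓞 F) = 3 + 4 * (c + n * a * r) := by
    have hc' := congrArg (Int.cast : ℤ → 𝓞 F) hc
    push_cast at hc' hε
    linear_combination (n * r : 𝓞 F) * hε + n * v * hr + hc'
  have h2p : (2 : 𝓞 F) ∈ P.under (𝓞 F) := by exact_mod_cast hqp
  refine mem_sqRamified_of_quadratic hG hσ P hP hP0 (1 + w) 2 (1 - n * ε * r) ?_ h2p ?_ ?_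
  · rw [map_sub, ← hw, map_ofNat, map_one]
    ring
  · rw [hd]
    convert Ideal.mul_mem_right (-1 - 2 * (c + n * a * r)) _ h2p using 1
    ring
  · intro h2
    refine natCast_notMem_sq hl hl8 hr hτ hτr hq hql hp hqp ?_
    have h4 : (4 : 𝓞 F) ∈ P.under (𝓞 F) ^ 2 := by
      convert Ideal.pow_mem_pow h2p 2 using 1
      norm_num
    have h5 := add_mem (Ideal.mul_mem_right (-(c + n * a * r)) _ h4) (neg_mem h2)
    rw [hd] at h5
    convert h5 using 1
    push_cast
    ring

theorem finite_and_card_sqRamified (hl : l.Prime) (hl8 : l % 8 = 1)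
    (hr : r ^ 2 = l) (hτ : τ ≠ 1) (hτr : τ • r = -r) (hn : n % 4 = 3 ∨ n % 8 = 6)
    (hsq : Squarefree n) (hln : ¬ l ∣ n) {u v : ℤ} (hε : (ε : 𝓞 F) = u + v * r)
    (hu : 4 ∣ u) (hv : v % 4 = 1)
    (hw : w ^ 2 = algebraMap (𝓞 F) (𝓞 K) (n * ε * r)) (hσ : σ ≠ 1) (hσw : σ • w = -w) :
    Finite (sqRamified (𝓞 F) (𝓞 K)) ∧ Nat.card (sqRamified (𝓞 F) (𝓞 K)) =
      ∑ p ∈ (2 * n * l).primeFactors, (primesAbove (𝓞 F) p).ncard := by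
  have hN0 : 2 * n * l ≠ 0 := by simp [hsq.ne_zero, hl.ne_zero]
  obtain ⟨hfin, hcard⟩ := finite_and_ncard_primesAbove_prod (F := F) hτ (2 * n * l).primeFactors
    fun p hp => Nat.prime_of_mem_primeFactors hp
  rw [primesAbove_prod_primeFactors hN0] at hfin hcard
  have hbij : Set.BijOn (fun P : Ideal (𝓞 K) => P.under (𝓞 F)) (sqRamified (𝓞 F) (𝓞 K))
      (primesAbove (𝓞 F) (2 * n * l)) := by
    refine ⟨fun P hP => under_mem_primesAbove_of_mem_sqRamified hr hw hσ hσw hP, ?_, ?_⟩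
    · intro P hP Q hQ hPQ
      have h1 : P ^ 2 = Q ^ 2 := by
        rw [← hP.2.2, ← hQ.2.2]
        exact congrArg _ hPQ
      have hPp := hP.1
      have hQp := hQ.1
      have h2 : P ≤ Q := hQp.le_of_pow_le (h1.le.trans (Ideal.pow_le_self two_ne_zero))
      exact (hPp.isMaximal hP.2.1).eq_of_le hQp.ne_top h2
    · intro p hp
      have hpp := hp.1
      obtain ⟨P, hPp, hP⟩ := (inferInstance : Nonempty (p.primesOver (𝓞 K)))
      have hPu : P.under (𝓞 F) = p := hP.over.symm
      exact ⟨P, mem_sqRamified_of_under_mem_primesAbove hl hl8 hr hτ hτr hn hsq hln hε hu hv hw hσ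
        hPp (hPu ▸ hp), hPu⟩
  refine ⟨(hbij.finite_iff_finite.2 hfin).to_subtype, ?_⟩
  rw [Nat.card_coe_set_eq, Set.ncard_congr' hbij.equiv, hcard]

theorem card_sq_eq_one_mul_eight [IsTotallyReal F] [IsTotallyReal K] (f : K →+* ℝ)
    (hl : l.Prime) (hl8 : l % 8 = 1)
    (hr : r ^ 2 = l) (hετ : ∀ τ : Gal(F/ℚ), τ • r = -r → (ε : 𝓞 F) * τ • (ε : 𝓞 F) = -1)
    (hunits : ∀ η : (𝓞 F)ˣ, ∃ m : ℤ, η = ε ^ m ∨ η = -ε ^ m)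
    (hn : n % 4 = 3 ∨ n % 8 = 6)
    (hsq : Squarefree n) (hln : ¬ l ∣ n) {u v : ℤ} (hε : (ε : 𝓞 F) = u + v * r)
    (hu : 4 ∣ u) (hv : v % 4 = 1)
    (hw : w ^ 2 = algebraMap (𝓞 F) (𝓞 K) (n * ε * r)) :
    Nat.card {x : ClassGroup (𝓞 K) // x ^ 2 = 1} * 8 =
      2 ^ ∑ p ∈ (2 * n * l).primeFactors, (primesAbove (𝓞 F) p).ncard := by
  obtain ⟨τ, hτ, hτr⟩ := exists_gal_smul_eq_neg (F := F) hl hr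
  obtain ⟨σ, hσ, hσw⟩ := exists_gal_smul_eq_neg_of_not_isSquare
    (not_isSquare_mul_mul hl hl8 hr hε hu hv hn) hw
  have hG : Nat.card Gal(K/F) = 2 := card_gal_of_isQuadraticExtension
  have hsqu := exists_sq_eq_of_norm hl hl8 hr hτr (hετ τ hτr) hunits hε hu hv hn hw hσw
  obtain ⟨hfin, hcard⟩ := finite_and_card_sqRamified hl hl8 hr hτ hτr hn hsq hln hε hu hv hw hσ hσw
  have hN (x : (𝓞 K)ˣ) : ∃ e : (𝓞 F)ˣ,
      (x : 𝓞 K) * σ • (x : 𝓞 K) = algebraMap (𝓞 F) (𝓞 K) (e ^ 2 : (𝓞 F)ˣ) := by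
    obtain ⟨η, hη⟩ := exists_unit_algebraMap_eq_mul_smul hσ x
    obtain ⟨e, rfl⟩ := hsqu η ⟨x, 1, one_ne_zero, by rw [hη, smul_one, mul_one, mul_one]⟩
    exact ⟨e, hη.symm⟩
  have hU (η : (𝓞 F)ˣ) (h : ∃ a b : 𝓞 K, b ≠ 0 ∧
      a * σ • a = algebraMap (𝓞 F) (𝓞 K) η * (b * σ • b)) :
      ∃ e : (𝓞 K)ˣ, (e : 𝓞 K) * σ • (e : 𝓞 K) = algebraMap (𝓞 F) (𝓞 K) η := by
    obtain ⟨e, rfl⟩ := hsqu η h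
    exact ⟨Units.map (algebraMap (𝓞 F) (𝓞 K)) e, by simp [sq]⟩
  have h1 := card_sq_eq_one_mul_index hG hσ (odd_card_classGroup hl hl8 hr hτ hτr (hετ τ hτr))
    (fun J hJ => isPrincipal_pow_card_classGroup J hJ) hU hN
  have h2 := index_sq_mul_index_sq_normOneUnits σ (f.comp (algebraMap (𝓞 K) K)) hN
  have h3 : Module.finrank ℚ F = 2 := Algebra.IsQuadraticExtension.finrank_eq_two ℚ F
  have h4 : Module.finrank ℚ K = 4 := by
    rw [← Module.finrank_mul_finrank ℚ F K, h3, Algebra.IsQuadraticExtension.finrank_eq_two F K]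
  rw [NumberField.Units.index_sq_of_isTotallyReal F (f.comp (algebraMap F K)),
    NumberField.Units.index_sq_of_isTotallyReal K f, h3, h4] at h2
  have h5 : (powMonoidHom 2 : normOneUnits (𝓞 K) σ →* normOneUnits (𝓞 K) σ).range.index = 8 := by
    omega
  rw [h5, hcard] at h1
  exact h1

end Relative

section Counting

theorem legSym_eq_one_iff {l : ℕ} (hl : l.Prime) (hl2 : l % 2 = 1) {a : ℕ} (ha : ¬ l ∣ a) :
    legSym l a = 1 ↔ IsSquare (a : ZMod l) := by
  have : Fact l.Prime := ⟨hl⟩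
  have ha0 : (a : ZMod l) ≠ 0 := by rwa [Ne, ZMod.natCast_eq_zero_iff]
  rw [ZMod.euler_criterion l ha0, show l / 2 = (l - 1) / 2 by omega]
  unfold legSym
  rw [Int.cast_natCast]
  split_ifs <;> simp_all

theorem legSym_eq_neg_one_iff {l a : ℕ} (ha : ¬ l ∣ a) :
    legSym l a = -1 ↔ ¬ legSym l a = 1 := by
  have ha0 : (a : ZMod l) ≠ 0 := by rwa [Ne, ZMod.natCast_eq_zero_iff]
  unfold legSym
  rw [Int.cast_natCast, if_neg ha0]
  split_ifs <;> simp

variable {l δ t s : ℕ} {p : Fin t → ℕ} {q : Fin s → ℕ}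

theorem primeFactors_prod_of_prime {ι : Type*} [Fintype ι] {f : ι → ℕ}
    (hf : ∀ i, (f i).Prime) : (∏ i, f i).primeFactors = Finset.univ.image f := by
  ext x
  rw [Nat.mem_primeFactors_of_ne_zero (Finset.prod_ne_zero_iff.2 fun i _ => (hf i).ne_zero)]
  simp only [Finset.mem_image, Finset.mem_univ, true_and]
  constructor
  · rintro ⟨hx, hdvd⟩
    obtain ⟨i, -, hi⟩ := (hx.prime.dvd_finsetProd_iff _).1 hdvd
    exact ⟨i, ((Nat.prime_dvd_prime_iff_eq hx (hf i)).1 hi).symm⟩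
  · rintro ⟨i, rfl⟩
    exact ⟨hf i, Finset.dvd_prod_of_mem f (Finset.mem_univ i)⟩

theorem primeFactors_two_mul_mul (hl : l.Prime) (hδ : δ = 1 ∨ δ = 2)
    (hp : ∀ i, (p i).Prime) (hq : ∀ j, (q j).Prime) :
    (2 * (δ * ((∏ i, p i) * ∏ j, q j)) * l).primeFactors =
      {2, l} ∪ (Finset.univ.image p ∪ Finset.univ.image q) := by
  have hp0 : ∏ i, p i ≠ 0 := Finset.prod_ne_zero_iff.2 fun i _ => (hp i).ne_zero
  have hq0 : ∏ j, q j ≠ 0 := Finset.prod_ne_zero_iff.2 fun j _ => (hq j).ne_zero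
  have hδ0 : δ ≠ 0 := by omega
  have hδ' : {2} ∪ δ.primeFactors = {2} := by
    rcases hδ with rfl | rfl <;> simp [Nat.prime_two.primeFactors]
  have hpp := primeFactors_prod_of_prime hp
  have hqq := primeFactors_prod_of_prime hq
  rw [Nat.primeFactors_mul (by positivity) hl.ne_zero, Nat.primeFactors_mul two_ne_zero
    (by positivity), Nat.primeFactors_mul hδ0 (by positivity), Nat.primeFactors_mul hp0 hq0,
    hpp, hqq, Nat.prime_two.primeFactors, hl.primeFactors, ← Finset.union_assoc, hδ']
  ext x
  simp only [Finset.mem_union, Finset.mem_insert, Finset.mem_singleton]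
  tauto

theorem sum_primeFactors_two_mul_mul (c : ℕ → ℕ) (hl : l.Prime) (hl2 : l ≠ 2)
    (hδ : δ = 1 ∨ δ = 2) (hp : ∀ i, (p i).Prime) (hq : ∀ j, (q j).Prime)
    (hpinj : Function.Injective p) (hqinj : Function.Injective q) (hpq : ∀ i j, p i ≠ q j)
    (hpl : ∀ i, p i ≠ l) (hql : ∀ j, q j ≠ l) (hp2 : ∀ i, p i ≠ 2) (hq2 : ∀ j, q j ≠ 2) :
    ∑ x ∈ (2 * (δ * ((∏ i, p i) * ∏ j, q j)) * l).primeFactors, c x =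
      c 2 + c l + (∑ i, c (p i) + ∑ j, c (q j)) := by
  rw [primeFactors_two_mul_mul hl hδ hp hq, Finset.sum_union, Finset.sum_union,
    Finset.sum_pair hl2.symm, Finset.sum_image hpinj.injOn, Finset.sum_image hqinj.injOn]
  · rw [Finset.disjoint_left]
    simp only [Finset.mem_image, Finset.mem_univ, true_and]
    rintro _ ⟨i, rfl⟩ ⟨j, hj⟩
    exact hpq i j hj.symm
  · rw [Finset.disjoint_left]
    simp only [Finset.mem_image, Finset.mem_univ, true_and, Finset.mem_insert, Finset.mem_union,
      Finset.mem_singleton, not_or, not_exists]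
    rintro _ (rfl | rfl)
    · exact ⟨hp2, hq2⟩
    · exact ⟨hpl, hql⟩

theorem sum_ite_two_one {ι : Type*} [Fintype ι] (P : ι → Prop) [DecidablePred P] :
    ∑ i, (if P i then 2 else 1) = Fintype.card ι + (Finset.univ.filter P).card := by
  rw [Finset.card_filter, ← Finset.card_univ, Finset.card_eq_sum_ones, ← Finset.sum_add_distrib]
  exact Finset.sum_congr rfl fun i _ => by split_ifs <;> rfl

theorem prod_mod_four_eq_one (hp4 : ∀ i, p i % 4 = 1) : (∏ i, p i) % 4 = 1 := by
  rw [Finset.prod_nat_mod]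
  simp [hp4]

theorem prod_mod_four_eq_three (hs : Odd s) (hq4 : ∀ j, q j % 4 = 3) : (∏ j, q j) % 4 = 3 := by
  obtain ⟨m, rfl⟩ := hs
  rw [Finset.prod_nat_mod]
  simp [hq4, pow_succ, pow_mul, Nat.mul_mod, Nat.pow_mod]

theorem mod_of_prod (hδ : δ = 1 ∨ δ = 2) (hs : Odd s) (hp4 : ∀ i, p i % 4 = 1)
    (hq4 : ∀ j, q j % 4 = 3) : δ * ((∏ i, p i) * ∏ j, q j) % 4 = 3 ∨
      δ * ((∏ i, p i) * ∏ j, q j) % 8 = 6 := by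
  have h : ((∏ i, p i) * ∏ j, q j) % 4 = 3 := by
    rw [Nat.mul_mod, prod_mod_four_eq_one hp4, prod_mod_four_eq_three hs hq4]
  rcases hδ with rfl | rfl <;> omega

theorem squarefree_prod_of_prime {ι : Type*} [Fintype ι] {f : ι → ℕ} (hf : ∀ i, (f i).Prime)
    (hinj : Function.Injective f) : Squarefree (∏ i, f i) :=
  Finset.squarefree_prod_of_pairwise_isCoprime
    (fun _ _ _ _ hij => Nat.coprime_iff_isRelPrime.1
      ((Nat.coprime_primes (hf _) (hf _)).2 (hinj.ne hij)))
    fun i _ => (hf i).squarefree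

theorem squarefree_mul_prod (hδ : δ = 1 ∨ δ = 2) (hp : ∀ i, (p i).Prime) (hq : ∀ j, (q j).Prime)
    (hpinj : Function.Injective p) (hqinj : Function.Injective q) (hpq : ∀ i j, p i ≠ q j)
    (hp2 : ∀ i, p i ≠ 2) (hq2 : ∀ j, q j ≠ 2) :
    Squarefree (δ * ((∏ i, p i) * ∏ j, q j)) := by
  have h1 : Squarefree ((∏ i, p i) * ∏ j, q j) := by
    rw [Nat.squarefree_mul]
    · exact ⟨squarefree_prod_of_prime hp hpinj, squarefree_prod_of_prime hq hqinj⟩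
    · exact Nat.Coprime.prod_left fun i _ => Nat.Coprime.prod_right fun j _ =>
        (Nat.coprime_primes (hp i) (hq j)).2 (hpq i j)
  rcases hδ with rfl | rfl
  · rwa [one_mul]
  · rw [Nat.squarefree_mul]
    · exact ⟨Nat.prime_two.squarefree, h1⟩
    · exact Nat.Coprime.mul_right
        (Nat.Coprime.prod_right fun i _ => (Nat.coprime_primes Nat.prime_two (hp i)).2 (hp2 i).symm)
        (Nat.Coprime.prod_right fun j _ => (Nat.coprime_primes Nat.prime_two (hq j)).2 (hq2 j).symm)

theorem not_dvd_mul_prod (hl : l.Prime) (hl2 : l ≠ 2) (hδ : δ = 1 ∨ δ = 2)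
    (hp : ∀ i, (p i).Prime) (hq : ∀ j, (q j).Prime)
    (hpl : ∀ i, p i ≠ l) (hql : ∀ j, q j ≠ l) : ¬ l ∣ δ * ((∏ i, p i) * ∏ j, q j) := by
  rw [hl.dvd_mul, hl.dvd_mul, hl.prime.dvd_finsetProd_iff, hl.prime.dvd_finsetProd_iff]
  rintro (h | ⟨i, -, h⟩ | ⟨j, -, h⟩)
  · rcases hδ with rfl | rfl
    · exact hl.one_lt.ne' (Nat.dvd_one.1 h)
    · exact hl2 ((Nat.prime_dvd_prime_iff_eq hl Nat.prime_two).1 h)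
  · exact hpl i ((Nat.prime_dvd_prime_iff_eq hl (hp i)).1 h).symm
  · exact hql j ((Nat.prime_dvd_prime_iff_eq hl (hq j)).1 h).symm

end Counting

section FundamentalUnit

open NumberField

theorem four_dvd_and_mod_four_of_sq_add_one_eq {l : ℕ} (hl8 : l % 8 = 1) {u v : ℤ}
    (h : u ^ 2 + 1 = l * v ^ 2) (hv : 0 < v) : 4 ∣ u ∧ v % 4 = 1 := by
  have h8 : (u % 8) ^ 2 % 8 = ((v % 8) ^ 2 + 7) % 8 := by
    have h1 : (l : ℤ) % 8 = 1 := by omega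
    have h2 : (l * v ^ 2 : ℤ) % 8 = (v % 8) ^ 2 % 8 := by simp [Int.mul_emod, h1, pow_two]
    have h3 : (u % 8) ^ 2 % 8 = u ^ 2 % 8 := by simp [Int.mul_emod, pow_two]
    omega
  have hu8 : u % 8 = 0 ∨ u % 8 = 4 := by
    have h1 : 0 ≤ u % 8 := by omega
    have h2 : u % 8 < 8 := by omega
    have h3 : 0 ≤ v % 8 := by omega
    have h4 : v % 8 < 8 := by omega
    generalize u % 8 = a at *
    generalize v % 8 = b at *
    interval_cases a <;> interval_cases b <;> simp_all
  refine ⟨by omega, ?_⟩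
  lift v to ℕ using hv.le
  have hsq : IsSquare (-1 : ZMod v) := by
    refine ⟨(u : ZMod v), ?_⟩
    have h1 := congrArg (Int.cast : ℤ → ZMod v) h
    push_cast at h1
    rw [ZMod.natCast_self] at h1
    linear_combination -h1
  obtain ⟨x, y, hxy⟩ := Nat.eq_sq_add_sq_of_isSquare_mod_neg_one hsq
  have hodd : (v : ℤ) % 2 = 1 := by
    rcases hu8 with h1 | h1
    all_goals
      by_contra h2
      have h3 : (v : ℤ) % 8 = 0 ∨ (v : ℤ) % 8 = 2 ∨ (v : ℤ) % 8 = 4 ∨ (v : ℤ) % 8 = 6 := by omega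
      rw [h1] at h8
      rcases h3 with h3 | h3 | h3 | h3 <;> rw [h3] at h8 <;> norm_num at h8
  have hx : x % 4 = 0 ∨ x % 4 = 1 ∨ x % 4 = 2 ∨ x % 4 = 3 := by omega
  have hy : y % 4 = 0 ∨ y % 4 = 1 ∨ y % 4 = 2 ∨ y % 4 = 3 := by omega
  have h4 : v % 4 = ((x % 4) ^ 2 + (y % 4) ^ 2) % 4 := by
    rw [hxy, Nat.add_mod, Nat.pow_mod, Nat.pow_mod y, ← Nat.add_mod]
  rcases hx with hx | hx | hx | hx <;> rcases hy with hy | hy | hy | hy <;>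
    rw [hx, hy] at h4 <;> norm_num at h4 <;> omega

theorem even_of_sq_sub_mul_sq_eq_neg_four {l : ℕ} (hl8 : l % 8 = 1) {a b : ℤ}
    (h : a ^ 2 - l * b ^ 2 = -4) : 2 ∣ a ∧ 2 ∣ b := by
  have h8 : (a % 8) ^ 2 % 8 = ((b % 8) ^ 2 + 4) % 8 := by
    have h1 : (l : ℤ) % 8 = 1 := by omega
    have h2 : (l * b ^ 2 : ℤ) % 8 = (b % 8) ^ 2 % 8 := by simp [Int.mul_emod, h1, pow_two]
    have h3 : (a % 8) ^ 2 % 8 = a ^ 2 % 8 := by simp [Int.mul_emod, pow_two]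
    omega
  have h1 : 0 ≤ a % 8 := by omega
  have h2 : a % 8 < 8 := by omega
  have h3 : 0 ≤ b % 8 := by omega
  have h4 : b % 8 < 8 := by omega
  have h5 : 2 ∣ a % 8 ∧ 2 ∣ b % 8 := by
    generalize a % 8 = x at *
    generalize b % 8 = y at *
    interval_cases x <;> interval_cases y <;> simp_all
  omega

theorem exists_zpow_of_isLeast_unit {R : Type*} [CommRing R] {f : R →+* ℝ}
    (hf : Function.Injective f) {ε : Rˣ} (hε : 1 < f ε) (hmin : ∀ x : Rˣ, 1 < f x → f ε ≤ f x)
    (η : Rˣ) : ∃ m : ℤ, η = ε ^ m ∨ η = -ε ^ m := by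
  let g : Rˣ →* ℝˣ := Units.map f
  have hg (x : Rˣ) : ((g x : ℝˣ) : ℝ) = f x := rfl
  have hpos (x : Rˣ) (hx : 0 < f x) : ∃ m : ℤ, x = ε ^ m := by
    obtain ⟨m, hm1, hm2⟩ := exists_mem_Ico_zpow hx hε
    refine ⟨m, ?_⟩
    have hεm : 0 < f ε ^ m := zpow_pos (one_pos.trans hε) m
    have h1 : f (x * ε ^ (-m) : Rˣ) = f x / f ε ^ m := by
      rw [← hg, map_mul, map_zpow, Units.val_mul, Units.val_zpow_eq_zpow_val, hg, hg, zpow_neg,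
        div_eq_mul_inv]
    have h2 : f (x * ε ^ (-m) : Rˣ) = 1 := by
      refine le_antisymm (not_lt.1 fun h => ?_) ?_
      · have h3 := hmin _ h
        rw [h1, le_div_iff₀ hεm, ← zpow_one_add₀ (one_pos.trans hε).ne', add_comm] at h3
        exact h3.not_gt hm2
      · rw [h1, le_div_iff₀ hεm, one_mul]
        exact hm1
    have h3 : x * ε ^ (-m) = 1 := Units.ext (hf (by rw [h2, Units.val_one, map_one]))
    rwa [zpow_neg, mul_inv_eq_one] at h3
  have h0 : f η ≠ 0 := (g η).ne_zero
  rcases h0.lt_or_gt with h | h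
  · obtain ⟨m, hm⟩ := hpos (-η) (by rw [Units.val_neg, map_neg]; exact neg_pos.2 h)
    exact ⟨m, Or.inr (by rw [← hm, neg_neg])⟩
  · obtain ⟨m, hm⟩ := hpos η h
    exact ⟨m, Or.inl hm⟩

variable {F : Type*} [Field F] [NumberField F] [Algebra.IsQuadraticExtension ℚ F]
  {l : ℕ} {r : 𝓞 F} {τ : Gal(F/ℚ)} {ε : (𝓞 F)ˣ}

theorem exists_int_eq_add_mul (hl : l.Prime) (hl8 : l % 8 = 1) (hr : r ^ 2 = l) (hτ : τ ≠ 1)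
    (hτr : τ • r = -r) (hετ : (ε : 𝓞 F) * τ • (ε : 𝓞 F) = -1) (f : 𝓞 F →+* ℝ) (hfr : 0 < f r)
    (hε1 : 1 < f ε) : ∃ u v : ℤ, (ε : 𝓞 F) = u + v * r ∧ u ^ 2 + 1 = l * v ^ 2 ∧
      4 ∣ u ∧ v % 4 = 1 ∧ 0 < v := by
  obtain ⟨a, b, hab⟩ := exists_two_mul_eq_add hl hr hτ hτr (ε : 𝓞 F)
  have hτab : 2 * τ • (ε : 𝓞 F) = a - b * r := by
    have h := congrArg (τ • ·) hab
    simp only [smul_mul', smul_add, hτr] at h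
    have h2 (m : ℤ) : τ • (m : 𝓞 F) = m := 
      map_intCast (MulSemiringAction.toRingHom Gal(F/ℚ) (𝓞 F) τ) m
    rw [h2, h2, show τ • (2 : 𝓞 F) = 2 by simpa using h2 2] at h
    linear_combination h
  have h4 : a ^ 2 - l * b ^ 2 = -4 := by
    have h : ((a ^ 2 - l * b ^ 2 : ℤ) : 𝓞 F) = (-4 : ℤ) := by
      push_cast
      linear_combination 4 * hετ + (b : 𝓞 F) ^ 2 * hr - (a - b * r) * hab -
        2 * (ε : 𝓞 F) * hτab
    exact_mod_cast h
  obtain ⟨⟨u, rfl⟩, ⟨v, rfl⟩⟩ := even_of_sq_sub_mul_sq_eq_neg_four hl8 h4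
  have hε : (ε : 𝓞 F) = u + v * r := by
    refine mul_left_cancel₀ (two_ne_zero (α := 𝓞 F)) ?_
    rw [hab]
    push_cast
    ring
  have huv : u ^ 2 + 1 = l * v ^ 2 := by linarith
  suffices hv : 0 < v from
    let h := four_dvd_and_mod_four_of_sq_add_one_eq hl8 huv hv
    ⟨u, v, hε, huv, h.1, h.2, hv⟩
  have h1 : f ε = u + v * f r := by rw [hε, map_add, map_mul, map_intCast, map_intCast]
  have h2 : f r ^ 2 = l := by rw [← map_pow, hr, map_natCast]
  have h3 : (u + v * f r) * (u - v * f r) = -1 := by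
    have : (u ^ 2 + 1 : ℝ) = l * v ^ 2 := by exact_mod_cast huv
    linear_combination this - (v : ℝ) ^ 2 * h2
  rw [h1] at hε1
  have h5 : 0 < v * f r := by nlinarith
  exact_mod_cast (pos_iff_pos_of_mul_pos h5).2 hfr

end FundamentalUnit

section TotallyReal

open NumberField IntermediateField ComplexConjugate

theorem Complex.exists_eq_ofReal_of_sq_eq {z : ℂ} {a : ℝ} (ha : 0 ≤ a) (h : z ^ 2 = a) :
    ∃ x : ℝ, z = x ∧ x ^ 2 = a := by
  have h1 : z ^ 2 = (Real.sqrt a : ℂ) ^ 2 := by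
    rw [h, ← Complex.ofReal_pow, Real.sq_sqrt ha]
  rcases sq_eq_sq_iff_eq_or_eq_neg.1 h1 with h2 | h2
  · exact ⟨Real.sqrt a, h2, Real.sq_sqrt ha⟩
  · exact ⟨-Real.sqrt a, by rw [h2, Complex.ofReal_neg], by rw [neg_sq, Real.sq_sqrt ha]⟩

theorem isTotallyReal_of_adjoin_eq_top {K : Type*} [Field K] [NumberField K] {z : K}
    (hz : ℚ⟮z⟯ = ⊤) (h : ∀ φ : K →+* ℂ, ∃ x : ℝ, φ z = x) : IsTotallyReal K := by
  refine ⟨fun v => InfinitePlace.isReal_iff.2 (ComplexEmbedding.isReal_iff.2 ?_)⟩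
  set φ := v.embedding
  obtain ⟨x, hx⟩ := h φ
  have h1 : (ComplexEmbedding.conjugate φ).toRatAlgHom.comp (val ⊤) =
      φ.toRatAlgHom.comp (val ⊤) := by
    refine algHom_ext_of_eq_adjoin ℚ hz.symm ?_
    intro y hy
    change conj (φ y) = φ y
    rw [Set.mem_singleton_iff.1 hy, hx, Complex.conj_ofReal]
  exact RingHom.ext fun y => DFunLike.congr_fun h1 ⟨y, mem_top⟩

end TotallyReal

section Main

open NumberField IntermediateField

variable {F : Type*} [Field F] [NumberField F] [Algebra.IsQuadraticExtension ℚ F]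
  {l : ℕ} {r : 𝓞 F} {ε : (𝓞 F)ˣ} {K : Type*} [Field K] [NumberField K] [Algebra F K] {w : 𝓞 K}

theorem isTotallyReal_of_sq_eq_mul {n : ℕ} (hr : r ^ 2 = l) {u v : ℤ}
    (hε : (ε : 𝓞 F) = u + v * r) (huv : u ^ 2 + 1 = l * v ^ 2) (hv : 0 < v)
    (hw : w ^ 2 = algebraMap (𝓞 F) (𝓞 K) (n * ε * r))
    (hadj : ℚ⟮algebraMap (𝓞 K) K w⟯ = ⊤) : IsTotallyReal K := by
  refine isTotallyReal_of_adjoin_eq_top hadj fun φ => ?_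
  let ψ : 𝓞 F →+* ℂ := φ.comp ((algebraMap (𝓞 K) K).comp (algebraMap (𝓞 F) (𝓞 K)))
  have h1 : ψ r ^ 2 = ((l : ℝ) : ℂ) := by rw [← map_pow, hr, map_natCast, Complex.ofReal_natCast]
  obtain ⟨x, hx, hxl⟩ := Complex.exists_eq_ofReal_of_sq_eq (Nat.cast_nonneg l) h1
  have h2 : φ (algebraMap (𝓞 K) K w) ^ 2 = ((n * (u * x + v * l) : ℝ) : ℂ) := by
    rw [← map_pow, ← map_pow, hw]
    change ψ (n * ε * r) = _
    have h3 : (n * ε * r : 𝓞 F) = n * (u * r + v * l) := by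
      rw [hε, ← hr]
      ring
    rw [h3]
    push_cast
    rw [map_mul, map_add, map_mul, map_mul, map_natCast, map_intCast, map_intCast, map_natCast, hx]
  have h4 : 0 ≤ u * x + v * (l : ℝ) := by
    have h5 : ((u : ℝ) * x) ^ 2 ≤ (v * l) ^ 2 := by
      have h6 : (u ^ 2 + 1 : ℝ) = l * v ^ 2 := by exact_mod_cast huv
      have h7 : (0 : ℝ) ≤ l := Nat.cast_nonneg l
      rw [mul_pow, hxl]
      nlinarith
    have h8 : (0 : ℝ) ≤ v * l := by positivity
    have := abs_le_of_sq_le_sq' h5 h8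
    linarith
  obtain ⟨y, hy, -⟩ := Complex.exists_eq_ofReal_of_sq_eq
    (mul_nonneg (Nat.cast_nonneg n) h4) h2
  exact ⟨y, hy⟩

theorem card_sq_eq_one_mul_eight_of_isLeast (f : K →+* ℝ) {n : ℕ}
    (hl : l.Prime) (hl8 : l % 8 = 1) (hr : r ^ 2 = l)
    (hετ : ∀ τ : Gal(F/ℚ), τ • r = -r → (ε : 𝓞 F) * τ • (ε : 𝓞 F) = -1)
    (hfr : 0 < f (algebraMap F K r)) (hε1 : 1 < f (algebraMap F K ε))
    (hmin : ∀ x : (𝓞 F)ˣ, 1 < f (algebraMap F K x) →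
      f (algebraMap F K ε) ≤ f (algebraMap F K x))
    (hn : n % 4 = 3 ∨ n % 8 = 6) (hsq : Squarefree n) (hln : ¬ l ∣ n)
    (hw : w ^ 2 = algebraMap (𝓞 F) (𝓞 K) (n * ε * r))
    (hadj : ℚ⟮algebraMap (𝓞 K) K w⟯ = ⊤) :
    Nat.card {x : ClassGroup (𝓞 K) // x ^ 2 = 1} * 8 =
      2 ^ ∑ p ∈ (2 * n * l).primeFactors, (primesAbove (𝓞 F) p).ncard := by
  obtain ⟨τ, hτ, hτr⟩ := exists_gal_smul_eq_neg (F := F) hl hr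
  let g : 𝓞 F →+* ℝ := f.comp ((algebraMap F K).comp (algebraMap (𝓞 F) F))
  have hg : Function.Injective g := f.injective.comp
    ((algebraMap F K).injective.comp (FaithfulSMul.algebraMap_injective (𝓞 F) F))
  obtain ⟨u, v, hε, huv, hu, hv, hv0⟩ :=
    exists_int_eq_add_mul hl hl8 hr hτ hτr (hετ τ hτr) g hfr hε1
  have hns := not_isSquare_mul_mul hl hl8 hr hε hu hv hn
  have : Algebra.IsQuadraticExtension F K :=
    { finrank_eq_two' := finrank_eq_two_of_adjoin_sqrt (w := algebraMap (𝓞 K) K w)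
        (by rw [← map_pow, hw, algebraMap_coe_ringOfIntegers]) hns
        (adjoin_eq_top_of_adjoin_eq_top ℚ hadj) }
  have : IsTotallyReal K := isTotallyReal_of_sq_eq_mul hr hε huv hv0 hw hadj
  have : IsTotallyReal F := IsTotallyReal.of_algebra F K
  exact card_sq_eq_one_mul_eight f hl hl8 hr hετ
    (exists_zpow_of_isLeast_unit hg hε1 hmin) hn hsq hln hε hu hv hw

theorem sum_ncard_primesAbove (hl : l.Prime) (hl8 : l % 8 = 1) (hr : r ^ 2 = l)
    {δ t s : ℕ} {p : Fin t → ℕ} {q : Fin s → ℕ}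
    (hδ : δ = 1 ∨ δ = 2) (hp : ∀ i, (p i).Prime) (hq : ∀ j, (q j).Prime)
    (hpinj : Function.Injective p) (hqinj : Function.Injective q) (hpq : ∀ i j, p i ≠ q j)
    (hpl : ∀ i, p i ≠ l) (hql : ∀ j, q j ≠ l) (hp2 : ∀ i, p i ≠ 2) (hq2 : ∀ j, q j ≠ 2) :
    ∑ x ∈ (2 * (δ * ((∏ i, p i) * ∏ j, q j)) * l).primeFactors, (primesAbove (𝓞 F) x).ncard =
      3 + (t + (Finset.univ.filter fun i => legSym l (p i) = 1).card +
        (Finset.univ.filter fun j => legSym l (q j) = -1).card +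
        2 * (Finset.univ.filter fun j => legSym l (q j) = 1).card) := by
  classical
  obtain ⟨τ, hτ, hτr⟩ := exists_gal_smul_eq_neg (F := F) hl hr
  have hl2 : l ≠ 2 := by omega
  have hnd {x : ℕ} (hx : x.Prime) (hxl : x ≠ l) : ¬ l ∣ x := fun h =>
    hxl ((Nat.prime_dvd_prime_iff_eq hl hx).1 h).symm
  have hcard {x : ℕ} (hx : x.Prime) (hx2 : x ≠ 2) (hxl : x ≠ l) :
      (primesAbove (𝓞 F) x).ncard = if legSym l x = 1 then 2 else 1 := by
    rw [ncard_primesAbove_of_odd hl hl8 hr hτ hτr hx hx2 hxl]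
    exact if_congr (legSym_eq_one_iff hl (by omega) (hnd hx hxl)).symm rfl rfl
  rw [sum_primeFactors_two_mul_mul _ hl hl2 hδ hp hq hpinj hqinj hpq hpl hql hp2 hq2,
    ncard_primesAbove_two hl8 hr hτ hτr, ncard_primesAbove_self hl hr hτ,
    Finset.sum_congr rfl fun i _ => hcard (hp i) (hp2 i) (hpl i),
    Finset.sum_congr rfl fun j _ => hcard (hq j) (hq2 j) (hql j),
    sum_ite_two_one, sum_ite_two_one, Fintype.card_fin, Fintype.card_fin]
  have h1 : (Finset.univ.filter fun j => legSym l (q j) = -1) =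
      Finset.univ.filter fun j => ¬ legSym l (q j) = 1 :=
    Finset.filter_congr fun j _ => legSym_eq_neg_one_iff (hnd (hq j) (hql j))
  have h2 := Finset.card_filter_add_card_filter_not (s := (Finset.univ : Finset (Fin s)))
    (fun j => legSym l (q j) = 1)
  rw [Finset.card_univ, Fintype.card_fin] at h2
  rw [h1]
  omega

end Main

section Real

open NumberField IntermediateField

theorem mul_smul_eq_neg_one {F : Type*} [Field F] [CharZero F] {l : ℕ} {r ε : 𝓞 F}
    {τ : Gal(F/ℚ)} (hr : r ^ 2 = l) (hτr : τ • r = -r) {u v : ℚ}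
    (hε : algebraMap (𝓞 F) F ε = u + v * algebraMap (𝓞 F) F r) (huv : u ^ 2 - v ^ 2 * l = -1) :
    ε * τ • ε = -1 := by
  have hcoe (x : 𝓞 F) : algebraMap (𝓞 F) F (τ • x) = τ (algebraMap (𝓞 F) F x) :=
    algebraMap.coe_smul' τ x F
  have hr' : algebraMap (𝓞 F) F r ^ 2 = l := by rw [← map_pow, hr, map_natCast]
  have huv' : (u ^ 2 - v ^ 2 * l : F) = -1 := by exact_mod_cast congrArg (Rat.cast : ℚ → F) huv
  refine FaithfulSMul.algebraMap_injective (𝓞 F) F ?_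
  rw [map_mul, hcoe, hε, map_add, map_mul, map_ratCast, map_ratCast, ← hcoe, hτr, map_neg, map_neg,
    map_one]
  linear_combination huv' - (v : F) ^ 2 * hr'

theorem adjoin_coe_eq_top {E L : Type*} [Field E] [Field L] [Algebra E L]
    {S : IntermediateField E L} {x : S} (h : S = E⟮(x : L)⟯) : E⟮x⟯ = ⊤ :=
  lift_injective S (by rw [lift_adjoin_simple, lift_top, ← h])

variable {S : IntermediateField ℚ ℝ} {x : ℝ}

theorem exists_ringOfIntegers_coe_eq (hx : x ∈ S) (hi : IsIntegral ℤ x) :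
    ∃ y : 𝓞 S, ((algebraMap (𝓞 S) S y : S) : ℝ) = x :=
  ⟨⟨⟨x, hx⟩, (isIntegral_algebraMap_iff (algebraMap S ℝ).injective).1 hi⟩, rfl⟩

theorem ringOfIntegers_coe_injective :
    Function.Injective fun y : 𝓞 S => ((algebraMap (𝓞 S) S y : S) : ℝ) :=
  Subtype.val_injective.comp (FaithfulSMul.algebraMap_injective (𝓞 S) S)

theorem exists_unit_coe_eq (hx : x ∈ S) (h0 : x ≠ 0) (hi : IsIntegral ℤ x)
    (hi' : IsIntegral ℤ x⁻¹) : ∃ y : (𝓞 S)ˣ, ((algebraMap (𝓞 S) S y : S) : ℝ) = x := by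
  obtain ⟨y, hy⟩ := exists_ringOfIntegers_coe_eq hx hi
  obtain ⟨z, hz⟩ := exists_ringOfIntegers_coe_eq (S.inv_mem hx) hi'
  refine ⟨Units.mkOfMulEqOne y z (ringOfIntegers_coe_injective ?_), hy⟩
  simp [hy, hz, h0]

theorem isIntegral_coe_ringOfIntegers (y : 𝓞 S) :
    IsIntegral ℤ ((algebraMap (𝓞 S) S y : S) : ℝ) :=
  (isIntegral_algebraMap_iff (algebraMap S ℝ).injective).2 y.2

theorem isIntegral_sqrt_natCast (m : ℕ) : IsIntegral ℤ (Real.sqrt (m : ℝ)) := by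
  refine IsIntegral.of_pow two_pos ?_
  rw [Real.sq_sqrt (Nat.cast_nonneg m)]
  exact isIntegral_algebraMap (R := ℤ) (x := (m : ℤ))

theorem le_coe_unit {l : ℕ} {ε₀ : ℝ} (hε : IsFundamentalUnit l ε₀)
    (hS : S = adjoin ℚ {Real.sqrt (l : ℝ)}) (y : (𝓞 S)ˣ)
    (hy : 1 < ((algebraMap (𝓞 S) S y : S) : ℝ)) : ε₀ ≤ ((algebraMap (𝓞 S) S y : S) : ℝ) := by
  refine hε.2.2.2.2 _ hy (hS ▸ SetLike.coe_mem _) (isIntegral_coe_ringOfIntegers _) ?_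
  convert isIntegral_coe_ringOfIntegers (S := S) ((y⁻¹ : (𝓞 S)ˣ) : 𝓞 S) using 1
  refine inv_eq_of_mul_eq_one_right ?_
  rw [← MulMemClass.coe_mul, ← map_mul, Units.mul_inv, map_one]
  rfl

theorem exists_ringOfIntegers_sq_eq {m : ℕ} (hx : Real.sqrt (m : ℝ) ∈ S) :
    ∃ r : 𝓞 S, ((algebraMap (𝓞 S) S r : S) : ℝ) = Real.sqrt m ∧ r ^ 2 = m := by
  obtain ⟨r, hr⟩ := exists_ringOfIntegers_coe_eq hx (isIntegral_sqrt_natCast m)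
  exact ⟨r, hr, ringOfIntegers_coe_injective (by
    simp [hr, Real.sq_sqrt (Nat.cast_nonneg (α := ℝ) m)])⟩

theorem finrank_eq_two_of_eq_adjoin_sqrt {l : ℕ} (hl : l.Prime)
    (hS : S = adjoin ℚ {Real.sqrt (l : ℝ)}) : Module.finrank ℚ S = 2 := by
  have hmem : Real.sqrt (l : ℝ) ∈ S := hS ▸ mem_adjoin_simple_self ℚ _
  refine finrank_eq_two_of_adjoin_sqrt (w := (⟨_, hmem⟩ : S)) (d := l) (Subtype.ext ?_)
    (not_isSquare_natCast_of_prime hl) (adjoin_coe_eq_top hS)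
  simp

theorem sqrt_mem_of_eq_adjoin {l n : ℕ} {ε₀ : ℝ} (hl : l.Prime) (hn : n ≠ 0) {u v : ℚ}
    (hε : ε₀ = u + v * Real.sqrt (l : ℝ)) (huv : u ^ 2 - v ^ 2 * l = -1)
    (hx : x ^ 2 = n * ε₀ * Real.sqrt (l : ℝ)) (hxS : x ∈ S) : Real.sqrt (l : ℝ) ∈ S := by
  have hu : u ≠ 0 := by
    rintro rfl
    have hv : v ≠ 0 := by
      rintro rfl
      norm_num at huv
    refine not_isSquare_natCast_of_prime hl ⟨v⁻¹, ?_⟩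
    field_simp
    linarith
  have hn' : (n : ℝ) ≠ 0 := by exact_mod_cast hn
  have hu' : (u : ℝ) ≠ 0 := by exact_mod_cast hu
  have h1 : Real.sqrt (l : ℝ) = (x ^ 2 / n - v * l) / u := by
    rw [hx, hε]
    field_simp
    linear_combination -v * Real.sq_sqrt (Nat.cast_nonneg (α := ℝ) l)
  rw [h1]
  exact S.div_mem (S.sub_mem (S.div_mem (pow_mem hxS 2) (_root_.natCast_mem S n))
    (S.mul_mem (SubfieldClass.ratCast_mem S v) (_root_.natCast_mem S l))) (SubfieldClass.ratCast_mem S u)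

theorem twoTorsCard_mul_eight {l n : ℕ} {ε₀ : ℝ} (hl : l.Prime) (hl8 : l % 8 = 1)
    (hε : IsFundamentalUnit l ε₀)
    (hεnorm : ∃ u v : ℚ, ε₀ = (u : ℝ) + (v : ℝ) * Real.sqrt (l : ℝ) ∧
      (u : ℝ) ^ 2 - (v : ℝ) ^ 2 * (l : ℝ) = -1)
    (hn : n % 4 = 3 ∨ n % 8 = 6) (hsq : Squarefree n) (hln : ¬ l ∣ n)
    {F K : IntermediateField ℚ ℝ} [NumberField F] [NumberField K]
    (hF : F = adjoin ℚ {Real.sqrt (l : ℝ)})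
    (hK : K = adjoin ℚ {Real.sqrt ((n : ℝ) * ε₀ * Real.sqrt (l : ℝ))}) :
    twoTorsCard K * 8 = 2 ^ ∑ p ∈ (2 * n * l).primeFactors, (primesAbove (𝓞 F) p).ncard := by
  obtain ⟨u, v, hε₀, huv⟩ := hεnorm
  have huv : u ^ 2 - v ^ 2 * l = -1 := by exact_mod_cast huv
  have hl0 : 0 < Real.sqrt (l : ℝ) := Real.sqrt_pos.2 (Nat.cast_pos.2 hl.pos)
  have hε0 : 0 < ε₀ := one_pos.trans hε.1
  set W := Real.sqrt ((n : ℝ) * ε₀ * Real.sqrt (l : ℝ)) with hW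
  have hW2 : W ^ 2 = n * ε₀ * Real.sqrt (l : ℝ) := Real.sq_sqrt (by positivity)
  have hWi : IsIntegral ℤ W := by
    refine IsIntegral.of_pow two_pos ?_
    rw [hW2]
    exact ((isIntegral_algebraMap (R := ℤ) (x := (n : ℤ))).mul hε.2.2.1).mul
      (isIntegral_sqrt_natCast l)
  have hWK : W ∈ K := hK ▸ mem_adjoin_simple_self ℚ W
  have hRK : Real.sqrt (l : ℝ) ∈ K := sqrt_mem_of_eq_adjoin hl hsq.ne_zero hε₀ huv hW2 hWK
  have hFK : F ≤ K := by rw [hF, adjoin_simple_le_iff]; exact hRK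
  obtain ⟨r, hr, hr2⟩ := exists_ringOfIntegers_sq_eq (S := F) (hF ▸ mem_adjoin_simple_self ℚ _)
  obtain ⟨w, hw⟩ := exists_ringOfIntegers_coe_eq hWK hWi
  obtain ⟨ε, hε'⟩ := exists_unit_coe_eq (S := F) (hF ▸ hε.2.1) hε0.ne' hε.2.2.1 hε.2.2.2.1
  let _ : Algebra F K := (inclusion hFK).toRingHom.toAlgebra
  have : Algebra.IsQuadraticExtension ℚ F :=
    { finrank_eq_two' := finrank_eq_two_of_eq_adjoin_sqrt hl hF }
  refine card_sq_eq_one_mul_eight_of_isLeast (algebraMap K ℝ) (r := r) (ε := ε) (w := w) hl hl8 hr2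
    (fun τ hτ => mul_smul_eq_neg_one hr2 hτ (u := u) (v := v) (Subtype.ext ?_) huv)
    (hl0.trans_eq hr.symm) (hε.1.trans_eq hε'.symm)
    (fun x hx => hε'.trans_le (le_coe_unit hε hF x hx)) hn hsq hln
    (ringOfIntegers_coe_injective ?_) (adjoin_coe_eq_top (hK.trans (by rw [hw])))
  · rw [hε', hε₀]
    simp [hr]
  · change ((algebraMap (𝓞 K) K (w ^ 2) : K) : ℝ) = ((algebraMap (𝓞 F) F (n * ε * r) : F) : ℝ)
    simp [hw, hW2, hε', hr]

end Real

end

/-- `l ≡ 1 (mod 8)` prime, `δ ∈ {1,2}`, `n = δ·p₁⋯p_t·q₁⋯q_s` with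
distinct primes `pᵢ ≡ 1 (mod 4)`, `qⱼ ≡ 3 (mod 4)`, all coprime to `l`, `t ≥ 1`,
`s ≥ 1` odd.  With `h = t + #{i : (pᵢ/l) = 1}` (the number of primes of `k` above
`p₁⋯p_t`), `s₁ = #{j : (qⱼ/l) = -1}`, `s₂ = #{j : (qⱼ/l) = 1}` (so `s = s₁ + s₂`),
one has `r₂(H) = h + s₁ + 2s₂`. -/
theorem stmt_6 (l : ℕ) (hl : l.Prime) (hl8 : l % 8 = 1)
    (ε₀ : ℝ) (hε : IsFundamentalUnit l ε₀)
    (hεnorm : ∃ u v : ℚ, ε₀ = (u : ℝ) + (v : ℝ) * Real.sqrt (l : ℝ) ∧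
      (u : ℝ) ^ 2 - (v : ℝ) ^ 2 * (l : ℝ) = -1)
    (δ : ℕ) (hδ : δ = 1 ∨ δ = 2)
    (t s : ℕ) (ht : 1 ≤ t) (hsodd : Odd s)
    (p : Fin t → ℕ) (q : Fin s → ℕ)
    (hpprime : ∀ i, (p i).Prime) (hqprime : ∀ j, (q j).Prime)
    (hpinj : Function.Injective p) (hqinj : Function.Injective q)
    (hpq : ∀ i j, p i ≠ q j)
    (hpl : ∀ i, p i ≠ l) (hql : ∀ j, q j ≠ l)
    (hp4 : ∀ i, p i % 4 = 1) (hq4 : ∀ j, q j % 4 = 3)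
    (n : ℕ) (hn : n = δ * ((∏ i, p i) * ∏ j, q j))
    (h : ℕ) (hh : h = t + (Finset.filter (fun i => legSym l (p i) = 1) Finset.univ).card)
    (s₁ s₂ : ℕ)
    (hs₁ : s₁ = (Finset.filter (fun j => legSym l (q j) = -1) Finset.univ).card)
    (hs₂ : s₂ = (Finset.filter (fun j => legSym l (q j) = 1) Finset.univ).card)
    (K : IntermediateField ℚ ℝ)
    (hK : K = IntermediateField.adjoin ℚ
      ({Real.sqrt ((n : ℝ) * ε₀ * Real.sqrt (l : ℝ))} : Set ℝ))
    [NumberField K] :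
    twoTorsCard K = 2 ^ (h + s₁ + 2 * s₂) := by
  have hp2 (i) : p i ≠ 2 := fun h => by have := hp4 i; omega
  have hq2 (j) : q j ≠ 2 := fun h => by have := hq4 j; omega
  have hl2 : l ≠ 2 := by omega
  let F : IntermediateField ℚ ℝ := IntermediateField.adjoin ℚ {Real.sqrt (l : ℝ)}
  have hF : Module.finrank ℚ F = 2 := finrank_eq_two_of_eq_adjoin_sqrt hl rfl
  have : NumberField F :=
    { to_charZero := inferInstance
      to_finiteDimensional := Module.finite_of_finrank_eq_succ hF }
  have : Algebra.IsQuadraticExtension ℚ F := { finrank_eq_two' := hF }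
  obtain ⟨r, -, hr⟩ := exists_ringOfIntegers_sq_eq (S := F)
    (IntermediateField.mem_adjoin_simple_self ℚ _)
  have hcard := twoTorsCard_mul_eight hl hl8 hε hεnorm
    (hn ▸ mod_of_prod hδ hsodd hp4 hq4)
    (hn ▸ squarefree_mul_prod hδ hpprime hqprime hpinj hqinj hpq hp2 hq2)
    (hn ▸ not_dvd_mul_prod hl hl2 hδ hpprime hqprime hpl hql) (F := F) rfl hK
  rw [hn, sum_ncard_primesAbove hl hl8 hr hδ hpprime hqprime hpinj hqinj hpq hpl hql hp2 hq2,
    ← hh, ← hs₁, ← hs₂, pow_add] at hcard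
  omega
end

section
/- Suppose n = 1, so that 𝕂 = ℚ(√(ε₀√2)). Then r₂(H) = 0, i.e. the 2-class group of 𝕂 is trivial. -/
open Polynomial NumberField IntermediateField

/-- The minimal polynomial `X⁴ - 4X² + 2` of `√(2 + √2)`. -/
noncomputable def quarticPoly : ℤ[X] := X ^ 4 - C 4 * X ^ 2 + C 2

theorem natDegree_quarticPoly : quarticPoly.natDegree = 4 := by
  unfold quarticPoly
  compute_degree!

theorem monic_quarticPoly : quarticPoly.Monic := by
  unfold quarticPoly
  monicity!

theorem aeval_quarticPoly {R : Type*} [CommRing R] (y : R) :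
    aeval y quarticPoly = y ^ 4 - 4 * y ^ 2 + 2 := by
  simp only [quarticPoly, map_add, map_sub, map_mul, map_pow, aeval_X, aeval_C]
  simp

theorem aeval_derivative_quarticPoly {R : Type*} [CommRing R] (y : R) :
    aeval y (derivative quarticPoly) = 4 * y * (y ^ 2 - 2) := by
  simp only [quarticPoly, derivative_X_pow, derivative_C_mul,
    derivative_C, map_add, map_sub, map_mul, map_pow, aeval_X, aeval_C, map_zero]
  simp
  ring

/-- `X⁴ - 4X² + 2` is irreducible, by Eisenstein's criterion at `2`. -/
theorem irreducible_quarticPoly : Irreducible quarticPoly := by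
  have hc (n : ℕ) : quarticPoly.coeff n =
      (if n = 4 then 1 else 0) - 4 * (if n = 2 then 1 else 0) + (if n = 0 then 2 else 0) := by
    simp only [quarticPoly, coeff_add, coeff_sub, coeff_X_pow, coeff_C_mul, coeff_C]
  have hdeg : quarticPoly.degree = 4 := by
    rw [degree_eq_natDegree monic_quarticPoly.ne_zero, natDegree_quarticPoly]
    rfl
  refine irreducible_of_eisenstein_criterion (P := Ideal.span {2})
    ((Ideal.span_singleton_prime two_ne_zero).2 Int.prime_two) ?_ ?_ ?_ ?_
    monic_quarticPoly.isPrimitive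
  · rw [monic_quarticPoly.leadingCoeff, Ideal.mem_span_singleton]
    decide
  · intro n hn
    have hn4 : n < 4 := by
      rw [hdeg] at hn
      exact_mod_cast hn
    rw [hc, Ideal.mem_span_singleton]
    interval_cases n <;> decide
  · rw [hdeg]
    norm_num
  · rw [hc, Ideal.span_singleton_pow, Ideal.mem_span_singleton]
    decide

section

variable {L : Type*} [Field L] [NumberField L] {x : 𝓞 L}

theorem minpoly_eq_quarticPoly (hx : x ^ 4 - 4 * x ^ 2 + 2 = 0) :
    minpoly ℤ x = quarticPoly := by
  have hint : IsIntegral ℤ x := RingOfIntegers.isIntegral x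
  have hdvd : minpoly ℤ x ∣ quarticPoly :=
    minpoly.isIntegrallyClosed_dvd hint ((aeval_quarticPoly x).trans hx)
  exact eq_of_monic_of_associated (minpoly.monic hint) monic_quarticPoly
    ((irreducible_quarticPoly.dvd_iff.1 hdvd).resolve_left
      (minpoly.not_isUnit ℤ x)).symm

theorem adjoin_eq_top (hgen : ℚ⟮(x : L)⟯ = ⊤) : Algebra.adjoin ℚ {(x : L)} = ⊤ := by
  rw [← IntermediateField.adjoin_simple_toSubalgebra_of_isAlgebraic
    (Algebra.IsAlgebraic.isAlgebraic _), hgen, IntermediateField.top_toSubalgebra]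

theorem finrank_eq_four (hx : x ^ 4 - 4 * x ^ 2 + 2 = 0) (hgen : ℚ⟮(x : L)⟯ = ⊤) :
    Module.finrank ℚ L = 4 := by
  rw [← (Field.primitive_element_iff_minpoly_natDegree_eq ℚ (x : L)).1 hgen,
    minpoly.isIntegrallyClosed_eq_field_fractions' ℚ x.isIntegral_coe,
    (minpoly.monic x.isIntegral_coe).natDegree_map, ← natDegree_quarticPoly,
    ← minpoly_eq_quarticPoly hx, RingOfIntegers.minpoly_coe]

/-- In a quartic field the principal ideal generated by `m : ℕ` has norm `m ^ 4`. -/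
theorem absNorm_span_natCast_of_finrank_eq_four (hrank : Module.finrank ℚ L = 4) (m : ℕ) :
    Ideal.absNorm (Ideal.span {(m : 𝓞 L)}) = m ^ 4 := by
  rw [Ideal.absNorm_span_singleton, ← map_natCast (algebraMap ℤ (𝓞 L)), Algebra.norm_algebraMap,
    RingOfIntegers.rank, hrank]
  simp [Int.natAbs_pow]

theorem absNorm_span_generator (hx : x ^ 4 - 4 * x ^ 2 + 2 = 0)
    (hrank : Module.finrank ℚ L = 4) : Ideal.absNorm (Ideal.span {x}) = 2 := by
  have hu : IsUnit (2 * x ^ 2 - 1) := .of_mul_eq_one (7 - 2 * x ^ 2) (by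
    linear_combination (-4 : 𝓞 L) * hx)
  have h : Ideal.span {x} ^ 4 = Ideal.span {((2 : ℕ) : 𝓞 L)} := by
    rw [Ideal.span_singleton_pow, show x ^ 4 = ((2 : ℕ) : 𝓞 L) * (2 * x ^ 2 - 1) by
      push_cast; linear_combination hx, Ideal.span_singleton_mul_right_unit hu]
  have h' := congrArg Ideal.absNorm h
  rw [map_pow, absNorm_span_natCast_of_finrank_eq_four hrank] at h'
  exact Nat.pow_left_injective (by decide : 4 ≠ 0) h'

theorem natAbs_discr_le (hx : x ^ 4 - 4 * x ^ 2 + 2 = 0) (hgen : ℚ⟮(x : L)⟯ = ⊤) :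
    (discr L).natAbs ≤ 2048 := by
  have hrank := finrank_eq_four hx hgen
  have hsqrt : Ideal.absNorm (Ideal.span {x ^ 2 - 2}) = 4 := by
    have h : Ideal.span {x ^ 2 - 2} ^ 2 = Ideal.span {((2 : ℕ) : 𝓞 L)} := by
      rw [Ideal.span_singleton_pow, show (x ^ 2 - 2) ^ 2 = ((2 : ℕ) : 𝓞 L) by
        push_cast; linear_combination hx]
    have h' := congrArg Ideal.absNorm h
    rw [map_pow, absNorm_span_natCast_of_finrank_eq_four hrank] at h'
    exact Nat.pow_left_injective (by decide : 2 ≠ 0) h'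
  have hmem : 4 * x * (x ^ 2 - 2) ∈ differentIdeal ℤ (𝓞 L) := by
    have h := aeval_derivative_mem_differentIdeal ℤ ℚ L x (adjoin_eq_top hgen)
    rwa [minpoly_eq_quarticPoly hx, aeval_derivative_quarticPoly] at h
  have hdvd := Ideal.absNorm_dvd_absNorm_of_le
    ((Ideal.span_singleton_le_iff_mem _).2 hmem)
  rw [absNorm_differentIdeal L, ← Ideal.span_singleton_mul_span_singleton,
    ← Ideal.span_singleton_mul_span_singleton, map_mul, map_mul, hsqrt,
    absNorm_span_generator hx hrank,
    show (4 : 𝓞 L) = ((4 : ℕ) : 𝓞 L) by norm_num,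
    absNorm_span_natCast_of_finrank_eq_four hrank] at hdvd
  exact Nat.le_of_dvd (by norm_num) hdvd

theorem conj_eq_self_of_quartic {z : ℂ} (hz : z ^ 4 - 4 * z ^ 2 + 2 = 0) :
    (starRingEnd ℂ) z = z := by
  have real_of_sq (r : ℝ) (hr : 0 ≤ r) (h : z ^ 2 = r) : (starRingEnd ℂ) z = z := by
    have : z ^ 2 = ((√r : ℝ) : ℂ) ^ 2 := by
      rw [h, ← Complex.ofReal_pow, Real.sq_sqrt hr]
    rcases sq_eq_sq_iff_eq_or_eq_neg.1 this with h | h <;> simp [h]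
  have h2 : ((√2 : ℝ) : ℂ) ^ 2 = 2 := by
    rw [← Complex.ofReal_pow, Real.sq_sqrt zero_le_two, Complex.ofReal_ofNat]
  have hlt : √2 ≤ 2 := by
    rw [Real.sqrt_le_left zero_le_two]
    norm_num
  have hfac : (z ^ 2 - 2) ^ 2 = ((√2 : ℝ) : ℂ) ^ 2 := by
    rw [h2]
    linear_combination hz
  rcases sq_eq_sq_iff_eq_or_eq_neg.1 hfac with h | h
  · refine real_of_sq (2 + √2) (by positivity) ?_
    push_cast
    linear_combination h
  · refine real_of_sq (2 - √2) (by linarith) ?_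
    push_cast
    linear_combination h

theorem isTotallyReal_of_quartic (hx : x ^ 4 - 4 * x ^ 2 + 2 = 0) (hgen : ℚ⟮(x : L)⟯ = ⊤) :
    IsTotallyReal L where
  isReal v := by
    rw [← v.mk_embedding, InfinitePlace.isReal_mk_iff, ComplexEmbedding.isReal_iff]
    set φ := v.embedding
    have hz : φ x ^ 4 - 4 * φ x ^ 2 + 2 = 0 := by
      have := congrArg (φ.comp (algebraMap (𝓞 L) L)) hx
      simp only [map_add, map_sub, map_mul, map_pow, map_ofNat, map_zero] at this
      exact this
    have halg : (ComplexEmbedding.conjugate φ).toRatAlgHom = φ.toRatAlgHom :=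
      AlgHom.ext_of_adjoin_eq_top (adjoin_eq_top hgen) fun y hy ↦ by
        rw [Set.mem_singleton_iff.1 hy]
        exact conj_eq_self_of_quartic hz
    ext y
    exact DFunLike.congr_fun halg y

/-- A prime of norm at most `4` is generated by `x`. -/
theorem eq_span_of_absNorm_le (hx : x ^ 4 - 4 * x ^ 2 + 2 = 0)
    (hrank : Module.finrank ℚ L = 4) {P : Ideal (𝓞 L)} (hP : P.IsPrime) (hP0 : P ≠ ⊥)
    (hle : Ideal.absNorm P ≤ 4) : P = Ideal.span {x} := by
  have hnorm := absNorm_span_generator hx hrank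
  have hmax : (Ideal.span {x}).IsMaximal := by
    refine (Ideal.isPrime_of_irreducible_absNorm ?_).isMaximal ?_
    · rw [hnorm]
      exact Nat.prime_two
    · rw [ne_eq, ← Ideal.absNorm_eq_zero_iff, hnorm]
      decide
  suffices hxP : x ∈ P from
    (hmax.eq_of_le hP.ne_top ((Ideal.span_singleton_le_iff_mem _).2 hxP)).symm
  have h0 : Ideal.absNorm P ≠ 0 := Ideal.absNorm_eq_zero_iff.not.2 hP0
  have h1 : Ideal.absNorm P ≠ 1 := Ideal.absNorm_eq_one_iff.not.2 hP.ne_top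
  have hmem := Ideal.absNorm_mem P
  suffices h2 : (2 : 𝓞 L) ∈ P by
    refine hP.mem_of_pow_mem 4 ?_
    rw [show x ^ 4 = (2 * x ^ 2 - 1) * 2 by linear_combination hx]
    exact P.mul_mem_left _ h2
  obtain h | h | h : Ideal.absNorm P = 2 ∨ Ideal.absNorm P = 3 ∨ Ideal.absNorm P = 4 := by
    omega
  · simpa [h] using hmem
  · have h3 : (3 : 𝓞 L) ∈ P := by simpa [h] using hmem
    have hfrob : x ^ 3 - x ∈ P := by
      have hPmax := hP.isMaximal hP0
      let := Ideal.Quotient.field P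
      have hcard : Nat.card (𝓞 L ⧸ P) = 3 := h
      have : Finite (𝓞 L ⧸ P) := Nat.finite_of_card_ne_zero (by omega)
      let := Fintype.ofFinite (𝓞 L ⧸ P)
      have := FiniteField.pow_card (Ideal.Quotient.mk P x)
      rw [← Nat.card_eq_fintype_card, hcard] at this
      rwa [← map_pow, Ideal.Quotient.eq] at this
    rw [show (2 : 𝓞 L) = (x ^ 2) * 3 - x * (x ^ 3 - x) by linear_combination hx]
    exact P.sub_mem (P.mul_mem_left _ h3) (P.mul_mem_left _ hfrob)
  · refine hP.mem_of_pow_mem 2 ?_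
    rw [show (2 : 𝓞 L) ^ 2 = 4 by norm_num]
    simpa [h] using hmem

theorem isPrincipalIdealRing_of_quartic (hx : x ^ 4 - 4 * x ^ 2 + 2 = 0)
    (hgen : ℚ⟮(x : L)⟯ = ⊤) : IsPrincipalIdealRing (𝓞 L) := by
  have hrank := finrank_eq_four hx hgen
  have := isTotallyReal_of_quartic hx hgen
  refine RingOfIntegers.isPrincipalIdealRing_of_isPrincipal_of_norm_le_of_isPrime
    fun I hI hle ↦ ?_
  have hle4 : Ideal.absNorm (I : Ideal (𝓞 L)) ≤ 4 := by
    have hd : ((|discr L| : ℤ) : ℝ) ≤ 2048 := by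
      have := natAbs_discr_le hx hgen
      rw [Int.abs_eq_natAbs]
      exact_mod_cast this
    have hs : √((|discr L| : ℤ) : ℝ) < 160 / 3 := by
      rw [Real.sqrt_lt' (by norm_num)]
      exact hd.trans_lt (by norm_num)
    rw [IsTotallyReal.nrComplexPlaces_eq_zero, hrank] at hle
    norm_num [Nat.factorial] at hle hs
    have hlt : ((Ideal.absNorm (I : Ideal (𝓞 L)) : ℕ) : ℝ) < (5 : ℕ) := by
      push_cast
      linarith
    exact Nat.lt_succ_iff.1 (Nat.cast_lt.1 hlt)
  rw [eq_span_of_absNorm_le hx hrank hI (nonZeroDivisors.coe_ne_zero I) hle4]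
  exact ⟨⟨x, rfl⟩⟩

end

/-- for `l = 2`, `ε₀ = 1 + √2` and `n = 1`, the 2-class group of
`𝕂 = ℚ(√(ε₀√2))` is trivial, i.e. `r₂(H) = 0`. -/
theorem stmt_8
    (K : IntermediateField ℚ ℝ)
    (hK : K = IntermediateField.adjoin ℚ
      ({Real.sqrt (((1 : ℝ) + Real.sqrt 2) * Real.sqrt 2)} : Set ℝ))
    [NumberField K] :
    twoTorsCard K = 2 ^ 0 := by
  set a : ℝ := √((1 + √2) * √2) with ha
  have haK : a ∈ K := hK ▸ mem_adjoin_simple_self ℚ a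
  have hsq : a ^ 2 = 2 + √2 := by
    rw [ha, Real.sq_sqrt (by positivity), add_mul, Real.mul_self_sqrt zero_le_two]
    ring
  have haroot : a ^ 4 - 4 * a ^ 2 + 2 = 0 := by
    have h2 : √2 ^ 2 = 2 := Real.sq_sqrt zero_le_two
    linear_combination (a ^ 2 - 2 + √2) * hsq + h2
  have hbroot : (⟨a, haK⟩ : K) ^ 4 - 4 * (⟨a, haK⟩ : K) ^ 2 + 2 = 0 := by
    apply Subtype.ext
    exact haroot
  have hint : IsIntegral ℤ (⟨a, haK⟩ : K) :=
    ⟨quarticPoly, monic_quarticPoly, (aeval_quarticPoly _).trans hbroot⟩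
  have hgen : ℚ⟮(⟨a, haK⟩ : K)⟯ = ⊤ := by
    have h (inst : Algebra ℚ K) :
        @IntermediateField.adjoin ℚ _ K _ inst {⟨a, haK⟩} = ⊤ := by
      obtain rfl : inst = K.algebra' := Subsingleton.elim _ _
      apply IntermediateField.lift_injective
      rw [IntermediateField.lift_adjoin_simple, IntermediateField.lift_top]
      exact hK.symm
    exact h _
  have hpid : IsPrincipalIdealRing (𝓞 K) :=
    isPrincipalIdealRing_of_quartic (x := ⟨⟨a, haK⟩, hint⟩) (RingOfIntegers.ext hbroot) hgen
  have hcard := card_classGroup_eq_one_iff.2 hpid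
  have : Subsingleton (ClassGroup (𝓞 K)) := Fintype.card_le_one_iff_subsingleton.1 hcard.le
  have : Nonempty {x : ClassGroup (𝓞 K) // x ^ 2 = 1} := ⟨1, one_pow 2⟩
  rw [twoTorsCard, pow_zero, Nat.card_unique]
end
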